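/- Let 1 ≤ d ≤ 3 and let A₁,…,A_N be d × d real matrices. If the linear switched system defined by (A₁,…,A_N) is periodically asymptotically stable, then it is globally uniformly exponentially stable. -/

import Mathlib

open scoped NNReal
open Filter Topology MeasureTheory

/-- A switching law: measurable functions `u₁,…,u_N : [0,∞) → [0,1]` with `Σᵢ uᵢ(s) = 1`
for a.e. `s ≥ 0` (the `uᵢ` are extended measurably to all of `ℝ`). -/
def IsSwitchingLaw {N : ℕ} (u : Fin N → ℝ → ℝ) : Prop :=
  (∀ i, Measurable (u i)) ∧
  (∀ᵐ s ∂(volume.restrict (Set.Ici (0 : ℝ))),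
    (∀ i, u i s ∈ Set.Icc (0 : ℝ) 1) ∧ ∑ i, u i s = 1)

/-- `x : [0,∞) → ℝ^d` is the trajectory of the linear switched system defined by the
linear maps `A₁,…,A_N` generated by the switching law `u`. -/
def IsLinTrajectoryWith {d N : ℕ}
    (A : Fin N → EuclideanSpace ℝ (Fin d) →L[ℝ] EuclideanSpace ℝ (Fin d))
    (u : Fin N → ℝ → ℝ) (x : ℝ≥0 → EuclideanSpace ℝ (Fin d)) : Prop :=
  Continuous x ∧ IsSwitchingLaw u ∧
  ∀ t : ℝ≥0, x t = x 0 + ∫ s in Set.Ioc (0 : ℝ) (t : ℝ), ∑ i, u i s • A i (x (Real.toNNReal s))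

/-- The switching law `u` is constant (almost everywhere on `[0,∞)`). -/
def IsConstantLaw {N : ℕ} (u : Fin N → ℝ → ℝ) : Prop :=
  ∃ c : Fin N → ℝ, ∀ i, ∀ᵐ s ∂(volume.restrict (Set.Ici (0 : ℝ))), u i s = c i

/-- The switching law `u` is periodic: for some `p > 0`, `uᵢ(t + p) = uᵢ(t)` a.e. -/
def IsPeriodicLaw {N : ℕ} (u : Fin N → ℝ → ℝ) : Prop :=
  ∃ p : ℝ, 0 < p ∧ ∀ i, ∀ᵐ s ∂(volume.restrict (Set.Ici (0 : ℝ))), u i (s + p) = u i s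

theorem exists_continuous_log_path (c : unitInterval → ℂ) (hc : Continuous c) (h0 : ∀ t, c t ≠ 0) :
    ∃ Γ : unitInterval → ℂ, Continuous Γ ∧ ∀ t, Complex.exp (Γ t) = c t := by
  obtain ⟨Γ, hΓ, -⟩ := Complex.isCoveringMap_exp.exists_path_lifts
    (γ := ⟨fun t => ⟨c t, h0 t⟩, by fun_prop⟩) (e := Complex.log (c 0))
    (by simp [Complex.exp_log (h0 0)])
  refine ⟨Γ, Γ.continuous, fun t => ?_⟩
  have := congrFun hΓ t
  simpa using congrArg Subtype.val this

theorem log_path_increment_unique {Γ₁ Γ₂ : unitInterval → ℂ} (h₁ : Continuous Γ₁)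
    (h₂ : Continuous Γ₂) (h : ∀ t, Complex.exp (Γ₁ t) = Complex.exp (Γ₂ t)) :
    Γ₁ 1 - Γ₁ 0 = Γ₂ 1 - Γ₂ 0 := by
  have key : Γ₁ = fun t => Γ₂ t + (Γ₁ 0 - Γ₂ 0) := by
    refine Complex.isCoveringMap_exp.eq_of_comp_eq h₁ (by fun_prop) ?_ 0 (by simp)
    funext t
    apply Subtype.ext
    have h0 := h 0
    simp only [Function.comp, Complex.exp_add, Complex.exp_sub, h t]
    rw [h0, div_self (Complex.exp_ne_zero _), mul_one]
  have := congrFun key 1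
  rw [this]; ring

theorem exists_log_variation (γ : ℝ → ℂ) (hγ : Continuous γ) {T : ℝ} (hT : 0 ≤ T) :
    ∃ W : ℂ → ℂ, ContinuousOn W (γ '' Set.Icc 0 T)ᶜ ∧
      ∀ p ∉ γ '' Set.Icc 0 T, Complex.exp (W p) = (γ T - p) / (γ 0 - p) := by
  set C := γ '' Set.Icc 0 T with hC
  have hCc : IsClosed C := (isCompact_Icc.image hγ).isClosed
  have hmem : ∀ t : unitInterval, γ (t * T) ∈ C := fun t =>
    ⟨t * T, ⟨mul_nonneg t.2.1 hT, mul_le_of_le_one_left hT t.2.2⟩, rfl⟩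
  have hne : ∀ p ∉ C, ∀ t : unitInterval, γ (t * T) - p ≠ 0 := by
    intro p hp t h
    exact hp (sub_eq_zero.mp h ▸ hmem t)
  have hlog : ∀ p : ℂ, ∃ Γ : unitInterval → ℂ, p ∉ C →
      Continuous Γ ∧ ∀ t : unitInterval, Complex.exp (Γ t) = γ (t * T) - p := by
    intro p
    by_cases hp : p ∈ C
    · exact ⟨fun _ => 0, fun h => absurd hp h⟩
    · obtain ⟨Γ, h⟩ := exists_continuous_log_path (fun t => γ (t * T) - p) (by fun_prop) (hne p hp)
      exact ⟨Γ, fun _ => h⟩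
  choose Γ hΓ using hlog
  refine ⟨fun p => Γ p 1 - Γ p 0, ?_, ?_⟩
  · intro p hp
    obtain ⟨d, hd, hball⟩ := Metric.isOpen_iff.mp hCc.isOpen_compl p hp
    have hlt : ∀ q ∈ Metric.ball p d, ∀ t : unitInterval,
        (γ (t * T) - q) / (γ (t * T) - p) ∈ Complex.slitPlane := by
      intro q hq t
      have h1 := hne p hp t
      have e : (γ (t * T) - q) / (γ (t * T) - p) = 1 + (p - q) / (γ (t * T) - p) := by
        field_simp; ring
      rw [e]
      apply Complex.mem_slitPlane_of_norm_lt_one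
      rw [norm_div, div_lt_one (norm_pos_iff.mpr h1)]
      have : d ≤ ‖γ (t * T) - p‖ := by
        by_contra hlt
        exact hball (by rw [Metric.mem_ball, dist_eq_norm]; exact not_le.mp hlt) (hmem t)
      rw [Metric.mem_ball, dist_comm, dist_eq_norm] at hq
      linarith
    have heq : ∀ q ∈ Metric.ball p d, Γ q 1 - Γ q 0 = Γ p 1 - Γ p 0 +
        (Complex.log ((γ T - q) / (γ T - p)) - Complex.log ((γ 0 - q) / (γ 0 - p))) := by
      intro q hq
      have hqC : q ∉ C := hball hq
      have := log_path_increment_unique (Γ₁ := Γ q)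
        (Γ₂ := fun t => Γ p t + Complex.log ((γ (t * T) - q) / (γ (t * T) - p))) (hΓ q hqC).1
        ((hΓ p hp).1.add (Continuous.clog (Continuous.div (by fun_prop) (by fun_prop)
          (hne p hp)) (hlt q hq))) (by
          intro t
          rw [Complex.exp_add, (hΓ q hqC).2, (hΓ p hp).2, Complex.exp_log
            (Complex.slitPlane_ne_zero (hlt q hq t)), mul_div_cancel₀ _ (hne p hp t)])
      rw [this]
      simp; ring
    have h1 := hne p hp 1
    have h0 := hne p hp 0
    simp only [Set.Icc.coe_one, one_mul, Set.Icc.coe_zero, zero_mul] at h0 h1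
    have hcont : ContinuousAt (fun q => Γ p 1 - Γ p 0 +
        (Complex.log ((γ T - q) / (γ T - p)) - Complex.log ((γ 0 - q) / (γ 0 - p)))) p := by
      refine continuousAt_const.add (ContinuousAt.sub ?_ ?_)
      · refine ContinuousAt.clog (by fun_prop) ?_
        rw [div_self h1]; exact Complex.one_mem_slitPlane
      · refine ContinuousAt.clog (by fun_prop) ?_
        rw [div_self h0]; exact Complex.one_mem_slitPlane
    refine ContinuousAt.continuousWithinAt (hcont.congr ?_)
    filter_upwards [Metric.ball_mem_nhds p hd] with q hq using (heq q hq).symm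
  · intro p hp
    have h1 := (hΓ p hp).2 1
    have h0 := (hΓ p hp).2 0
    simp only [Set.Icc.coe_one, one_mul, Set.Icc.coe_zero, zero_mul] at h0 h1
    rw [Complex.exp_sub, h1, h0]

theorem monotoneOn_Ioi_of_local {F : ℝ → ℝ} {T : ℝ}
    (hl : ∀ t > T, ∀ᶠ s in 𝓝[<] t, F s ≤ F t) (hr : ∀ t > T, ∀ᶠ s in 𝓝[>] t, F t ≤ F s)
    {a b : ℝ} (ha : T < a) (hab : a ≤ b) : F a ≤ F b := by
  set S := {x ∈ Set.Icc a b | ∀ y ∈ Set.Icc a x, F a ≤ F y} with hS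
  have haS : a ∈ S := ⟨⟨le_rfl, hab⟩, fun y hy => by rw [le_antisymm hy.2 hy.1]⟩
  have hbdd : BddAbove S := ⟨b, fun x hx => hx.1.2⟩
  set s := sSup S with hs
  have has : a ≤ s := le_csSup hbdd haS
  have hsb : s ≤ b := csSup_le ⟨a, haS⟩ fun x hx => hx.1.2
  have hlt : ∀ y, a ≤ y → y < s → F a ≤ F y := by
    intro y hay hy
    obtain ⟨x, hx, hyx⟩ := exists_lt_of_lt_csSup ⟨a, haS⟩ hy
    exact hx.2 y ⟨hay, hyx.le⟩
  have hFs : F a ≤ F s := by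
    rcases has.eq_or_lt with h | h
    · rw [← h]
    · have h1 := hl s (ha.trans h)
      have h2 : ∀ᶠ y in 𝓝[<] s, y ∈ Set.Ioo a s := Ioo_mem_nhdsLT h
      obtain ⟨y, hy1, hy2⟩ := (h1.and h2).exists
      exact (hlt y hy2.1.le hy2.2).trans hy1
  rcases hsb.eq_or_lt with h | h
  · rwa [h] at hFs
  · exfalso
    have h1 := hr s (ha.trans_le has)
    obtain ⟨u, hu, hu'⟩ := (mem_nhdsGT_iff_exists_Ioo_subset' h).mp h1
    have hu0 : s < u := hu
    set x := min ((s + u) / 2) b with hx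
    have hsx : s < x := lt_min (by linarith) h
    have hxS : x ∈ S := by
      refine ⟨⟨has.trans hsx.le, min_le_right _ _⟩, fun y hy => ?_⟩
      rcases lt_trichotomy y s with h' | h' | h'
      · exact hlt y hy.1 h'
      · rwa [h']
      · refine hFs.trans (hu' ⟨h', hy.2.trans_lt ((min_le_left _ _).trans_lt (by linarith))⟩)
    exact absurd (le_csSup hbdd hxS) (not_le.mpr hsx)

theorem constOn_of_exp_eq_one {n : ℂ → ℂ} {D : Set ℂ} (hD : IsPreconnected D)
    (hn : ContinuousOn n D) (h : ∀ p ∈ D, Complex.exp (n p) = 1) {p q : ℂ} (hp : p ∈ D)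
    (hq : q ∈ D) : n p = n q :=
  Complex.isCoveringMap_exp.constOn_of_comp hD hn
    (fun a ha b hb => Subtype.ext (by simp [h a ha, h b hb])) hp hq

theorem planar_crossing_contradiction {γ : ℝ → ℂ} (hc : Continuous γ)
    (hinj : Function.Injective γ) (h0 : γ 0 = 0) {r T β : ℝ} (hT : 0 < T) (hβ : 0 < β)
    (hβr : β < r) (hγT : γ T = Complex.I * β)
    (hcross : ∀ t, ‖γ t‖ < r → (γ t).re = 0 →
      (∀ᶠ s in 𝓝[<] t, (γ s).re < 0) ∧ ∀ᶠ s in 𝓝[>] t, 0 < (γ s).re)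
    (hfree : ∀ t ∈ Set.Ioo 0 T, (γ t).re = 0 → ¬ (0 ≤ (γ t).im ∧ (γ t).im ≤ β))
    (hrec : ∀ s, ∀ ε > 0, ∀ N, ∃ t > N, ‖γ t - γ s‖ < ε) : False := by
  obtain ⟨W, hWc, hWe⟩ := exists_log_variation γ hc hT.le
  set C := γ '' Set.Icc 0 T with hC
  have hCc : IsClosed C := (isCompact_Icc.image hc).isClosed
  have hCo : IsOpen Cᶜ := hCc.isOpen_compl
  have h0C : (0 : ℂ) ∈ C := ⟨0, ⟨le_rfl, hT.le⟩, h0⟩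
  have hTC : Complex.I * β ∈ C := ⟨T, ⟨hT.le, le_rfl⟩, hγT⟩
  set R : ℂ → ℂ := fun p => p / (Complex.I * β - p) with hR
  have hden : ∀ p ∉ C, Complex.I * β - p ≠ 0 := fun p hp h => hp (sub_eq_zero.mp h ▸ hTC)
  have hRne : ∀ p ∉ C, R p ≠ 0 := fun p hp =>
    div_ne_zero (fun h => hp (h ▸ h0C)) (hden p hp)
  have hRim : ∀ p : ℂ, (R p).im = - (p.re * β) / Complex.normSq (Complex.I * β - p) := by
    intro p
    simp only [hR, Complex.div_im]
    simp
    ring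
  have hRre : ∀ p : ℂ, (R p).re =
      (p.im * (β - p.im) - p.re ^ 2) / Complex.normSq (Complex.I * β - p) := by
    intro p
    simp only [hR, Complex.div_re]
    simp
    ring
  have hpos : ∀ p ∉ C, 0 < Complex.normSq (Complex.I * β - p) := fun p hp =>
    Complex.normSq_pos.mpr (hden p hp)
  have hRc : ∀ p ∉ C, ContinuousAt R p := fun p hp =>
    continuousAt_id.div (by fun_prop) (hden p hp)
  have hWc' : ∀ p ∉ C, ContinuousAt W p := fun p hp => hWc.continuousAt (hCo.mem_nhds hp)
  -- the two branches
  set n : ℂ → ℂ := fun p => W p + Complex.log (-R p) with hn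
  set m : ℂ → ℂ := fun p => W p + Complex.log (R p) + Real.pi * Complex.I with hm
  have hWR : ∀ p ∉ C, Complex.exp (W p) * R p = -1 := by
    intro p hp
    have hp0 : p ≠ 0 := fun h => hp (h ▸ h0C)
    rw [hWe p hp, h0, hγT]
    simp only [hR]
    have := hden p hp
    field_simp
    simp
  have hne1 : ∀ p ∉ C, Complex.exp (n p) = 1 := by
    intro p hp
    simp only [hn]
    rw [Complex.exp_add, Complex.exp_log (neg_ne_zero.mpr (hRne p hp)), mul_neg, hWR p hp, neg_neg]
  have hme1 : ∀ p ∉ C, Complex.exp (m p) = 1 := by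
    intro p hp
    simp only [hm]
    rw [Complex.exp_add, Complex.exp_add, Complex.exp_log (hRne p hp), hWR p hp,
      Complex.exp_pi_mul_I]
    norm_num
  have hnc : ∀ p ∉ C, (p.re = 0 → ¬ (0 ≤ p.im ∧ p.im ≤ β)) → ContinuousAt n p := by
    intro p hp hσ
    refine (hWc' p hp).add (ContinuousAt.clog (hRc p hp).neg ?_)
    rw [Complex.mem_slitPlane_iff, Complex.neg_re, Complex.neg_im, hRim, hRre]
    by_cases ha : p.re = 0
    · left
      rw [← neg_div]
      refine div_pos ?_ (hpos p hp)
      have := hσ ha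
      rw [not_and_or, not_le, not_le] at this
      rw [ha]
      rcases this with h | h <;> nlinarith
    · right
      exact neg_ne_zero.mpr (div_ne_zero (neg_ne_zero.mpr (mul_ne_zero ha hβ.ne')) (hpos p hp).ne')
  have hmc : ∀ p ∉ C, (p.re = 0 → 0 < p.im ∧ p.im < β) → ContinuousAt m p := by
    intro p hp hσ
    refine ((hWc' p hp).add (ContinuousAt.clog (hRc p hp) ?_)).add continuousAt_const
    rw [Complex.mem_slitPlane_iff, hRim, hRre]
    by_cases ha : p.re = 0
    · left
      refine div_pos ?_ (hpos p hp)
      have := hσ ha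
      rw [ha]
      nlinarith
    · right
      exact div_ne_zero (neg_ne_zero.mpr (mul_ne_zero ha hβ.ne')) (hpos p hp).ne'
  have hnm_neg : ∀ p ∉ C, p.re < 0 → (n p).im = (m p).im - 2 * Real.pi := by
    intro p hp ha
    simp only [hn, hm, Complex.add_im, Complex.log_im]
    rw [Complex.arg_neg_eq_arg_sub_pi_of_im_pos (by
      rw [hRim]; exact div_pos (by nlinarith) (hpos p hp))]
    simp; ring
  have hnm_pos : ∀ p ∉ C, 0 < p.re → (n p).im = (m p).im := by
    intro p hp ha
    simp only [hn, hm, Complex.add_im, Complex.log_im]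
    rw [Complex.arg_neg_eq_arg_add_pi_of_im_neg (by
      rw [hRim]; exact div_neg_of_neg_of_pos (by nlinarith) (hpos p hp))]
    simp; ring
  have hnm_zero : ∀ p ∉ C, p.re = 0 → 0 < p.im → p.im < β → (n p).im = (m p).im := by
    intro p hp ha h1 h2
    have e1 : (R p).im = 0 := by rw [hRim, ha]; simp
    have e2 : 0 < (R p).re := by
      rw [hRre, ha]; exact div_pos (by nlinarith) (hpos p hp)
    simp only [hn, hm, Complex.add_im, Complex.log_im]
    rw [Complex.arg_eq_pi_iff.mpr ⟨by simpa using e2, by simpa using e1⟩,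
      Complex.arg_eq_zero_iff.mpr ⟨e2.le, e1⟩]
    simp
  have hσC : ∀ p ∉ C, 0 ≤ p.im → p.im ≤ β → p.re = 0 → 0 < p.im ∧ p.im < β := by
    intro p hp h1 h2 h3
    refine ⟨h1.lt_of_ne fun h => hp ?_, h2.lt_of_ne fun h => hp ?_⟩
    · rwa [show p = 0 from Complex.ext (by simpa using h3) (by simpa using h.symm)]
    · rwa [show p = Complex.I * β from Complex.ext (by simpa using h3) (by simpa using h)]
  have hloc_const : ∀ (f : ℂ → ℂ), (∀ p ∉ C, Complex.exp (f p) = 1) → ∀ p ∉ C,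
      (∀ᶠ q in 𝓝 p, ContinuousAt f q) → ∀ᶠ q in 𝓝 p, f q = f p := by
    intro f hf p hp hcont
    obtain ⟨ε, hε, hball⟩ := Metric.eventually_nhds_iff_ball.mp (hcont.and (hCo.mem_nhds hp))
    filter_upwards [Metric.ball_mem_nhds p hε] with q hq
    exact constOn_of_exp_eq_one (convex_ball p ε).isPreconnected
      (fun z hz => (hball z hz).1.continuousWithinAt) (fun z hz => hf z (hball z hz).2) hq
      (Metric.mem_ball_self hε)
  have hσcl : IsClosed {p : ℂ | p.re = 0 ∧ 0 ≤ p.im ∧ p.im ≤ β} :=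
    (isClosed_eq Complex.continuous_re continuous_const).inter
      ((isClosed_le continuous_const Complex.continuous_im).inter
        (isClosed_le Complex.continuous_im continuous_const))
  have hnloc : ∀ p ∉ C, (p.re = 0 → ¬ (0 ≤ p.im ∧ p.im ≤ β)) → ∀ᶠ q in 𝓝 p, n q = n p := by
    intro p hp hσ
    refine hloc_const n hne1 p hp ?_
    have h1 : p ∈ {p : ℂ | p.re = 0 ∧ 0 ≤ p.im ∧ p.im ≤ β}ᶜ := fun h => hσ h.1 h.2
    filter_upwards [hCo.mem_nhds hp, hσcl.isOpen_compl.mem_nhds h1] with q hq1 hq2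
    exact hnc q hq1 fun h h' => hq2 ⟨h, h'⟩
  have hmloc : ∀ p ∉ C, 0 < p.im → p.im < β → ∀ᶠ q in 𝓝 p, m q = m p := by
    intro p hp h1 h2
    refine hloc_const m hme1 p hp ?_
    filter_upwards [hCo.mem_nhds hp,
      (isOpen_lt continuous_const Complex.continuous_im).mem_nhds h1,
      (isOpen_lt Complex.continuous_im continuous_const).mem_nhds h2] with q hq1 hq2 hq3
    exact hmc q hq1 fun _ => ⟨hq2, hq3⟩
  have hγC : ∀ t > T, γ t ∉ C := by
    rintro t ht ⟨s, hs, hst⟩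
    rw [hinj hst] at hs
    exact absurd hs.2 (not_le.mpr ht)
  have hγC' : ∀ t < 0, γ t ∉ C := by
    rintro t ht ⟨s, hs, hst⟩
    rw [hinj hst] at hs
    exact absurd hs.1 (not_le.mpr ht)
  -- monotonicity along the curve
  have hmono : ∀ {a b : ℝ}, T < a → a ≤ b → (n (γ a)).im ≤ (n (γ b)).im := by
    have key : ∀ t > T, (∀ᶠ s in 𝓝[<] t, (n (γ s)).im ≤ (n (γ t)).im) ∧
        ∀ᶠ s in 𝓝[>] t, (n (γ t)).im ≤ (n (γ s)).im := by
      intro t ht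
      have hp := hγC t ht
      by_cases hσ : (γ t).re = 0 ∧ 0 ≤ (γ t).im ∧ (γ t).im ≤ β
      · obtain ⟨h1, h2⟩ := hσC _ hp hσ.2.1 hσ.2.2 hσ.1
        have hnorm : ‖γ t‖ < r := by
          have : γ t = ((γ t).im : ℂ) * Complex.I := Complex.ext (by simp [hσ.1]) (by simp)
          rw [this, norm_mul, Complex.norm_I, mul_one, Complex.norm_real, Real.norm_eq_abs,
            abs_of_pos h1]
          linarith
        obtain ⟨hb, ha⟩ := hcross t hnorm hσ.1
        have hml := hc.continuousAt.eventually (hmloc _ hp h1 h2)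
        have hCl := hc.continuousAt.eventually (hCo.mem_nhds hp)
        have hnt := hnm_zero _ hp hσ.1 h1 h2
        constructor
        · filter_upwards [hb, nhdsWithin_le_nhds hml, nhdsWithin_le_nhds hCl] with s h3 h4 h5
          rw [hnm_neg _ h5 h3, hnt, h4]
          linarith [Real.pi_pos]
        · filter_upwards [ha, nhdsWithin_le_nhds hml, nhdsWithin_le_nhds hCl] with s h3 h4 h5
          rw [hnm_pos _ h5 h3, hnt, h4]
      · have := hc.continuousAt.eventually (hnloc _ hp fun h h' => hσ ⟨h, h'⟩)
        constructor
        · filter_upwards [nhdsWithin_le_nhds this] with s hs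
          rw [hs]
        · filter_upwards [nhdsWithin_le_nhds this] with s hs
          rw [hs]
    intro a b ha hab
    exact monotoneOn_Ioi_of_local (F := fun t => (n (γ t)).im) (fun t ht => (key t ht).1)
      (fun t ht => (key t ht).2) ha hab
  -- half balls at the endpoints of the section
  have hr0 : 0 < r := hβ.trans hβr
  have hTn : ‖γ T‖ < r := by
    rw [hγT, norm_mul, Complex.norm_I, one_mul, Complex.norm_real, Real.norm_eq_abs,
      abs_of_pos hβ]; exact hβr
  obtain ⟨hcr0l, hcr0r⟩ := hcross 0 (by rw [h0]; simpa using hr0) (by simp [h0])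
  obtain ⟨hcrTl, hcrTr⟩ := hcross T hTn (by rw [hγT]; simp)
  have hhalf0 : ∀ᶠ p in 𝓝 (0 : ℂ), p.re < 0 → p ∉ C := by
    obtain ⟨u, hu, hu'⟩ := (mem_nhdsGT_iff_exists_Ioo_subset' hT).mp hcr0r
    have hu0 : 0 < u := hu
    have hcl : IsClosed (γ '' Set.Icc u T) := (isCompact_Icc.image hc).isClosed
    have : (0 : ℂ) ∉ γ '' Set.Icc u T := by
      rintro ⟨s, hs, hs'⟩
      rw [← h0] at hs'
      have := hinj hs'
      linarith [hs.1]
    filter_upwards [hcl.isOpen_compl.mem_nhds this] with p hp hre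
    rintro ⟨s, hs, rfl⟩
    rcases hs.1.eq_or_lt with h | h
    · rw [← h, h0] at hre; simp at hre
    · rcases lt_or_ge s u with h' | h'
      · have : 0 < (γ s).re := hu' ⟨h, h'⟩
        linarith
      · exact hp ⟨s, ⟨h', hs.2⟩, rfl⟩
  have hhalfT : ∀ᶠ p in 𝓝 (Complex.I * β), 0 < p.re → p ∉ C := by
    obtain ⟨u, hu, hu'⟩ := (mem_nhdsLT_iff_exists_Ioo_subset' hT).mp hcrTl
    have hu0 : u < T := hu
    have hcl : IsClosed (γ '' Set.Icc 0 u) := (isCompact_Icc.image hc).isClosed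
    have : Complex.I * β ∉ γ '' Set.Icc 0 u := by
      rintro ⟨s, hs, hs'⟩
      rw [← hγT] at hs'
      have := hinj hs'
      linarith [hs.2]
    filter_upwards [hcl.isOpen_compl.mem_nhds this] with p hp hre
    rintro ⟨s, hs, rfl⟩
    rcases hs.2.eq_or_lt with h | h
    · rw [h, hγT] at hre; simp at hre
    · rcases lt_or_ge u s with h' | h'
      · have : (γ s).re < 0 := hu' ⟨h', h⟩
        linarith
      · exact hp ⟨s, ⟨hs.1, h'⟩, rfl⟩
  obtain ⟨ρ₀, hρ₀, hb0⟩ := Metric.eventually_nhds_iff_ball.mp hhalf0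
  obtain ⟨ρ₁, hρ₁, hbT⟩ := Metric.eventually_nhds_iff_ball.mp hhalfT
  set ρ := min (min ρ₀ ρ₁) β with hρ
  have hρpos : 0 < ρ := lt_min (lt_min hρ₀ hρ₁) hβ
  have hρ0 : ρ ≤ ρ₀ := (min_le_left _ _).trans (min_le_left _ _)
  have hρ1 : ρ ≤ ρ₁ := (min_le_left _ _).trans (min_le_right _ _)
  have hρβ : ρ ≤ β := min_le_right _ _
  -- the tube around the middle of the section
  have hseg : IsCompact ((fun b : ℝ => Complex.I * b) '' Set.Icc (ρ / 2) (β - ρ / 2)) :=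
    isCompact_Icc.image (by fun_prop)
  have hsegC : (fun b : ℝ => Complex.I * b) '' Set.Icc (ρ / 2) (β - ρ / 2) ⊆ Cᶜ := by
    rintro _ ⟨b, hb, rfl⟩ ⟨s, hs, hs'⟩
    have hre : (γ s).re = 0 := by rw [hs']; simp
    have him : (γ s).im = b := by rw [hs']; simp
    rcases hs.1.eq_or_lt with h | h
    · rw [← h, h0] at him
      simp at him
      linarith [hb.1]
    · rcases hs.2.eq_or_lt with h' | h'
      · rw [h', hγT] at him
        simp at him
        linarith [hb.2]
      · exact hfree s ⟨h, h'⟩ hre (by rw [him]; exact ⟨by linarith [hb.1], by linarith [hb.2]⟩)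
  obtain ⟨κ, hκ, htube⟩ := hseg.exists_thickening_subset_open hCo hsegC
  set D₁ : Set ℂ := Metric.ball 0 ρ ∩ {p | p.re < 0} with hD₁
  set D₂ : Set ℂ := {p | -κ < p.re} ∩ {p | p.re < κ} ∩ ({p | ρ / 2 ≤ p.im} ∩ {p | p.im ≤ β - ρ / 2})
    with hD₂
  set D₃ : Set ℂ := Metric.ball (Complex.I * β) ρ ∩ {p | 0 < p.re} with hD₃
  have hD₁c : IsPreconnected D₁ :=
    ((convex_ball _ _).inter (convex_halfSpace_re_lt 0)).isPreconnected
  have hD₃c : IsPreconnected D₃ :=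
    ((convex_ball _ _).inter (convex_halfSpace_re_gt 0)).isPreconnected
  have hD₂c : IsPreconnected D₂ :=
    (((convex_halfSpace_re_gt _).inter (convex_halfSpace_re_lt _)).inter
      ((convex_halfSpace_im_ge _).inter (convex_halfSpace_im_le _))).isPreconnected
  have hD₁C : ∀ p ∈ D₁, p ∉ C := fun p hp => hb0 p (Metric.ball_subset_ball hρ0 hp.1) hp.2
  have hD₃C : ∀ p ∈ D₃, p ∉ C := fun p hp => hbT p (Metric.ball_subset_ball hρ1 hp.1) hp.2
  have hD₂C : ∀ p ∈ D₂, p ∉ C := by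
    intro p hp
    refine htube (Metric.mem_thickening_iff.mpr ⟨Complex.I * p.im, ⟨p.im, hp.2, rfl⟩, ?_⟩)
    have : p - Complex.I * p.im = (p.re : ℂ) := Complex.ext (by simp) (by simp)
    rw [dist_eq_norm, this, Complex.norm_real, Real.norm_eq_abs, abs_lt]
    exact hp.1
  have hm₁ : ∀ p ∈ D₁, ∀ q ∈ D₁, m p = m q := fun p hp q hq => constOn_of_exp_eq_one hD₁c
    (fun z hz => (hmc z (hD₁C z hz) fun h => absurd hz.2 (by simp [h])).continuousWithinAt)
    (fun z hz => hme1 z (hD₁C z hz)) hp hq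
  have hm₃ : ∀ p ∈ D₃, ∀ q ∈ D₃, m p = m q := fun p hp q hq => constOn_of_exp_eq_one hD₃c
    (fun z hz => (hmc z (hD₃C z hz) fun h => absurd hz.2 (by simp [h])).continuousWithinAt)
    (fun z hz => hme1 z (hD₃C z hz)) hp hq
  have hm₂ : ∀ p ∈ D₂, ∀ q ∈ D₂, m p = m q := fun p hp q hq => constOn_of_exp_eq_one hD₂c
    (fun z hz => (hmc z (hD₂C z hz) fun _ =>
      ⟨by have := hz.2.1; simp only [Set.mem_ofPred_eq] at this; linarith,
        by have := hz.2.2; simp only [Set.mem_ofPred_eq] at this; linarith⟩).continuousWithinAt)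
    (fun z hz => hme1 z (hD₂C z hz)) hp hq
  set κ' := min κ (ρ / 2) / 2 with hκ'
  have hκ'pos : 0 < κ' := by positivity
  have hκ'κ : κ' < κ := by have := min_le_left κ (ρ / 2); linarith
  have hκ'ρ : κ' < ρ / 2 := by have := min_le_right κ (ρ / 2); linarith
  set p₁ : ℂ := ⟨-κ', ρ / 2⟩ with hp₁
  set p₂ : ℂ := ⟨κ', β - ρ / 2⟩ with hp₂
  have hp₁D₁ : p₁ ∈ D₁ := by
    refine ⟨?_, by simp [hp₁, hκ'pos]⟩
    rw [mem_ball_zero_iff]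
    refine (Complex.norm_le_abs_re_add_abs_im _).trans_lt ?_
    simp only [hp₁]
    rw [abs_neg, abs_of_pos hκ'pos, abs_of_pos (by linarith)]
    linarith
  have hp₂D₃ : p₂ ∈ D₃ := by
    refine ⟨?_, by simp [hp₂, hκ'pos]⟩
    rw [Metric.mem_ball, dist_eq_norm]
    refine (Complex.norm_le_abs_re_add_abs_im _).trans_lt ?_
    simp only [hp₂, Complex.sub_re, Complex.sub_im, Complex.mul_re, Complex.mul_im, Complex.I_re,
      Complex.I_im, Complex.ofReal_re, Complex.ofReal_im]
    rw [show κ' - (0 * β - 1 * 0) = κ' by ring,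
      show β - ρ / 2 - (0 * 0 + 1 * β) = -(ρ / 2) by ring, abs_neg, abs_of_pos hκ'pos,
      abs_of_pos (by linarith)]
    linarith
  have hp₁D₂ : p₁ ∈ D₂ := by
    simp only [hD₂, hp₁, Set.mem_inter_iff, Set.mem_ofPred_eq]
    refine ⟨⟨by linarith, by linarith⟩, by linarith, by linarith⟩
  have hp₂D₂ : p₂ ∈ D₂ := by
    simp only [hD₂, hp₂, Set.mem_inter_iff, Set.mem_ofPred_eq]
    refine ⟨⟨by linarith, by linarith⟩, by linarith, by linarith⟩
  have A0 : ∀ᶠ x in 𝓝[<] (0 : ℝ), γ x ∈ Metric.ball (γ 0) ρ :=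
    nhdsWithin_le_nhds (hc.continuousAt.eventually (Metric.ball_mem_nhds _ hρpos))
  have A1 : ∀ᶠ x in 𝓝[>] T, γ x ∈ Metric.ball (γ T) ρ :=
    nhdsWithin_le_nhds (hc.continuousAt.eventually (Metric.ball_mem_nhds _ hρpos))
  obtain ⟨s, hs1, hs2, hs3⟩ := (hcr0l.and (A0.and self_mem_nhdsWithin)).exists
  obtain ⟨τ, hτ1, hτ2, hτ3⟩ := (hcrTr.and (A1.and self_mem_nhdsWithin)).exists
  rw [h0] at hs2
  rw [hγT] at hτ2
  have hs3' : s < 0 := hs3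
  have hτ3' : T < τ := hτ3
  have e1 : (n (γ τ)).im = (n (γ s)).im + 2 * Real.pi := by
    rw [hnm_pos _ (hγC τ hτ3) hτ1, hnm_neg _ (hγC' s hs3) hs1,
      hm₃ _ ⟨hτ2, hτ1⟩ _ hp₂D₃, hm₂ _ hp₂D₂ _ hp₁D₂, hm₁ _ hp₁D₁ _ ⟨hs2, hs1⟩]
    ring
  obtain ⟨ε, hε, hn_ball⟩ := Metric.eventually_nhds_iff_ball.mp
    (hnloc (γ s) (hγC' s hs3) fun h => absurd hs1 (by simp [h]))
  obtain ⟨t, ht, htε⟩ := hrec s ε hε τ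
  have e2 := hn_ball (γ t) (by rwa [Metric.mem_ball, dist_eq_norm])
  have e3 := hmono hτ3' ht.le
  rw [e2] at e3
  linarith [Real.pi_pos]

theorem no_recurrent_crossing {γ : ℝ → ℂ} (hc : Continuous γ)
    (hinj : Function.Injective γ) (h0 : γ 0 = 0) {r : ℝ} (hr : 0 < r)
    (hcross : ∀ t, ‖γ t‖ < r → (γ t).re = 0 →
      (∀ᶠ s in 𝓝[<] t, (γ s).re < 0) ∧ ∀ᶠ s in 𝓝[>] t, 0 < (γ s).re)
    (hret : ∀ ε > 0, ∃ t > 0, (γ t).re = 0 ∧ ‖γ t‖ < ε)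
    (hrec : ∀ s, ∀ ε > 0, ∀ N, ∃ t > N, ‖γ t - γ s‖ < ε) : False := by
  obtain ⟨t₁, ht₁, hre₁, hn₁⟩ := hret r hr
  obtain ⟨δ, hδ, hδ'⟩ := (mem_nhdsGT_iff_exists_Ioo_subset (a := (0 : ℝ))).mp
    (hcross 0 (by simpa [h0] using hr) (by simp [h0])).2
  have hδ0 : (0 : ℝ) < δ := hδ
  set Z := Set.Icc δ t₁ ∩ {t | (γ t).re = 0 ∧ ‖γ t‖ ≤ ‖γ t₁‖} with hZ
  have hZc : IsCompact Z := isCompact_Icc.inter_right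
    ((isClosed_eq (Complex.continuous_re.comp hc) continuous_const).inter
      (isClosed_le hc.norm continuous_const))
  have hδt : ∀ t, 0 < t → (γ t).re = 0 → δ ≤ t := by
    intro t ht htr
    by_contra! h
    have h2 : t ∈ {x | 0 < (γ x).re} := hδ' ⟨ht, h⟩
    have h3 : 0 < (γ t).re := h2
    linarith
  obtain ⟨T, hTZ, hTmin⟩ := hZc.exists_isLeast ⟨t₁, ⟨hδt t₁ ht₁ hre₁, le_rfl⟩, hre₁, le_rfl⟩
  have hT0 : 0 < T := hδ0.trans_le hTZ.1.1
  have hTre : (γ T).re = 0 := hTZ.2.1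
  have hTn : ‖γ T‖ ≤ ‖γ t₁‖ := hTZ.2.2
  have hnorm : ∀ t, (γ t).re = 0 → ‖γ t‖ = |(γ t).im| := fun t ht => by
    rw [← Complex.abs_im_eq_norm.mpr ht]
  have him : (γ T).im ≠ 0 := fun h => hT0.ne' (hinj (by
    rw [h0]; exact Complex.ext hTre h))
  have hfree : ∀ t ∈ Set.Ioo 0 T, (γ t).re = 0 → |(γ t).im| ≤ |(γ T).im| → False := by
    intro t ht htr htn
    have : T ≤ t := hTmin ⟨⟨hδt t ht.1 htr, ht.2.le.trans hTZ.1.2⟩, htr,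
      by rw [hnorm t htr]; exact htn.trans (by rw [← hnorm T hTre]; exact hTn)⟩
    linarith [ht.2]
  have hlt : |(γ T).im| < r := by rw [← hnorm T hTre]; exact hTn.trans_lt hn₁
  rcases him.lt_or_gt with h | h
  · refine planar_crossing_contradiction (γ := fun t => starRingEnd ℂ (γ t)) (r := r) (T := T)
      (β := -(γ T).im) (Complex.continuous_conj.comp hc)
      ((starRingEnd ℂ).injective.comp hinj) (by simp [h0]) hT0 (by linarith)
      (by rwa [abs_of_neg h] at hlt) ?_ ?_ ?_ ?_
    · refine Complex.ext (by simp [hTre]) (by simp)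
    · intro t ht htr
      simp only [RCLike.norm_conj, Complex.conj_re] at *
      exact hcross t ht htr
    · intro t ht htr hh
      simp only [Complex.conj_re, Complex.conj_im] at htr hh
      refine hfree t ht htr ?_
      rw [abs_of_neg h, abs_le]
      constructor <;> linarith [hh.1, hh.2]
    · intro s ε hε N
      obtain ⟨t, ht, hts⟩ := hrec s ε hε N
      exact ⟨t, ht, by rwa [← map_sub, RCLike.norm_conj]⟩
  · refine planar_crossing_contradiction hc hinj h0 hT0 h (by rwa [abs_of_pos h] at hlt) ?_
      hcross ?_ hrec
    · refine Complex.ext (by simp [hTre]) (by simp)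
    · intro t ht htr hh
      refine hfree t ht htr ?_
      rw [abs_of_pos h, abs_of_nonneg hh.1]
      exact hh.2

/-- A family `S t` of linear maps, the evolution operators of length `t`, with generators `K`. -/
structure IsEvolution {E : Type*} [NormedAddCommGroup E] [NormedSpace ℝ E]
    (S : ℝ → Set (E →L[ℝ] E)) (K : Set (E →L[ℝ] E)) : Prop where
  one_mem : 1 ∈ S 0
  mul_mem : ∀ s t X Y, 0 ≤ s → 0 ≤ t → X ∈ S s → Y ∈ S t → Y * X ∈ S (s + t)
  path : ∀ T X, 0 ≤ T → X ∈ S T → ∃ P : ℝ → E →L[ℝ] E, P 0 = 1 ∧ P T = X ∧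
    ∀ s t, 0 ≤ s → s ≤ t → t ≤ T → ∃ Q ∈ S (t - s), P t = Q * P s
  isCompact : ∀ t, 0 ≤ t → IsCompact (S t)
  isCompact_gen : IsCompact K
  convex_gen : Convex ℝ K
  approx : ∃ c, 0 ≤ c ∧ ∀ t, 0 ≤ t → t ≤ 1 → ∀ X ∈ S t, ∃ A ∈ K, ‖X - 1 - t • A‖ ≤ c * t ^ 2
  flow : ∀ A ∈ K, ∃ e : ℝ → E →L[ℝ] E, e 0 = 1 ∧ (∀ t, 0 ≤ t → e t ∈ S t) ∧
    ∀ t, 0 ≤ t → HasDerivWithinAt e (e t * A) (Set.Ici 0) t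

/-- All evolution operators of positive length are power stable. -/
def PowerStable {E : Type*} [NormedAddCommGroup E] [NormedSpace ℝ E]
    (S : ℝ → Set (E →L[ℝ] E)) : Prop :=
  ∀ T, 0 < T → ∀ X ∈ S T, Tendsto (fun n : ℕ => X ^ n) atTop (𝓝 0)

/-- The evolution operators of length `t` have norm `O(exp (a * t))`. -/
def ExpBound {E : Type*} [NormedAddCommGroup E] [NormedSpace ℝ E]
    (S : ℝ → Set (E →L[ℝ] E)) (a : ℝ) : Prop :=
  ∃ C, 0 < C ∧ ∀ t, 0 ≤ t → ∀ X ∈ S t, ‖X‖ ≤ C * Real.exp (a * t)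

theorem ExpBound.mono {E : Type*} [NormedAddCommGroup E] [NormedSpace ℝ E]
    {S : ℝ → Set (E →L[ℝ] E)} {a b : ℝ} (h : ExpBound S a) (hab : a ≤ b) : ExpBound S b := by
  obtain ⟨C, hC, h⟩ := h
  refine ⟨C, hC, fun t ht X hX => (h t ht X hX).trans ?_⟩
  gcongr

theorem abs_exp_sub_one_sub_le (x : ℝ) :
    |Real.exp x - 1 - x| ≤ |x| ^ 2 * (2 * Real.exp |x|) := by
  have h1 : 1 ≤ Real.exp |x| := Real.one_le_exp (abs_nonneg x)
  rcases le_or_gt |x| 1 with h | h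
  · refine (Real.abs_exp_sub_one_sub_id_le h).trans ?_
    rw [sq_abs]
    nlinarith [sq_nonneg x]
  · have h2 : |Real.exp x - 1 - x| ≤ 2 * Real.exp |x| := by
      have h3 : Real.exp x ≤ Real.exp |x| := Real.exp_le_exp.mpr (le_abs_self x)
      have h4 := Real.add_one_le_exp |x|
      have h5 := Real.exp_pos x
      rw [abs_le]
      constructor <;> linarith [le_abs_self x, neg_abs_le x]
    refine h2.trans (le_mul_of_one_le_left (by positivity) ?_)
    nlinarith

namespace IsEvolution

variable {E : Type*} [NormedAddCommGroup E] [NormedSpace ℝ E]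
  {S : ℝ → Set (E →L[ℝ] E)} {K : Set (E →L[ℝ] E)}

theorem split (h : IsEvolution S K) {s t : ℝ} (hs : 0 ≤ s) (ht : 0 ≤ t) {X : E →L[ℝ] E}
    (hX : X ∈ S (s + t)) : ∃ Y ∈ S s, ∃ Z ∈ S t, X = Z * Y := by
  obtain ⟨P, h0, h1, hP⟩ := h.path _ X (by positivity) hX
  obtain ⟨Y, hY, hY'⟩ := hP 0 s le_rfl hs (by linarith)
  obtain ⟨Z, hZ, hZ'⟩ := hP s (s + t) hs (by linarith) le_rfl
  rw [sub_zero] at hY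
  rw [add_sub_cancel_left] at hZ
  refine ⟨Y, hY, Z, hZ, ?_⟩
  rw [← h1, hZ', hY', h0, mul_one]

theorem pow_mem (h : IsEvolution S K) {t : ℝ} (ht : 0 ≤ t) {X : E →L[ℝ] E} (hX : X ∈ S t)
    (n : ℕ) : X ^ n ∈ S (n * t) := by
  induction n with
  | zero => simpa using h.one_mem
  | succ n ih =>
    rw [pow_succ', Nat.cast_succ, add_mul, one_mul]
    exact h.mul_mem _ _ _ _ (by positivity) ht ih hX

theorem nonempty (h : IsEvolution S K) {t : ℝ} (ht : 0 ≤ t) : (S t).Nonempty := by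
  obtain ⟨c, -, hc⟩ := h.approx
  obtain ⟨A, hA, -⟩ := hc 0 le_rfl zero_le_one 1 h.one_mem
  obtain ⟨e, -, he, -⟩ := h.flow A hA
  exact ⟨e t, he t ht⟩

theorem eq_one (h : IsEvolution S K) {X : E →L[ℝ] E} (hX : X ∈ S 0) : X = 1 := by
  obtain ⟨c, -, hc⟩ := h.approx
  obtain ⟨A, hA, hb⟩ := hc 0 le_rfl zero_le_one X hX
  simpa [sub_eq_zero] using hb

theorem bound_Icc (h : IsEvolution S K) (n : ℕ) :
    ∃ B : ℝ, 1 ≤ B ∧ ∀ t : ℝ, 0 ≤ t → t ≤ n → ∀ X ∈ S t, ‖X‖ ≤ B := by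
  obtain ⟨c, hc0, hc⟩ := h.approx
  obtain ⟨k, hk⟩ := h.isCompact_gen.isBounded.exists_norm_le
  have h1 : ∀ t, 0 ≤ t → t ≤ 1 → ∀ X ∈ S t, ‖X‖ ≤ 1 + |k| + c := by
    intro t ht ht1 X hX
    obtain ⟨A, hA, hb⟩ := hc t ht ht1 X hX
    have h2 : ‖t • A‖ ≤ |k| := by
      rw [norm_smul, Real.norm_eq_abs, abs_of_nonneg ht]
      calc t * ‖A‖ ≤ 1 * |k| := by gcongr; exact (hk A hA).trans (le_abs_self k)
        _ = |k| := one_mul _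
    have h3 : ‖(1 : E →L[ℝ] E)‖ ≤ 1 := ContinuousLinearMap.norm_id_le
    have h4 : c * t ^ 2 ≤ c := mul_le_of_le_one_right hc0 (pow_le_one₀ ht ht1)
    calc ‖X‖ = ‖1 + t • A + (X - 1 - t • A)‖ := by congr 1; abel
      _ ≤ ‖(1 : E →L[ℝ] E)‖ + ‖t • A‖ + ‖X - 1 - t • A‖ := norm_add₃_le
      _ ≤ _ := by linarith
  induction n with
  | zero =>
    refine ⟨1 + |k| + c, by have := abs_nonneg k; linarith, fun t ht ht0 X hX => ?_⟩
    exact h1 t ht (ht0.trans (by simp)) X hX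
  | succ n ih =>
    obtain ⟨B, hB, hBb⟩ := ih
    have hk0 := abs_nonneg k
    refine ⟨B * (1 + |k| + c), by nlinarith, fun t ht htn X hX => ?_⟩
    rcases le_total t n with h2 | h2
    · exact (hBb t ht h2 X hX).trans (by nlinarith)
    · obtain ⟨Y, hY, Z, hZ, rfl⟩ := h.split (s := n) (t := t - n) (by positivity)
        (by linarith) (X := X) (by rwa [add_sub_cancel])
      push_cast at htn
      calc ‖Z * Y‖ ≤ ‖Z‖ * ‖Y‖ := norm_mul_le _ _
        _ ≤ (1 + |k| + c) * B := by
          gcongr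
          · exact h1 _ (by linarith) (by linarith) Z hZ
          · exact hBb n (by positivity) le_rfl Y hY
        _ = _ := mul_comm _ _

theorem expBound_of_gauge (h : IsEvolution S K) {q : E → ℝ} {m M : ℝ} (hm : 0 < m)
    (hmq : ∀ x, m * ‖x‖ ≤ q x) (hqM : ∀ x, q x ≤ M * ‖x‖) {s θ : ℝ} (hs : 0 < s)
    (hθ : 0 < θ) (hq : ∀ X ∈ S s, ∀ x, q (X x) ≤ θ * q x) :
    ExpBound S (Real.log θ / s) := by
  have hn : ∀ n : ℕ, ∀ X ∈ S (n * s), ∀ x, q (X x) ≤ θ ^ n * q x := by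
    intro n
    induction n with
    | zero =>
      intro X hX x
      rw [h.eq_one (X := X) (by simpa using hX)]
      simp
    | succ n ih =>
      intro X hX x
      obtain ⟨Y, hY, Z, hZ, rfl⟩ := h.split (s := n * s) (t := s) (by positivity) hs.le
        (X := X) (by convert hX using 1; push_cast; ring_nf)
      calc q (Z (Y x)) ≤ θ * q (Y x) := hq Z hZ _
        _ ≤ θ * (θ ^ n * q x) := by gcongr; exact ih Y hY x
        _ = _ := by ring
  obtain ⟨B, hB, hBb⟩ := h.bound_Icc ⌈s⌉₊
  have hC : 0 < Real.exp |Real.log θ| * (|M| + 1) * B / m := by positivity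
  refine ⟨_, hC, fun t ht X hX => ?_⟩
  refine X.opNorm_le_bound (by positivity) fun x => ?_
  set n := ⌊t / s⌋₊ with hn'
  have h1 : n * s ≤ t := (le_div_iff₀ hs).mp (Nat.floor_le (by positivity))
  have h2 : t < (n + 1) * s := (div_lt_iff₀ hs).mp (Nat.lt_floor_add_one _)
  obtain ⟨Y, hY, Z, hZ, rfl⟩ := h.split (s := t - n * s) (t := n * s) (by linarith)
    (by positivity) (X := X) (by convert hX using 1; ring_nf)
  have hYB : ‖Y‖ ≤ B := hBb _ (by linarith) ((by linarith : t - n * s ≤ s).trans (Nat.le_ceil s)) Y hY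
  have hpow : θ ^ n ≤ Real.exp |Real.log θ| * Real.exp (Real.log θ / s * t) := by
    rw [← Real.exp_add]
    rw [show θ ^ n = Real.exp (n * Real.log θ) by
      rw [Real.exp_nat_mul, Real.exp_log hθ]]
    gcongr
    set w := t / s - n with hw
    have hw0 : 0 ≤ w := by rw [hw, sub_nonneg, le_div_iff₀ hs]; exact h1
    have hw1 : w ≤ 1 := by
      rw [hw, sub_le_iff_le_add, div_le_iff₀ hs]; linarith
    have e : Real.log θ / s * t = n * Real.log θ + w * Real.log θ := by
      rw [hw]; ring
    rw [e]
    have : -|Real.log θ| ≤ w * Real.log θ := by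
      have h5 : |w * Real.log θ| ≤ |Real.log θ| := by
        rw [abs_mul, abs_of_nonneg hw0]
        exact mul_le_of_le_one_left (abs_nonneg _) hw1
      linarith [neg_abs_le (w * Real.log θ)]
    linarith
  have h6 : m * ‖Z (Y x)‖ ≤ θ ^ n * ((|M| + 1) * (B * ‖x‖)) := by
    calc m * ‖Z (Y x)‖ ≤ q (Z (Y x)) := hmq _
      _ ≤ θ ^ n * q (Y x) := hn n Z hZ _
      _ ≤ θ ^ n * ((|M| + 1) * (B * ‖x‖)) := by
        gcongr
        calc q (Y x) ≤ M * ‖Y x‖ := hqM _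
          _ ≤ (|M| + 1) * (B * ‖x‖) := by
            gcongr
            · linarith [le_abs_self M]
            · exact Y.le_of_opNorm_le hYB x
  change ‖Z (Y x)‖ ≤ _
  calc ‖Z (Y x)‖ ≤ θ ^ n * ((|M| + 1) * (B * ‖x‖)) / m := by
        rw [le_div_iff₀ hm]; linarith
    _ ≤ (Real.exp |Real.log θ| * Real.exp (Real.log θ / s * t)) * ((|M| + 1) * (B * ‖x‖)) / m := by
        gcongr
    _ = _ := by ring

theorem exists_expBound (h : IsEvolution S K) : ∃ a, ExpBound S a := by
  obtain ⟨B, hB, hBb⟩ := h.bound_Icc 1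
  exact ⟨_, h.expBound_of_gauge (q := fun x => ‖x‖) (m := 1) (M := 1) one_pos (by simp) (by simp)
    (s := 1) (θ := B) one_pos (by linarith)
    fun X hX x => X.le_of_opNorm_le (hBb 1 zero_le_one (by simp) X hX) x⟩

/-- Rescaling an evolution by `exp (-c * t)`. -/
theorem shift (h : IsEvolution S K) (c : ℝ) :
    IsEvolution (fun t => (fun X => Real.exp (-c * t) • X) '' S t)
      ((fun A => A - c • (1 : E →L[ℝ] E)) '' K) where
  one_mem := ⟨1, h.one_mem, by simp⟩
  mul_mem := by
    rintro s t _ _ hs ht ⟨X, hX, rfl⟩ ⟨Y, hY, rfl⟩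
    refine ⟨_, h.mul_mem s t X Y hs ht hX hY, ?_⟩
    simp only [smul_mul_smul_comm, ← Real.exp_add]
    congr 2; ring_nf
  path := by
    rintro T _ hT ⟨X, hX, rfl⟩
    obtain ⟨P, h0, h1, hP⟩ := h.path T X hT hX
    refine ⟨fun t => Real.exp (-c * t) • P t, by simp [h0], by simp [h1], fun s t hs hst htT => ?_⟩
    obtain ⟨Q, hQ, hQ'⟩ := hP s t hs hst htT
    refine ⟨_, ⟨Q, hQ, rfl⟩, ?_⟩
    simp only [smul_mul_smul_comm, ← Real.exp_add, hQ']
    congr 2; ring_nf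
  isCompact t ht := (h.isCompact t ht).image (continuous_const_smul _)
  isCompact_gen := h.isCompact_gen.image (by fun_prop)
  convex_gen := by
    have := h.convex_gen.translate (-(c • (1 : E →L[ℝ] E)))
    simpa only [sub_eq_add_neg, add_comm] using this
  approx := by
    obtain ⟨c₀, hc0, hc⟩ := h.approx
    obtain ⟨k, hk⟩ := h.isCompact_gen.isBounded.exists_norm_le
    set D := (-c) ^ 2 * (2 * Real.exp |c|) with hD
    have hexp : ∀ t, 0 ≤ t → t ≤ 1 → |Real.exp (-c * t) - 1 - -c * t| ≤ D * t ^ 2 := by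
      intro t ht ht1
      refine (abs_exp_sub_one_sub_le _).trans ?_
      rw [abs_mul, abs_neg, abs_of_nonneg ht, mul_pow, hD, neg_sq, ← sq_abs c]
      have : Real.exp (|c| * t) ≤ Real.exp |c| := by
        gcongr; exact mul_le_of_le_one_right (abs_nonneg c) ht1
      calc |c| ^ 2 * t ^ 2 * (2 * Real.exp (|c| * t)) ≤ |c| ^ 2 * t ^ 2 * (2 * Real.exp |c|) := by
            gcongr
        _ = _ := by ring
    have hD0 : 0 ≤ D := by positivity
    refine ⟨Real.exp |c| * c₀ + D + (|c| + D) * |k|, by positivity, ?_⟩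
    rintro t ht ht1 _ ⟨X, hX, rfl⟩
    obtain ⟨A, hA, hb⟩ := hc t ht ht1 X hX
    refine ⟨_, ⟨A, hA, rfl⟩, ?_⟩
    have e1 := hexp t ht ht1
    have e2 : |Real.exp (-c * t) - 1| ≤ (|c| + D) * t := by
      have : |-c * t| = |c| * t := by rw [abs_mul, abs_neg, abs_of_nonneg ht]
      calc |Real.exp (-c * t) - 1| = |(Real.exp (-c * t) - 1 - -c * t) + -c * t| := by ring_nf
        _ ≤ D * t ^ 2 + |c| * t := (abs_add_le _ _).trans (by rw [this]; gcongr)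
        _ ≤ D * t + |c| * t := by gcongr; nlinarith
        _ = _ := by ring
    have e3 : Real.exp (-c * t) ≤ Real.exp |c| := by
      gcongr
      calc -c * t ≤ |c| * t := by gcongr; exact neg_le_abs c
        _ ≤ |c| := mul_le_of_le_one_right (abs_nonneg c) ht1
    have h1 : ‖(1 : E →L[ℝ] E)‖ ≤ 1 := ContinuousLinearMap.norm_id_le
    have hkA : ‖A‖ ≤ |k| := (hk A hA).trans (le_abs_self k)
    calc ‖Real.exp (-c * t) • X - 1 - t • (A - c • (1 : E →L[ℝ] E))‖
        = ‖Real.exp (-c * t) • (X - 1 - t • A) + (Real.exp (-c * t) - 1 - -c * t) • (1 : E →L[ℝ] E)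
          + ((Real.exp (-c * t) - 1) * t) • A‖ := by congr 1; module
      _ ≤ ‖Real.exp (-c * t) • (X - 1 - t • A)‖
          + ‖(Real.exp (-c * t) - 1 - -c * t) • (1 : E →L[ℝ] E)‖
          + ‖((Real.exp (-c * t) - 1) * t) • A‖ := norm_add₃_le
      _ ≤ Real.exp |c| * (c₀ * t ^ 2) + D * t ^ 2 * 1 + ((|c| + D) * t * t) * |k| := by
        simp only [norm_smul, Real.norm_eq_abs, abs_mul, Real.abs_exp]
        rw [abs_of_nonneg ht]
        gcongr
      _ = _ := by ring
  flow := by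
    rintro _ ⟨A, hA, rfl⟩
    obtain ⟨e, he0, heS, hed⟩ := h.flow A hA
    refine ⟨fun t => Real.exp (-c * t) • e t, by simp [he0], fun t ht => ⟨e t, heS t ht, rfl⟩, ?_⟩
    intro t ht
    have h1 : HasDerivWithinAt (fun t => Real.exp (-c * t)) (Real.exp (-c * t) * (-c)) (Set.Ici 0) t := by
      have := ((hasDerivAt_id t).const_mul (-c)).exp
      simpa using this.hasDerivWithinAt
    have h2 : Real.exp (-c * t) • (e t * A) + (Real.exp (-c * t) * -c) • e t
        = (Real.exp (-c * t) • e t) * (A - c • (1 : E →L[ℝ] E)) := by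
      rw [mul_sub, mul_smul_comm, mul_one, smul_mul_assoc]
      module
    exact h2 ▸ h1.smul (hed t ht)

end IsEvolution

theorem PowerStable.shift {E : Type*} [NormedAddCommGroup E] [NormedSpace ℝ E]
    {S : ℝ → Set (E →L[ℝ] E)} (h : PowerStable S) {c : ℝ} (hc : 0 ≤ c) :
    PowerStable (fun t => (fun X => Real.exp (-c * t) • X) '' S t) := by
  rintro T hT _ ⟨X, hX, rfl⟩
  have := h T hT X hX
  refine squeeze_zero_norm (fun n => ?_) (tendsto_zero_iff_norm_tendsto_zero.mp this)
  simp only [smul_pow, norm_smul, norm_pow, Real.norm_eq_abs, Real.abs_exp]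
  refine mul_le_of_le_one_left (norm_nonneg _) (pow_le_one₀ (Real.exp_pos _).le ?_)
  rw [Real.exp_le_one_iff]
  nlinarith

theorem expBound_shift_iff {E : Type*} [NormedAddCommGroup E] [NormedSpace ℝ E]
    {S : ℝ → Set (E →L[ℝ] E)} {c a : ℝ} :
    ExpBound (fun t => (fun X => Real.exp (-c * t) • X) '' S t) a ↔ ExpBound S (a + c) := by
  simp only [ExpBound, Set.forall_mem_image, norm_smul, Real.norm_eq_abs, Real.abs_exp]
  refine exists_congr fun C => and_congr_right fun _ => forall₂_congr fun t _ =>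
    forall₂_congr fun X _ => ?_
  rw [add_mul, Real.exp_add, neg_mul, Real.exp_neg, inv_mul_le_iff₀ (Real.exp_pos _)]
  ring_nf

namespace IsEvolution

variable {E F : Type*} [NormedAddCommGroup E] [NormedSpace ℝ E]
  [NormedAddCommGroup F] [NormedSpace ℝ F]
  {S : ℝ → Set (E →L[ℝ] E)} {K : Set (E →L[ℝ] E)}

theorem compress (h : IsEvolution S K) (R : (E →L[ℝ] E) →L[ℝ] (F →L[ℝ] F)) (h1 : R 1 = 1)
    (hR : ∀ s t X Y, 0 ≤ s → 0 ≤ t → X ∈ S s → Y ∈ S t → R (Y * X) = R Y * R X) :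
    IsEvolution (fun t => R '' S t) (R '' K) where
  one_mem := ⟨1, h.one_mem, h1⟩
  mul_mem := by
    rintro s t _ _ hs ht ⟨X, hX, rfl⟩ ⟨Y, hY, rfl⟩
    exact ⟨_, h.mul_mem s t X Y hs ht hX hY, hR s t X Y hs ht hX hY⟩
  path := by
    rintro T _ hT ⟨X, hX, rfl⟩
    obtain ⟨P, h0, h1', hP⟩ := h.path T X hT hX
    refine ⟨fun t => R (P t), by simp [h0, h1], by simp [h1'], fun s t hs hst htT => ?_⟩
    obtain ⟨Q, hQ, hQ'⟩ := hP s t hs hst htT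
    obtain ⟨Q₁, hQ₁, hQ₁'⟩ := hP 0 s le_rfl hs (hst.trans htT)
    rw [h0, mul_one] at hQ₁'
    rw [sub_zero] at hQ₁
    exact ⟨_, ⟨Q, hQ, rfl⟩, by
      simp only [hQ', hQ₁']
      exact hR s (t - s) _ _ hs (by linarith) hQ₁ hQ⟩
  isCompact t ht := (h.isCompact t ht).image R.continuous
  isCompact_gen := h.isCompact_gen.image R.continuous
  convex_gen := h.convex_gen.linear_image R.toLinearMap
  approx := by
    obtain ⟨c, hc0, hc⟩ := h.approx
    refine ⟨‖R‖ * c, by positivity, ?_⟩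
    rintro t ht ht1 _ ⟨X, hX, rfl⟩
    obtain ⟨A, hA, hb⟩ := hc t ht ht1 X hX
    refine ⟨_, ⟨A, hA, rfl⟩, ?_⟩
    rw [← h1, ← map_smul, ← map_sub, ← map_sub, mul_assoc]
    exact R.le_opNorm_of_le hb
  flow := by
    rintro _ ⟨A, hA, rfl⟩
    obtain ⟨e, he0, heS, hed⟩ := h.flow A hA
    refine ⟨fun t => R (e t), by simp [he0, h1], fun t ht => ⟨_, heS t ht, rfl⟩, fun t ht => ?_⟩
    have key : R (e t * A) = R (e t) * R A := by
      have d0 := hed 0 le_rfl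
      rw [he0, one_mul] at d0
      have d1 : HasDerivWithinAt (fun s => R (e t * e s)) (R (e t * A)) (Set.Ici 0) 0 :=
        R.hasFDerivAt.comp_hasDerivWithinAt (0 : ℝ) (d0.const_mul (e t))
      have d2 : HasDerivWithinAt (fun s => R (e t) * R (e s)) (R (e t) * R A) (Set.Ici 0) 0 :=
        (R.hasFDerivAt.comp_hasDerivWithinAt (0 : ℝ) d0).const_mul _
      have d3 : HasDerivWithinAt (fun s => R (e t * e s)) (R (e t) * R A) (Set.Ici 0) 0 :=
        d2.congr (fun s hs => hR s t _ _ hs ht (heS s hs) (heS t ht))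
          (hR 0 t _ _ le_rfl ht (heS 0 le_rfl) (heS t ht))
      exact (uniqueDiffWithinAt_Ici (0 : ℝ)).eq_deriv _ d1 d3
    rw [← key]
    exact R.hasFDerivAt.comp_hasDerivWithinAt t (hed t ht)

theorem powerStable_compress (h : IsEvolution S K) (hS : PowerStable S)
    (R : (E →L[ℝ] E) →L[ℝ] (F →L[ℝ] F)) (h1 : R 1 = 1)
    (hR : ∀ s t X Y, 0 ≤ s → 0 ≤ t → X ∈ S s → Y ∈ S t → R (Y * X) = R Y * R X) :
    PowerStable (fun t => R '' S t) := by
  rintro T hT _ ⟨X, hX, rfl⟩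
  have : ∀ n : ℕ, R X ^ n = R (X ^ n) := by
    intro n
    induction n with
    | zero => simp [h1]
    | succ n ih =>
      rw [pow_succ', pow_succ', ih]
      exact (hR _ T _ _ (by positivity) hT.le (h.pow_mem hT.le hX n) hX).symm
  simp only [this]
  have h0 := (R.continuous.tendsto 0).comp (hS T hT X hX)
  rwa [map_zero] at h0

/-- An evolution with an invariant subspace is exponentially stable if both diagonal blocks are. -/
theorem expBound_of_blocks {F₁ F₂ : Type*} [NormedAddCommGroup F₁] [NormedSpace ℝ F₁]
    [NormedAddCommGroup F₂] [NormedSpace ℝ F₂]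
    (h : IsEvolution S K) (π₁ : E →L[ℝ] F₁) (π₂ : E →L[ℝ] F₂) (ι₁ : F₁ →L[ℝ] E) (ι₂ : F₂ →L[ℝ] E)
    (hsum : ∀ x, ι₁ (π₁ x) + ι₂ (π₂ x) = x)
    (hinv : ∀ t, 0 ≤ t → ∀ X ∈ S t, ∀ x, π₂ (X (ι₁ x)) = 0)
    {a : ℝ} (ha : a < 0)
    (hb₁ : ExpBound (fun t => (fun X => π₁ ∘L X ∘L ι₁) '' S t) a)
    (hb₂ : ExpBound (fun t => (fun X => π₂ ∘L X ∘L ι₂) '' S t) a) :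
    ∃ b < 0, ExpBound S b := by
  obtain ⟨C₁, hC₁, hb₁⟩ := hb₁
  obtain ⟨C₂, hC₂, hb₂⟩ := hb₂
  have hlim : Tendsto (fun t : ℝ => (C₁ + C₂) * Real.exp (a * t)) atTop (𝓝 0) := by
    have : Tendsto (fun t : ℝ => a * t) atTop atBot := tendsto_id.const_mul_atTop_of_neg ha
    simpa using (Real.tendsto_exp_atBot.comp this).const_mul (C₁ + C₂)
  obtain ⟨s, hs, hs0⟩ := ((hlim.eventually_lt_const (by norm_num : (0 : ℝ) < 1 / 4)).and
    (eventually_gt_atTop (0 : ℝ))).exists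
  obtain ⟨B, hB, hBb⟩ := h.bound_Icc ⌈s⌉₊
  have hBs : ∀ X ∈ S s, ‖X‖ ≤ B := hBb s hs0.le (Nat.le_ceil s)
  set D := ‖π₁‖ * B * ‖ι₂‖ with hD
  have hD0 : 0 ≤ D := by positivity
  set Λ := 1 + 4 * D with hΛ
  set q : E → ℝ := fun x => ‖π₁ x‖ + Λ * ‖π₂ x‖ with hq
  refine ⟨_, ?_, h.expBound_of_gauge (q := q) (m := (‖ι₁‖ + ‖ι₂‖ + 1)⁻¹) (M := ‖π₁‖ + Λ * ‖π₂‖)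
    (by positivity) ?_ ?_ hs0 (θ := 1 / 2) (by norm_num) ?_⟩
  · exact div_neg_of_neg_of_pos (Real.log_neg (by norm_num) (by norm_num)) hs0
  · intro x
    rw [inv_mul_le_iff₀ (by positivity)]
    have h1 := ι₁.le_opNorm (π₁ x)
    have h2 := ι₂.le_opNorm (π₂ x)
    have h3 : ‖x‖ ≤ ‖ι₁ (π₁ x)‖ + ‖ι₂ (π₂ x)‖ := by
      calc ‖x‖ = ‖ι₁ (π₁ x) + ι₂ (π₂ x)‖ := by rw [hsum]
        _ ≤ _ := norm_add_le _ _
    have h4 : ‖π₁ x‖ ≤ q x := by simp only [hq]; have : 0 ≤ Λ * ‖π₂ x‖ := by positivity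
                                 linarith
    have h5 : ‖π₂ x‖ ≤ q x := by
      simp only [hq]
      nlinarith [norm_nonneg (π₁ x), norm_nonneg (π₂ x)]
    have h6 : 0 ≤ q x := (norm_nonneg _).trans h4
    nlinarith [norm_nonneg ι₁, norm_nonneg ι₂]
  · intro x
    simp only [hq]
    have h1 := π₁.le_opNorm x
    have h2 := mul_le_mul_of_nonneg_left (π₂.le_opNorm x) (by positivity : 0 ≤ Λ)
    linarith
  · intro X hX x
    have e : X x = X (ι₁ (π₁ x)) + X (ι₂ (π₂ x)) := by rw [← map_add, hsum]
    have b₁ := (hb₁ s hs0.le _ ⟨X, hX, rfl⟩)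
    have b₂ := (hb₂ s hs0.le _ ⟨X, hX, rfl⟩)
    have hE := Real.exp_pos (a * s)
    have c₁ : ‖π₁ (X (ι₁ (π₁ x)))‖ ≤ 1 / 4 * ‖π₁ x‖ :=
      ContinuousLinearMap.le_of_opNorm_le _ (b₁.trans (by nlinarith)) (π₁ x)
    have c₂ : ‖π₂ (X (ι₂ (π₂ x)))‖ ≤ 1 / 4 * ‖π₂ x‖ :=
      ContinuousLinearMap.le_of_opNorm_le _ (b₂.trans (by nlinarith)) (π₂ x)
    have c₃ : ‖π₁ (X (ι₂ (π₂ x)))‖ ≤ D * ‖π₂ x‖ := by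
      calc ‖π₁ (X (ι₂ (π₂ x)))‖ ≤ ‖π₁‖ * (B * (‖ι₂‖ * ‖π₂ x‖)) :=
            π₁.le_opNorm_of_le (X.le_of_opNorm_le_of_le (hBs X hX) (ι₂.le_opNorm _))
        _ = _ := by rw [hD]; ring
    have e₁ : ‖π₁ (X x)‖ ≤ 1 / 4 * ‖π₁ x‖ + D * ‖π₂ x‖ := by
      rw [e, map_add]; exact (norm_add_le _ _).trans (by linarith)
    have e₂ : ‖π₂ (X x)‖ ≤ 1 / 4 * ‖π₂ x‖ := by
      rw [e, map_add, hinv s hs0.le X hX, zero_add]; exact c₂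
    simp only [hq]
    have e₃ := mul_le_mul_of_nonneg_left e₂ (by positivity : 0 ≤ Λ)
    have e₄ : D * ‖π₂ x‖ ≤ Λ * (1 / 4 * ‖π₂ x‖) := by
      rw [hΛ]; nlinarith [norm_nonneg (π₂ x)]
    nlinarith [norm_nonneg (π₁ x)]

end IsEvolution

/-- No proper nonzero subspace is invariant under all evolution operators. -/
def IrreducibleEvolution {E : Type*} [NormedAddCommGroup E] [NormedSpace ℝ E]
    (S : ℝ → Set (E →L[ℝ] E)) : Prop :=
  ∀ U : Submodule ℝ E, (∀ t, 0 ≤ t → ∀ X ∈ S t, ∀ x ∈ U, X x ∈ U) → U = ⊥ ∨ U = ⊤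

universe u

theorem exists_neg_expBound_of_critical
    (core : ∀ (E : Type u) [NormedAddCommGroup E] [NormedSpace ℝ E] [FiniteDimensional ℝ E]
      (S : ℝ → Set (E →L[ℝ] E)) (K : Set (E →L[ℝ] E)), Module.finrank ℝ E ≤ 3 →
      IsEvolution S K → PowerStable S → IrreducibleEvolution S → (∀ a > 0, ExpBound S a) →
      (∀ a < 0, ¬ ExpBound S a) → False) (n : ℕ) :
    ∀ (E : Type u) [NormedAddCommGroup E] [NormedSpace ℝ E] [FiniteDimensional ℝ E]
      (S : ℝ → Set (E →L[ℝ] E)) (K : Set (E →L[ℝ] E)), Module.finrank ℝ E = n → n ≤ 3 →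
      IsEvolution S K → PowerStable S → ∃ a < 0, ExpBound S a := by
  induction n using Nat.strong_induction_on with
  | _ n ih =>
  intro E _ _ _ S K hn hn3 hSK hS
  by_cases hirr : IrreducibleEvolution S
  · by_contra! hcon
    set Λ : Set ℝ := {a | ExpBound S a} with hΛ
    have hΛne : Λ.Nonempty := hSK.exists_expBound
    have hΛ0 : ∀ a ∈ Λ, 0 ≤ a := fun a ha => by
      by_contra! h
      exact hcon a h ha
    have hΛb : BddBelow Λ := ⟨0, hΛ0⟩
    have hc0 : 0 ≤ sInf Λ := le_csInf hΛne hΛ0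
    set c := sInf Λ with hc
    refine core E _ _ (hn ▸ hn3) (hSK.shift c) (hS.shift hc0) ?_ ?_ ?_
    · intro U hU
      refine hirr U fun t ht X hX x hx => ?_
      have := U.smul_mem (Real.exp (c * t)) (hU t ht _ ⟨X, hX, rfl⟩ x hx)
      simpa [smul_smul, ← Real.exp_add] using this
    · intro a ha
      rw [expBound_shift_iff]
      obtain ⟨b, hb, hbc⟩ := exists_lt_of_csInf_lt hΛne (show c < a + c by linarith)
      exact ExpBound.mono hb hbc.le
    · intro a ha h
      rw [expBound_shift_iff] at h
      have := csInf_le hΛb h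
      linarith
  · simp only [IrreducibleEvolution, not_forall, not_or] at hirr
    obtain ⟨U, hU, hbot, htop⟩ := hirr
    obtain ⟨W, hUW⟩ := U.exists_isCompl
    have hU1 : Module.finrank ℝ U < n := hn ▸ Submodule.finrank_lt htop
    have hW1 : Module.finrank ℝ W < n := by
      refine hn ▸ Submodule.finrank_lt fun h => hbot ?_
      have := hUW.disjoint
      rwa [h, disjoint_top] at this
    set π₁ : E →L[ℝ] U := LinearMap.toContinuousLinearMap (U.projectionOnto W hUW) with hπ₁
    set π₂ : E →L[ℝ] W := LinearMap.toContinuousLinearMap (W.projectionOnto U hUW.symm) with hπ₂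
    have p₁ : ∀ x : U, π₁ x = x := fun x => Submodule.projectionOnto_apply_left hUW x
    have p₂ : ∀ x : W, π₂ x = x := fun x => Submodule.projectionOnto_apply_left hUW.symm x
    have z₂ : ∀ x ∈ U, π₂ x = 0 := fun x hx =>
      (Submodule.projectionOnto_apply_eq_zero_iff hUW.symm).mpr hx
    have hsum : ∀ x, U.subtypeL (π₁ x) + W.subtypeL (π₂ x) = x := fun x =>
      Submodule.projection_add_projection_eq_self hUW x
    have hX₁ : ∀ x, x ∈ U → ((π₁ x : U) : E) = x := fun x hx => congrArg _ (p₁ ⟨x, hx⟩)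
    set R₁ : (E →L[ℝ] E) →L[ℝ] (U →L[ℝ] U) :=
      (ContinuousLinearMap.compL ℝ U E U π₁) ∘L ((ContinuousLinearMap.compL ℝ U E E).flip U.subtypeL)
      with hR₁
    set R₂ : (E →L[ℝ] E) →L[ℝ] (W →L[ℝ] W) :=
      (ContinuousLinearMap.compL ℝ W E W π₂) ∘L ((ContinuousLinearMap.compL ℝ W E E).flip W.subtypeL)
      with hR₂
    have a₁ : R₁ 1 = 1 := ContinuousLinearMap.ext fun x => p₁ x
    have a₂ : R₂ 1 = 1 := ContinuousLinearMap.ext fun x => p₂ x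
    have m₁ : ∀ s t X Y, 0 ≤ s → 0 ≤ t → X ∈ S s → Y ∈ S t → R₁ (Y * X) = R₁ Y * R₁ X := by
      intro s t X Y hs ht hX hY
      refine ContinuousLinearMap.ext fun x => ?_
      change π₁ (Y (X x)) = π₁ (Y ((π₁ (X x) : U) : E))
      rw [hX₁ _ (hU s hs X hX x x.2)]
    have m₂ : ∀ s t X Y, 0 ≤ s → 0 ≤ t → X ∈ S s → Y ∈ S t → R₂ (Y * X) = R₂ Y * R₂ X := by
      intro s t X Y hs ht hX hY
      refine ContinuousLinearMap.ext fun x => ?_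
      change π₂ (Y (X x)) = π₂ (Y ((π₂ (X x) : W) : E))
      have e : ((π₁ (X x) : U) : E) + ((π₂ (X x) : W) : E) = X x := hsum (X x)
      conv_lhs => rw [← e, map_add, map_add, z₂ (Y _) (hU t ht Y hY _ (π₁ (X x)).2), zero_add]
    obtain ⟨b₁, hb₁, hB₁⟩ := ih _ hU1 U _ _ rfl (by omega) (hSK.compress R₁ a₁ m₁)
      (hSK.powerStable_compress hS R₁ a₁ m₁)
    obtain ⟨b₂, hb₂, hB₂⟩ := ih _ hW1 W _ _ rfl (by omega) (hSK.compress R₂ a₂ m₂)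
      (hSK.powerStable_compress hS R₂ a₂ m₂)
    exact hSK.expBound_of_blocks π₁ π₂ U.subtypeL W.subtypeL hsum
      (fun t ht X hX x => z₂ _ (hU t ht X hX x x.2)) (a := max b₁ b₂) (max_lt hb₁ hb₂)
      (hB₁.mono (le_max_left _ _)) (hB₂.mono (le_max_right _ _))

namespace IsEvolution

variable {E : Type*} [NormedAddCommGroup E] [NormedSpace ℝ E]
  {S : ℝ → Set (E →L[ℝ] E)} {K : Set (E →L[ℝ] E)}

/-- The vectors with bounded orbit. -/
def boundedVectors (S : ℝ → Set (E →L[ℝ] E)) : Submodule ℝ E where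
  carrier := {x | ∃ C, ∀ t, 0 ≤ t → ∀ X ∈ S t, ‖X x‖ ≤ C}
  add_mem' := by
    rintro x y ⟨C, hC⟩ ⟨D, hD⟩
    refine ⟨C + D, fun t ht X hX => ?_⟩
    rw [map_add]
    exact (norm_add_le _ _).trans (add_le_add (hC t ht X hX) (hD t ht X hX))
  zero_mem' := ⟨0, fun t ht X hX => by simp⟩
  smul_mem' := by
    rintro a x ⟨C, hC⟩
    refine ⟨‖a‖ * C, fun t ht X hX => ?_⟩
    rw [map_smul, norm_smul]
    gcongr
    exact hC t ht X hX

theorem exists_bound [FiniteDimensional ℝ E] (h : IsEvolution S K) (hirr : IrreducibleEvolution S)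
    (hexp : ∀ a > 0, ExpBound S a) : ∃ C, ∀ t, 0 ≤ t → ∀ X ∈ S t, ‖X‖ ≤ C := by
  have hcomplete : CompleteSpace E := FiniteDimensional.complete ℝ E
  have hV : boundedVectors S = ⊥ ∨ boundedVectors S = ⊤ := by
    refine hirr _ fun t ht X hX x hx => ?_
    obtain ⟨C, hC⟩ := hx
    exact ⟨C, fun s hs Y hY => hC _ (by positivity) _ (h.mul_mem t s X Y ht hs hX hY)⟩
  by_cases htop : boundedVectors S = ⊤
  · obtain ⟨C, hC⟩ := banach_steinhaus (ι := {X : E →L[ℝ] E // ∃ t, 0 ≤ t ∧ X ∈ S t})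
      (g := fun X => X.1) (fun x => by
        obtain ⟨C, hC⟩ : x ∈ boundedVectors S := htop ▸ Submodule.mem_top
        exact ⟨C, fun ⟨X, t, ht, hX⟩ => hC t ht X hX⟩)
    exact ⟨C, fun t ht X hX => hC ⟨X, t, ht, hX⟩⟩
  · exfalso
    have hbot := hV.resolve_right htop
    obtain ⟨x₀, hx₀⟩ : ∃ x : E, x ≠ 0 := by
      by_contra! hall
      refine htop (eq_top_iff.mpr fun x _ => ?_)
      rw [hall x]
      exact Submodule.zero_mem _
    have hcov : Metric.sphere (0 : E) 1 ⊆
        ⋃ i : {q : ℝ × (E →L[ℝ] E) // 0 ≤ q.1 ∧ q.2 ∈ S q.1}, {x | 2 < ‖i.1.2 x‖} := by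
      intro x hx
      by_contra hnot
      simp only [Set.mem_iUnion, Set.mem_ofPred_eq, not_exists, not_lt] at hnot
      have : x ∈ boundedVectors S := ⟨2, fun t ht X hX => hnot ⟨(t, X), ht, hX⟩⟩
      rw [hbot, Submodule.mem_bot] at this
      simp [this] at hx
    obtain ⟨I, hI⟩ := (isCompact_sphere (0 : E) 1).elim_finite_subcover _
      (fun i => isOpen_lt continuous_const (i.1.2.continuous.norm)) hcov
    obtain ⟨T, hT⟩ : ∃ T, ∀ i ∈ I, i.1.1 ≤ T := by
      obtain ⟨T, hT⟩ := (I.finite_toSet.image (fun i => i.1.1)).bddAbove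
      exact ⟨T, fun i hi => hT ⟨i, hi, rfl⟩⟩
    have hstep : ∀ x : E, x ≠ 0 → ∃ t, 0 ≤ t ∧ t ≤ T ∧ ∃ X ∈ S t, 2 * ‖x‖ ≤ ‖X x‖ := by
      intro x hx
      have hx' : ‖x‖⁻¹ • x ∈ Metric.sphere (0 : E) 1 := by
        simp [norm_smul, hx]
      obtain ⟨i, hi, hix⟩ := Set.mem_iUnion₂.mp (hI hx')
      refine ⟨i.1.1, i.2.1, hT i hi, i.1.2, i.2.2, ?_⟩
      have h2 : 2 < ‖i.1.2 (‖x‖⁻¹ • x)‖ := hix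
      rw [map_smul, norm_smul, norm_inv, norm_norm, lt_inv_mul_iff₀ (norm_pos_iff.mpr hx)] at h2
      linarith
    have hiter : ∀ n : ℕ, ∃ t, 0 ≤ t ∧ t ≤ n * T ∧ ∃ X ∈ S t, 2 ^ n * ‖x₀‖ ≤ ‖X x₀‖ := by
      intro n
      induction n with
      | zero => exact ⟨0, le_rfl, by simp, 1, h.one_mem, by simp⟩
      | succ n ih =>
        obtain ⟨t, ht, htn, X, hX, hb⟩ := ih
        have hpos : 0 < ‖X x₀‖ := lt_of_lt_of_le (by positivity) hb
        obtain ⟨s, hs, hsT, Y, hY, hb'⟩ := hstep (X x₀) (norm_pos_iff.mp hpos)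
        refine ⟨t + s, by positivity, by push_cast; linarith, _, h.mul_mem t s X Y ht hs hX hY, ?_⟩
        change _ ≤ ‖Y (X x₀)‖
        rw [pow_succ]; linarith
    obtain ⟨t₀, ht₀, ht₀T, -⟩ := hstep x₀ hx₀
    have hT0 : 0 ≤ T := ht₀.trans ht₀T
    have hl : 0 < Real.log (3 / 2) := Real.log_pos (by norm_num)
    obtain ⟨C, hC, hCb⟩ := hexp (Real.log (3 / 2) / (T + 1)) (by positivity)
    have hfin : ∀ n : ℕ, (4 / 3 : ℝ) ^ n ≤ C := by
      intro n
      obtain ⟨t, ht, htn, X, hX, hb⟩ := hiter n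
      have h1 := X.le_of_opNorm_le (hCb t ht X hX) x₀
      have h2 : (2 : ℝ) ^ n ≤ C * Real.exp (Real.log (3 / 2) / (T + 1) * t) :=
        le_of_mul_le_mul_right (hb.trans h1) (norm_pos_iff.mpr hx₀)
      have h3 : Real.exp (Real.log (3 / 2) / (T + 1) * t) ≤ (3 / 2) ^ n := by
        rw [show (3 / 2 : ℝ) ^ n = Real.exp (n * Real.log (3 / 2)) by
          rw [Real.exp_nat_mul, Real.exp_log (by norm_num)]]
        refine Real.exp_le_exp.mpr ?_
        rw [div_mul_eq_mul_div, div_le_iff₀ (by positivity)]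
        nlinarith [(Nat.cast_nonneg n : (0 : ℝ) ≤ n)]
      have h4 : (2 : ℝ) ^ n ≤ C * (3 / 2) ^ n := h2.trans (by gcongr)
      rw [show (4 / 3 : ℝ) = 2 / (3 / 2) by norm_num, div_pow, div_le_iff₀ (by positivity)]
      exact h4
    obtain ⟨n, hn⟩ := pow_unbounded_of_one_lt C (by norm_num : (1 : ℝ) < 4 / 3)
    linarith [hfin n]

theorem exists_extremal_seminorm (h : IsEvolution S K) {C : ℝ}
    (hC : ∀ t, 0 ≤ t → ∀ X ∈ S t, ‖X‖ ≤ C) :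
    ∃ p : Seminorm ℝ E, (∀ x, ‖x‖ ≤ p x) ∧ (∀ x, p x ≤ C * ‖x‖) ∧
      ∀ t, 0 ≤ t → ∀ X ∈ S t, ∀ x, p (X x) ≤ p x := by
  let ι := {X : E →L[ℝ] E // ∃ t, 0 ≤ t ∧ X ∈ S t}
  have hb : ∀ (i : ι) x, ‖i.1 x‖ ≤ C * ‖x‖ := fun ⟨X, t, ht, hX⟩ x =>
    X.le_of_opNorm_le (hC t ht X hX) x
  have hbdd : ∀ x, BddAbove (Set.range fun i : ι => ‖i.1 x‖) := fun x =>
    ⟨C * ‖x‖, by rintro _ ⟨i, rfl⟩; exact hb i x⟩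
  have hne : Nonempty ι := ⟨⟨1, 0, le_rfl, h.one_mem⟩⟩
  refine ⟨Seminorm.of (fun x => ⨆ i : ι, ‖i.1 x‖) ?_ ?_, ?_, ?_, ?_⟩
  · intro x y
    refine ciSup_le fun i => ?_
    rw [map_add]
    exact (norm_add_le _ _).trans (add_le_add (le_ciSup (hbdd x) i) (le_ciSup (hbdd y) i))
  · intro a x
    simp only [map_smul, norm_smul]
    rw [Real.mul_iSup_of_nonneg (norm_nonneg a)]
  · intro x
    exact le_ciSup (hbdd x) ⟨1, 0, le_rfl, h.one_mem⟩
  · intro x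
    exact ciSup_le fun i => hb i x
  · intro t ht X hX x
    refine ciSup_le fun ⟨Y, s, hs, hY⟩ => ?_
    exact le_ciSup (hbdd x) ⟨Y * X, t + s, by positivity, h.mul_mem t s X Y ht hs hX hY⟩

theorem continuous_of_le {p : Seminorm ℝ E} {C : ℝ} (hp : ∀ x, p x ≤ C * ‖x‖) : Continuous p := by
  refine (LipschitzWith.of_dist_le_mul (K := C.toNNReal) fun x y => ?_).continuous
  rw [Real.dist_eq, dist_eq_norm]
  refine (abs_sub_map_le_sub p x y).trans ((hp _).trans ?_)
  gcongr
  exact Real.le_coe_toNNReal C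

theorem exists_norm_preserved [FiniteDimensional ℝ E] (h : IsEvolution S K)
    (hexp : ∀ a < 0, ¬ ExpBound S a) {p : Seminorm ℝ E} {C : ℝ}
    (hp1 : ∀ x, ‖x‖ ≤ p x) (hp2 : ∀ x, p x ≤ C * ‖x‖)
    {T : ℝ} (hT : 0 < T) (hp3 : ∀ X ∈ S T, ∀ x, p (X x) ≤ p x) :
    ∃ X ∈ S T, ∃ x, p x = 1 ∧ p (X x) = 1 := by
  by_contra! hcon
  have hpc := continuous_of_le hp2
  have hsph : IsCompact {x : E | p x = 1} := by
    refine Metric.isCompact_of_isClosed_isBounded (isClosed_eq hpc continuous_const)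
      ((Metric.isBounded_closedBall (x := (0 : E)) (r := 1)).subset fun x hx => ?_)
    rw [mem_closedBall_zero_iff]
    exact (hp1 x).trans hx.le
  obtain ⟨θ, hθ0, hθ1, hθ⟩ : ∃ θ : ℝ, 0 < θ ∧ θ < 1 ∧ ∀ X ∈ S T, ∀ x, p x = 1 → p (X x) ≤ θ := by
    rcases (S T ×ˢ {x : E | p x = 1}).eq_empty_or_nonempty with he | hne
    · refine ⟨1 / 2, by norm_num, by norm_num, fun X hX x hx => ?_⟩
      have : (X, x) ∈ S T ×ˢ {x : E | p x = 1} := ⟨hX, hx⟩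
      rw [he] at this
      exact this.elim
    · have hf : Continuous fun q : (E →L[ℝ] E) × E => p (q.1 q.2) :=
        hpc.comp (continuous_fst.clm_apply continuous_snd)
      obtain ⟨q, hq, hmax⟩ := ((h.isCompact T hT.le).prod hsph).exists_isMaxOn hne hf.continuousOn
      have hlt : p (q.1 q.2) < 1 :=
        lt_of_le_of_ne ((hp3 _ hq.1 _).trans hq.2.le) (hcon _ hq.1 _ hq.2)
      refine ⟨max (p (q.1 q.2)) (1 / 2), by positivity, max_lt hlt (by norm_num),
        fun X hX x hx => le_max_of_le_left ?_⟩
      exact hmax (show (X, x) ∈ S T ×ˢ {x : E | p x = 1} from ⟨hX, hx⟩)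
  refine hexp _ ?_ (h.expBound_of_gauge (q := p) (m := 1) one_pos (by simpa using hp1) hp2 hT hθ0 ?_)
  · exact div_neg_of_neg_of_pos (Real.log_neg hθ0 hθ1) hT
  · intro X hX x
    rcases eq_or_ne x 0 with rfl | hx
    · simp
    · have hpx : 0 < p x := (norm_pos_iff.mpr hx).trans_le (hp1 x)
      have := hθ X hX ((p x)⁻¹ • x) (by
        rw [map_smul_eq_mul, Real.norm_eq_abs, abs_of_pos (by positivity), inv_mul_cancel₀ hpx.ne'])
      rwa [map_smul, map_smul_eq_mul, Real.norm_eq_abs, abs_of_pos (by positivity),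
        inv_mul_le_iff₀ hpx, mul_comm] at this

end IsEvolution

/-- A compact shift-invariant set of simple curves on the unit sphere of `p`, with velocities
generated by `K`. -/
structure IsExtremalFamily {E : Type*} [NormedAddCommGroup E] [NormedSpace ℝ E]
    (p : Seminorm ℝ E) (K : Set (E →L[ℝ] E)) (Z : Set (ℝ → E)) : Prop where
  isCompact : IsCompact Z
  nonempty : Z.Nonempty
  shift : ∀ z ∈ Z, ∀ h : ℝ, (fun t => z (t + h)) ∈ Z
  norm_eq : ∀ z ∈ Z, ∀ t, p (z t) = 1
  ne : ∀ z ∈ Z, ∀ s t, s < t → z t ≠ z s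
  ne_neg : ∀ z ∈ Z, ∀ s t, s < t → z t ≠ -z s
  incr : ∃ c, 0 ≤ c ∧ ∀ z ∈ Z, ∀ s t, s ≤ t → t ≤ s + 1 →
    ∃ A ∈ K, ‖z t - z s - (t - s) • A (z s)‖ ≤ c * (t - s) ^ 2

namespace IsEvolution

variable {E : Type*} [NormedAddCommGroup E] [NormedSpace ℝ E]
  {S : ℝ → Set (E →L[ℝ] E)} {K : Set (E →L[ℝ] E)}

theorem isClosed_graph (h : IsEvolution S K) {t : ℝ} (ht : 0 ≤ t) :
    IsClosed {q : E × E | ∃ X ∈ S t, q.2 = X q.1} := by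
  have : CompactSpace (S t) := isCompact_iff_compactSpace.mp (h.isCompact t ht)
  have hcl : IsClosed {r : S t × (E × E) | r.2.2 = (r.1 : E →L[ℝ] E) r.2.1} :=
    isClosed_eq (by fun_prop) (by fun_prop)
  convert isClosedMap_snd_of_compactSpace _ hcl using 1
  ext q
  constructor
  · rintro ⟨X, hX, hq⟩
    exact ⟨(⟨X, hX⟩, q), hq, rfl⟩
  · rintro ⟨⟨⟨X, hX⟩, q⟩, hq, rfl⟩
    exact ⟨X, hX, hq⟩

theorem eq_zero_of_pow_fix (hS : PowerStable S) {t : ℝ} (ht : 0 < t) {X : E →L[ℝ] E}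
    (hX : X ∈ S t) {x : E} {m : ℕ} (hm : 0 < m) (hx : (X ^ m) x = x) : x = 0 := by
  have h1 : ∀ n : ℕ, (X ^ (m * n)) x = x := by
    intro n
    induction n with
    | zero => simp
    | succ n ih =>
      rw [mul_add, mul_one, pow_add, mul_apply_eq_comp, hx, ih]
  have h2 : Tendsto (fun n : ℕ => (X ^ (m * n)) x) atTop (𝓝 0) := by
    have h3 := (hS t ht X hX).comp (tendsto_id.const_mul_atTop' hm)
    have h4 := ((ContinuousLinearMap.apply ℝ E x).continuous.tendsto 0).comp h3
    rw [map_zero] at h4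
    exact h4
  simp only [h1] at h2
  exact tendsto_nhds_unique tendsto_const_nhds h2

theorem gen_apply_ne_zero (h : IsEvolution S K) (hS : PowerStable S) {A : E →L[ℝ] E} (hA : A ∈ K)
    {y : E} (hy : y ≠ 0) : A y ≠ 0 := by
  intro hAy
  obtain ⟨e, he0, heS, hed⟩ := h.flow A hA
  have hd : ∀ t, 0 ≤ t → HasDerivWithinAt (fun t => e t y) 0 (Set.Ici 0) t := by
    intro t ht
    have := (ContinuousLinearMap.apply ℝ E y).hasFDerivAt.comp_hasDerivWithinAt t (hed t ht)
    have e0 : (ContinuousLinearMap.apply ℝ E y) (e t * A) = 0 := by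
      simp [hAy]
    rw [e0] at this
    exact this
  have hfix : e 1 y = e 0 y := by
    exact constant_of_has_deriv_right_zero (f := fun t => e t y) (a := 0) (b := 1)
      (fun t ht => (hd t ht.1).continuousWithinAt.mono fun s hs => hs.1)
      (fun t ht => (hd t ht.1).mono (Set.Ici_subset_Ici.mpr ht.1)) 1 (by simp)
  rw [he0] at hfix
  exact hy (eq_zero_of_pow_fix hS one_pos (heS 1 zero_le_one) (m := 1) one_pos (by simpa using hfix))

theorem exists_extremalFamily [FiniteDimensional ℝ E] (h : IsEvolution S K) (hS : PowerStable S)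
    (hexp : ∀ a < 0, ¬ ExpBound S a) {p : Seminorm ℝ E} {C : ℝ}
    (hp1 : ∀ x, ‖x‖ ≤ p x) (hp2 : ∀ x, p x ≤ C * ‖x‖)
    (hp3 : ∀ t, 0 ≤ t → ∀ X ∈ S t, ∀ x, p (X x) ≤ p x) :
    ∃ Z, IsExtremalFamily p K Z := by
  have hpc := continuous_of_le hp2
  set Zn : ℕ → Set (ℝ → E) := fun n => (Set.pi Set.univ fun _ => Metric.closedBall (0 : E) 1) ∩
    {z | ∀ s t : ℝ, -(n + 1 : ℝ) ≤ s → s ≤ t → t ≤ n + 1 →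
      (∃ X ∈ S (t - s), z t = X (z s)) ∧ p (z s) = 1} with hZn
  have hcompact : IsCompact (Set.pi Set.univ fun _ : ℝ => Metric.closedBall (0 : E) 1) :=
    isCompact_univ_pi fun _ => isCompact_closedBall _ _
  have hclosed : ∀ n, IsClosed (Zn n) := by
    intro n
    refine hcompact.isClosed.inter ?_
    simp only [Set.ofPred_forall]
    refine isClosed_iInter fun s => isClosed_iInter fun t => isClosed_iInter fun _ =>
      isClosed_iInter fun hst => isClosed_iInter fun _ => ?_
    refine IsClosed.inter ?_ (isClosed_eq (hpc.comp (continuous_apply s)) continuous_const)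
    exact (h.isClosed_graph (sub_nonneg.mpr hst)).preimage (f := fun z : ℝ → E => (z s, z t))
      ((continuous_apply s).prodMk (continuous_apply t))
  have hne : (⋂ n, Zn n).Nonempty := by
    refine IsCompact.nonempty_iInter_of_sequence_nonempty_isCompact_isClosed Zn ?_ ?_
      (hcompact.of_isClosed_subset (hclosed 0) Set.inter_subset_left) hclosed
    · rintro n z ⟨hz1, hz2⟩
      refine ⟨hz1, fun s t hs hst ht => hz2 s t ?_ hst ?_⟩ <;> push_cast <;> linarith
    · intro n
      have hL : (0 : ℝ) < 2 * (n + 1) := by positivity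
      obtain ⟨X, hX, x, hx, hXx⟩ := h.exists_norm_preserved hexp hp1 hp2 hL (hp3 _ hL.le)
      obtain ⟨P, hP0, hPT, hP⟩ := h.path _ X hL.le hX
      have hPp : ∀ s, 0 ≤ s → s ≤ 2 * (n + 1 : ℝ) → p (P s x) = 1 := by
        intro s hs hsT
        refine le_antisymm ?_ ?_
        · obtain ⟨Q, hQ, hQ'⟩ := hP 0 s le_rfl hs hsT
          rw [hQ', hP0, mul_one, ← hx]
          exact hp3 _ (by linarith) Q hQ x
        · obtain ⟨Q, hQ, hQ'⟩ := hP s _ hs hsT le_rfl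
          rw [← hXx, ← hPT, hQ']
          exact hp3 _ (by linarith) Q hQ _
      refine ⟨fun t => if |t| ≤ n + 1 then P (t + (n + 1)) x else 0, ?_, ?_⟩
      · intro t _
        rw [mem_closedBall_zero_iff]
        dsimp only
        split_ifs with ht
        · rw [abs_le] at ht
          exact (hp1 _).trans (hPp _ (by linarith) (by linarith)).le
        · simp
      · intro s t hs hst ht
        have hs' : |s| ≤ n + 1 := abs_le.mpr ⟨hs, hst.trans ht⟩
        have ht' : |t| ≤ n + 1 := abs_le.mpr ⟨hs.trans hst, ht⟩
        dsimp only
        rw [if_pos hs', if_pos ht']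
        refine ⟨?_, hPp _ (by linarith) (by linarith)⟩
        obtain ⟨Q, hQ, hQ'⟩ := hP (s + (n + 1)) (t + (n + 1)) (by linarith) (by linarith)
          (by linarith)
        refine ⟨Q, by convert hQ using 2; ring, ?_⟩
        rw [hQ']; rfl
  have hmem : ∀ z ∈ ⋂ n, Zn n, ∀ s t : ℝ, s ≤ t →
      (∃ X ∈ S (t - s), z t = X (z s)) ∧ p (z s) = 1 := by
    intro z hz s t hst
    obtain ⟨n, hn⟩ := exists_nat_ge (max |s| |t|)
    have h1 := (le_max_left |s| |t|).trans hn
    have h2 := (le_max_right |s| |t|).trans hn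
    exact (Set.mem_iInter.mp hz n).2 s t (by linarith [neg_abs_le s]) hst (by linarith [le_abs_self t])
  have hpow : ∀ z ∈ ⋂ n, Zn n, ∀ s t : ℝ, s < t → ∀ a : ℝ, a ^ 2 = 1 → z t ≠ a • z s := by
    intro z hz s t hst a ha heq
    obtain ⟨⟨X, hX, hXz⟩, hps⟩ := hmem z hz s t hst.le
    have : z s = 0 := by
      refine eq_zero_of_pow_fix hS (sub_pos.mpr hst) hX (m := 2) two_pos ?_
      rw [pow_two, mul_apply_eq_comp, ← hXz, heq, map_smul, ← hXz, heq, smul_smul,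
        ← pow_two, ha, one_smul]
    rw [this, map_zero] at hps
    exact zero_ne_one hps
  refine ⟨⋂ n, Zn n, ?_, hne, ?_, ?_, ?_, ?_, ?_⟩
  · exact hcompact.of_isClosed_subset (isClosed_iInter hclosed)
      ((Set.iInter_subset _ 0).trans Set.inter_subset_left)
  · intro z hz a
    refine Set.mem_iInter.mpr fun n => ⟨fun t _ => ?_, fun s t _ hst _ => ?_⟩
    · exact (Set.mem_iInter.mp hz 0).1 (t + a) trivial
    · have := hmem z hz (s + a) (t + a) (by linarith)
      rwa [add_sub_add_right_eq_sub] at this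
  · exact fun z hz t => (hmem z hz t t le_rfl).2
  · intro z hz s t hst
    simpa using hpow z hz s t hst 1 (by norm_num)
  · intro z hz s t hst
    simpa using hpow z hz s t hst (-1) (by norm_num)
  · obtain ⟨c, hc0, hc⟩ := h.approx
    refine ⟨c, hc0, fun z hz s t hst ht1 => ?_⟩
    obtain ⟨⟨X, hX, hXz⟩, hps⟩ := hmem z hz s t hst
    obtain ⟨A, hA, hb⟩ := hc (t - s) (by linarith) (by linarith) X hX
    refine ⟨A, hA, ?_⟩
    have h1 : ‖z s‖ ≤ 1 := hps ▸ hp1 (z s)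
    have := (X - 1 - (t - s) • A).le_of_opNorm_le_of_le hb h1
    rw [mul_one] at this
    simpa [hXz] using this

end IsEvolution

section MinimalSets

variable {X : Type*} [TopologicalSpace X] [T2Space X]

/-- A compact nonempty set with a commuting family of continuous self-maps contains a
minimal compact nonempty invariant subset. -/
theorem exists_minimal_invariant {ι : Type*} {Z : Set X} (hZ : IsCompact Z) (hne : Z.Nonempty)
    (σ : ι → X → X) (hinv : ∀ i, Set.MapsTo (σ i) Z Z) :
    ∃ M ⊆ Z, M.Nonempty ∧ IsClosed M ∧ (∀ i, Set.MapsTo (σ i) M M) ∧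
      ∀ N ⊆ M, N.Nonempty → IsClosed N → (∀ i, Set.MapsTo (σ i) N N) → N = M := by
  set 𝒮 : Set (Set X) := {M | M ⊆ Z ∧ M.Nonempty ∧ IsClosed M ∧ ∀ i, Set.MapsTo (σ i) M M} with h𝒮
  have hZ𝒮 : Z ∈ 𝒮 := ⟨subset_rfl, hne, hZ.isClosed, hinv⟩
  obtain ⟨M, hM⟩ := zorn_superset 𝒮 (by
    intro c hc hchain
    rcases c.eq_empty_or_nonempty with rfl | hcne
    · exact ⟨Z, hZ𝒮, by simp⟩
    refine ⟨⋂₀ c, ⟨?_, ?_, ?_, ?_⟩, fun s hs => Set.sInter_subset_of_mem hs⟩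
    · obtain ⟨s, hs⟩ := hcne
      exact (Set.sInter_subset_of_mem hs).trans (hc hs).1
    · have := hcne.to_subtype
      exact IsCompact.nonempty_sInter_of_directed_nonempty_isCompact_isClosed
        (fun x hx y hy => (hchain.total hx hy).elim (fun h => ⟨x, hx, subset_rfl, h⟩)
          fun h => ⟨y, hy, h, subset_rfl⟩) (fun s hs => (hc hs).2.1)
        (fun s hs => hZ.of_isClosed_subset (hc hs).2.2.1 (hc hs).1) (fun s hs => (hc hs).2.2.1)
    · exact isClosed_sInter fun s hs => (hc hs).2.2.1
    · exact fun i x hx => Set.mem_sInter.mpr fun s hs => (hc hs).2.2.2 i (hx s hs))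
  obtain ⟨h1, h2, h3, h4⟩ := hM.prop
  refine ⟨M, h1, h2, h3, h4, fun N hN hNne hNc hNi => ?_⟩
  exact hN.antisymm (hM.le_of_le ⟨hN.trans h1, hNne, hNc, hNi⟩ hN)

end MinimalSets

section Curves

variable {E : Type*} [NormedAddCommGroup E]

/-- Compact sets of curves invariant under forward shifts contain a subset of recurrent curves. -/
theorem exists_recurrent_family {Z : Set (ℝ → E)} (hZ : IsCompact Z) (hne : Z.Nonempty)
    (hshift : ∀ z ∈ Z, ∀ h : ℝ, (fun t => z (t + h)) ∈ Z) :
    ∃ M ⊆ Z, M.Nonempty ∧ IsCompact M ∧ (∀ z ∈ M, ∀ h : ℝ, 0 ≤ h → (fun t => z (t + h)) ∈ M) ∧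
      ∀ z ∈ M, ∀ s, ∀ ε > 0, ∀ N, ∃ t > N, ‖z t - z s‖ < ε := by
  obtain ⟨M, hMZ, hMne, hMc, hMi, hmin⟩ := exists_minimal_invariant hZ hne
    (fun (h : ℝ≥0) (z : ℝ → E) (t : ℝ) => z (t + h)) (fun h z hz => hshift z hz h)
  refine ⟨M, hMZ, hMne, hZ.of_isClosed_subset hMc hMZ, fun z hz h hh => hMi ⟨h, hh⟩ hz, ?_⟩
  intro z hz s ε hε N
  set O : Set (ℝ → E) := (fun (h : ℝ) (t : ℝ) => z (t + h)) '' Set.Ici (max 0 (N - s + 1)) with hO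
  have hOM : closure O ⊆ M := closure_minimal (by
    rintro _ ⟨h, hh, rfl⟩
    exact hMi ⟨h, (le_max_left _ _).trans hh⟩ hz) hMc
  have hOeq : closure O = M := by
    refine hmin _ hOM (Set.Nonempty.closure ⟨_, _, Set.self_mem_Ici, rfl⟩) isClosed_closure
      fun h => ?_
    refine Set.MapsTo.closure ?_ (continuous_pi fun t => continuous_apply (t + (h : ℝ)))
    rintro _ ⟨a, ha, rfl⟩
    refine ⟨a + h, ?_, funext fun t => by ring_nf⟩
    exact le_trans (show _ ≤ a from ha) (by simp)
  have hzO : z ∈ closure O := hOeq ▸ hz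
  obtain ⟨_, hw, ⟨h, hh, rfl⟩⟩ := mem_closure_iff.mp hzO {w | ‖w s - z s‖ < ε}
    (isOpen_lt ((continuous_apply s).sub continuous_const).norm continuous_const) (by simpa using hε)
  refine ⟨s + h, ?_, hw⟩
  have h2 : N - s + 1 ≤ h := (le_max_right _ _).trans hh
  linarith

end Curves

section SupportFunctionals

variable {E : Type*} [NormedAddCommGroup E] [NormedSpace ℝ E] [FiniteDimensional ℝ E]

theorem exists_support (p : Seminorm ℝ E) {y : E} (hy : p y = 1) :
    ∃ l : E →L[ℝ] ℝ, (∀ x, l x ≤ p x) ∧ l y = 1 := by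
  have hy0 : y ≠ 0 := by
    rintro rfl
    simp at hy
  obtain ⟨g, hg1, hg2⟩ := exists_extension_of_le_sublinear
    (LinearPMap.mkSpanSingleton y (1 : ℝ) hy0) p
    (fun c hc x => by rw [map_smul_eq_mul, Real.norm_eq_abs, abs_of_pos hc])
    (map_add_le_add p) (by
      rintro ⟨x, hx⟩
      obtain ⟨c, rfl⟩ := Submodule.mem_span_singleton.mp hx
      have : (LinearPMap.mkSpanSingleton y (1 : ℝ) hy0) ⟨c • y, hx⟩ = c • (1 : ℝ) :=
        LinearPMap.mkSpanSingleton'_apply _ _ _ _ _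
      rw [this]
      simp only [smul_eq_mul, mul_one, map_smul_eq_mul, hy, Real.norm_eq_abs]
      exact le_abs_self c)
  refine ⟨LinearMap.toContinuousLinearMap g, hg2, ?_⟩
  have := hg1 ⟨y, Submodule.mem_span_singleton_self y⟩
  rw [LinearPMap.mkSpanSingleton_apply] at this
  exact this

theorem isCompact_le_seminorm {p : Seminorm ℝ E} {C : ℝ} (hp : ∀ x, p x ≤ C * ‖x‖) :
    IsCompact {l : E →L[ℝ] ℝ | ∀ x, l x ≤ p x} := by
  have : ProperSpace (E →L[ℝ] ℝ) := FiniteDimensional.proper ℝ _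
  refine Metric.isCompact_of_isClosed_isBounded ?_
    ((Metric.isBounded_closedBall (x := (0 : E →L[ℝ] ℝ)) (r := |C|)).subset fun l hl => ?_)
  · simp only [Set.ofPred_forall]
    exact isClosed_iInter fun x => isClosed_le (by fun_prop) continuous_const
  · rw [mem_closedBall_zero_iff]
    refine l.opNorm_le_bound (abs_nonneg C) fun x => ?_
    have h1 := hl x
    have h2 := hl (-x)
    rw [map_neg, map_neg_eq_map] at h2
    have h3 : C * ‖x‖ ≤ |C| * ‖x‖ := by gcongr; exact le_abs_self C
    rw [Real.norm_eq_abs, abs_le]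
    constructor <;> linarith [hp x]

/-- Two independent functionals on a space of dimension at most three are complemented by a third
one to an injective map. -/
theorem exists_complementary (hd : Module.finrank ℝ E ≤ 3) {a b : E →L[ℝ] ℝ} {u v : E}
    (hu : a u ≠ 0) (hav : a v = 0) (hbv : b v ≠ 0) :
    ∃ g : E →L[ℝ] ℝ, ∀ e, a e = 0 → b e = 0 → g e = 0 → e = 0 := by
  set A : Submodule ℝ E := LinearMap.ker (a : E →ₗ[ℝ] ℝ) with hA
  set B : Submodule ℝ E := A ⊓ LinearMap.ker (b : E →ₗ[ℝ] ℝ) with hB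
  have h1 : A < ⊤ := lt_top_iff_ne_top.mpr fun h => hu (by
    have : u ∈ A := h ▸ Submodule.mem_top
    simpa [hA] using this)
  have h2 : B < A := by
    refine lt_of_le_of_ne inf_le_left fun h => hbv ?_
    have : v ∈ B := h ▸ (by simpa [hA] using hav)
    simpa [hB] using this.2
  have h3 := Submodule.finrank_lt h1.ne
  have h4 := Submodule.finrank_lt_finrank_of_lt h2
  obtain ⟨v, hv⟩ := finrank_le_one_iff.mp (show Module.finrank ℝ B ≤ 1 by omega)
  have hB' : ∀ e, a e = 0 → b e = 0 → e ∈ B := fun e h h' => by simp [hB, hA, h, h']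
  rcases eq_or_ne (v : E) 0 with h0 | h0
  · refine ⟨0, fun e h h' _ => ?_⟩
    obtain ⟨c, hc⟩ := hv ⟨e, hB' e h h'⟩
    have := congrArg (Subtype.val) hc
    simpa [h0, eq_comm] using this
  · obtain ⟨g, hg⟩ := SeparatingDual.exists_ne_zero (R := ℝ) h0
    refine ⟨g, fun e h h' h'' => ?_⟩
    obtain ⟨c, hc⟩ := hv ⟨e, hB' e h h'⟩
    have hce : c • (v : E) = e := congrArg (Subtype.val) hc
    rw [← hce, map_smul, smul_eq_mul, mul_eq_zero, or_iff_left hg] at h''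
    rw [← hce, h'', zero_smul]

theorem exists_norm_le_of_injective {a b g : E →L[ℝ] ℝ}
    (h : ∀ e, a e = 0 → b e = 0 → g e = 0 → e = 0) :
    ∃ κ > 0, ∀ e, ‖e‖ ≤ κ * (|a e| + |b e| + |g e|) := by
  set f : E →L[ℝ] ℝ × ℝ × ℝ := a.prod (b.prod g) with hf
  obtain ⟨κ, hκ, hanti⟩ := LinearMap.exists_antilipschitzWith (f : E →ₗ[ℝ] ℝ × ℝ × ℝ) (by
    rw [LinearMap.ker_eq_bot']
    intro e he
    have h1 : (a e, b e, g e) = 0 := he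
    simp only [Prod.mk_eq_zero] at h1
    exact h e h1.1 h1.2.1 h1.2.2)
  refine ⟨κ, by exact_mod_cast hκ, fun e => ?_⟩
  have h1 := hanti.le_mul_dist e 0
  rw [dist_zero_right, map_zero, dist_zero_right] at h1
  refine h1.trans ?_
  gcongr
  change ‖(a e, b e, g e)‖ ≤ _
  simp only [Prod.norm_mk, Real.norm_eq_abs]
  have := abs_nonneg (a e)
  have := abs_nonneg (b e)
  have := abs_nonneg (g e)
  refine max_le (by linarith) (max_le (by linarith) (by linarith))

end SupportFunctionals

section SmoothPoint

variable {E : Type*} [NormedAddCommGroup E] [NormedSpace ℝ E]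

/-- The functionals supporting the unit ball of `p` at `y`. -/
def supportSet (p : Seminorm ℝ E) (y : E) : Set (E →L[ℝ] ℝ) :=
  {l | (∀ x, l x ≤ p x) ∧ l y = 1}

/-- `g` separates points whose difference is almost annihilated by `a` and `b`. -/
def AlmostComplementary (a b g : E →L[ℝ] ℝ) (δ : ℝ) : Prop :=
  ∀ e, |a e| ≤ δ * ‖e‖ → |b e| ≤ δ * ‖e‖ → g e = 0 → e = 0

theorem exists_almostComplementary [FiniteDimensional ℝ E] (hd : Module.finrank ℝ E ≤ 3)
    {p : Seminorm ℝ E} {y : E} {l l' : E →L[ℝ] ℝ} (hl : l ∈ supportSet p y)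
    (hl' : l' ∈ supportSet p y) (hne : l' ≠ l) :
    ∃ δ > 0, ∃ g, ∀ a b, ∀ η ≤ δ, ‖l - a‖ ≤ η → ‖l' - b‖ ≤ η →
      AlmostComplementary a b g η := by
  obtain ⟨x, hx⟩ : ∃ x, l' x ≠ l x := by
    by_contra! h
    exact hne (ContinuousLinearMap.ext h)
  obtain ⟨g, hg⟩ := exists_complementary hd (a := l) (b := l') (u := y) (v := x - l x • y)
    (by rw [hl.2]; exact one_ne_zero) (by simp [hl.2]) (by simpa [hl'.2, sub_eq_zero] using hx)
  obtain ⟨κ, hκ, hκ'⟩ := exists_norm_le_of_injective hg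
  refine ⟨1 / (8 * κ), by positivity, g, fun a b η hη ha hb e hae hbe hge => ?_⟩
  have h1 : |l e| ≤ 2 * η * ‖e‖ := by
    have h := (l - a).le_of_opNorm_le ha e
    rw [sub_apply, Real.norm_eq_abs] at h
    have := abs_add_le (l e - a e) (a e)
    rw [sub_add_cancel] at this
    linarith
  have h2 : |l' e| ≤ 2 * η * ‖e‖ := by
    have h := (l' - b).le_of_opNorm_le hb e
    rw [sub_apply, Real.norm_eq_abs] at h
    have := abs_add_le (l' e - b e) (b e)
    rw [sub_add_cancel] at this
    linarith
  have h3 := hκ' e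
  rw [hge, abs_zero, add_zero] at h3
  have h4 : κ * η ≤ 1 / 8 := by
    rw [le_div_iff₀ (by positivity)] at hη
    linarith
  have h5 : ‖e‖ ≤ 4 * (κ * η) * ‖e‖ := by
    have := mul_le_mul_of_nonneg_left (add_le_add h1 h2) hκ.le
    linarith
  have h6 := mul_le_mul_of_nonneg_right h4 (norm_nonneg e)
  exact norm_le_zero_iff.mp (by linarith)

theorem AlmostComplementary.injective {p : Seminorm ℝ E} {a b g : E →L[ℝ] ℝ} {δ : ℝ}
    (h : AlmostComplementary a b g δ) {x y : E} (hpx : p x = 1) (hpy : p y = 1)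
    (hx : ∃ l ∈ supportSet p x, ∃ l' ∈ supportSet p x, ‖l - a‖ ≤ δ ∧ ‖l' - b‖ ≤ δ)
    (hy : ∃ l ∈ supportSet p y, ∃ l' ∈ supportSet p y, ‖l - a‖ ≤ δ ∧ ‖l' - b‖ ≤ δ)
    (hg : g x = g y) : x = y := by
  have key : ∀ a l l' : E →L[ℝ] ℝ, l ∈ supportSet p x → l' ∈ supportSet p y → ‖l - a‖ ≤ δ →
      ‖l' - a‖ ≤ δ → |a (x - y)| ≤ δ * ‖x - y‖ := by
    intro a l l' hl hl' hla hla'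
    have h1 := (l - a).le_of_opNorm_le hla (x - y)
    have h2 := (l' - a).le_of_opNorm_le hla' (x - y)
    rw [sub_apply, Real.norm_eq_abs] at h1 h2
    have h3 : 0 ≤ l (x - y) := by
      rw [map_sub, hl.2]; linarith [hl.1 y]
    have h4 : l' (x - y) ≤ 0 := by
      rw [map_sub, hl'.2]; linarith [hl'.1 x]
    rw [abs_le] at h1 h2 ⊢
    constructor <;> linarith
  obtain ⟨l₁, h₁, l₂, h₂, h₃, h₄⟩ := hx
  obtain ⟨m₁, k₁, m₂, k₂, k₃, k₄⟩ := hy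
  refine sub_eq_zero.mp (h _ (key a l₁ m₁ h₁ k₁ h₃ k₃) (key b l₂ m₂ h₂ k₂ h₄ k₄) ?_)
  rw [map_sub, hg, sub_self]

theorem isClosed_setOf_exists_support [FiniteDimensional ℝ E] {p : Seminorm ℝ E} {C : ℝ}
    (hp : ∀ x, p x ≤ C * ‖x‖) (a b : E →L[ℝ] ℝ) (δ : ℝ) :
    IsClosed {y | ∃ l ∈ supportSet p y, ∃ l' ∈ supportSet p y, ‖l - a‖ ≤ δ ∧ ‖l' - b‖ ≤ δ} := by
  set L : Set (E →L[ℝ] ℝ) := {l | ∀ x, l x ≤ p x}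
  have : CompactSpace L := isCompact_iff_compactSpace.mp (isCompact_le_seminorm hp)
  have hcl : IsClosed {q : (L × L) × E | (q.1.1 : E →L[ℝ] ℝ) q.2 = 1 ∧
      (q.1.2 : E →L[ℝ] ℝ) q.2 = 1 ∧ ‖(q.1.1 : E →L[ℝ] ℝ) - a‖ ≤ δ ∧
      ‖(q.1.2 : E →L[ℝ] ℝ) - b‖ ≤ δ} := by
    simp only [Set.ofPred_and]
    exact (isClosed_eq (by fun_prop) (by fun_prop)).inter <|
      (isClosed_eq (by fun_prop) (by fun_prop)).inter <|
      (isClosed_le (by fun_prop) (by fun_prop)).inter (isClosed_le (by fun_prop) (by fun_prop))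
  convert isClosedMap_snd_of_compactSpace _ hcl using 1
  ext y
  constructor
  · rintro ⟨l, hl, l', hl', h1, h2⟩
    exact ⟨((⟨l, hl.1⟩, ⟨l', hl'.1⟩), y), ⟨hl.2, hl'.2, h1, h2⟩, rfl⟩
  · rintro ⟨⟨⟨l, l'⟩, y⟩, ⟨h1, h2, h3, h4⟩, rfl⟩
    exact ⟨l, ⟨l.2, h1⟩, l', ⟨l'.2, h2⟩, h3, h4⟩

/-- A family of recurrent simple curves on the unit sphere of a norm on a space of dimension at
most three passes through a point where the norm is differentiable. -/
theorem exists_smooth_point [FiniteDimensional ℝ E] (hd : Module.finrank ℝ E ≤ 3)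
    {p : Seminorm ℝ E} {C : ℝ} (hp : ∀ x, p x ≤ C * ‖x‖) {M : Set (ℝ → E)}
    (hne : M.Nonempty) (hM : IsCompact M) (hcont : ∀ z ∈ M, Continuous z)
    (hnorm : ∀ z ∈ M, ∀ t, p (z t) = 1) (hsimple : ∀ z ∈ M, ∀ s t, s < t → z t ≠ z s)
    (hshift : ∀ z ∈ M, ∀ h : ℝ, 0 ≤ h → (fun t => z (t + h)) ∈ M)
    (hrec : ∀ z ∈ M, ∀ s, ∀ ε > 0, ∀ N, ∃ t > N, ‖z t - z s‖ < ε) :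
    ∃ z ∈ M, ∃ l, supportSet p (z 0) = {l} := by
  by_contra! H
  set Ω : Set E := (fun z => z 0) '' M with hΩ
  have hΩc : IsCompact Ω := hM.image (continuous_apply 0)
  have hzΩ : ∀ z ∈ M, ∀ t, 0 ≤ t → z t ∈ Ω := fun z hz t ht =>
    ⟨_, hshift z hz t ht, by simp⟩
  have hΩ1 : ∀ y ∈ Ω, p y = 1 := by
    rintro _ ⟨z, hz, rfl⟩
    exact hnorm z hz 0
  have : CompactSpace Ω := isCompact_iff_compactSpace.mp hΩc
  have : Nonempty Ω := (hne.image _).to_subtype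
  have : ProperSpace (E →L[ℝ] ℝ) := FiniteDimensional.proper ℝ _
  set D := TopologicalSpace.denseSeq (E →L[ℝ] ℝ) with hD
  have hDd := TopologicalSpace.denseRange_denseSeq (E →L[ℝ] ℝ)
  set Q : ℕ × ℕ × ℕ → Set Ω := fun i => {y | (∃ g, AlmostComplementary (D i.1) (D i.2.1) g
    (1 / (i.2.2 + 1))) ∧ ∃ l ∈ supportSet p y, ∃ l' ∈ supportSet p y,
      ‖l - D i.1‖ ≤ 1 / (i.2.2 + 1) ∧ ‖l' - D i.2.1‖ ≤ 1 / (i.2.2 + 1)} with hQ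
  obtain ⟨⟨i, j, k⟩, ⟨y₀, hy₀⟩⟩ := nonempty_interior_of_iUnion_of_closed (f := Q) (by
    intro i
    refine (isClosed_const).inter ?_
    exact (isClosed_setOf_exists_support hp _ _ _).preimage continuous_subtype_val) (by
    refine Set.eq_univ_of_forall fun y => Set.mem_iUnion.mpr ?_
    obtain ⟨z, hz, hzy⟩ := y.2
    obtain ⟨l, hl⟩ := exists_support p (hΩ1 y y.2)
    obtain ⟨l', hl', hne⟩ : ∃ l' ∈ supportSet p y, l' ≠ l := by
      by_contra! h
      refine H z hz l (Set.eq_singleton_iff_unique_mem.mpr ?_)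
      have hzy' : z 0 = y := hzy
      rw [hzy']
      exact ⟨hl, h⟩
    obtain ⟨δ, hδ, g, hg⟩ := exists_almostComplementary hd hl hl' hne
    obtain ⟨k, hk⟩ := exists_nat_one_div_lt hδ
    have hk0 : (0 : ℝ) < 1 / (k + 1) := by positivity
    obtain ⟨i, hi⟩ := hDd.exists_dist_lt l hk0
    obtain ⟨j, hj⟩ := hDd.exists_dist_lt l' hk0
    rw [dist_eq_norm] at hi hj
    exact ⟨(i, j, k), ⟨g, hg _ _ _ hk.le hi.le hj.le⟩, l, hl, l', hl', hi.le, hj.le⟩)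
  obtain ⟨ε, hε, hball⟩ := Metric.mem_nhds_iff.mp (mem_interior_iff_mem_nhds.mp hy₀)
  obtain ⟨⟨g, hg⟩, -⟩ := hball (Metric.mem_ball_self hε)
  obtain ⟨z, hz, hzy⟩ := y₀.2
  have hzy : z 0 = y₀ := hzy
  have hinj : ∀ s t, 0 ≤ s → s < t → ‖z s - z 0‖ < ε → ‖z t - z 0‖ < ε → g (z s) ≠ g (z t) := by
    intro s t hs hst h1 h2 h
    have hs' := hball (show (⟨z s, hzΩ z hz s hs⟩ : Ω) ∈ Metric.ball y₀ ε by
      rwa [Metric.mem_ball, Subtype.dist_eq, ← hzy, dist_eq_norm])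
    have ht' := hball (show (⟨z t, hzΩ z hz t (hs.trans hst.le)⟩ : Ω) ∈ Metric.ball y₀ ε by
      rwa [Metric.mem_ball, Subtype.dist_eq, ← hzy, dist_eq_norm])
    exact hsimple z hz s t hst (hg.injective (hnorm z hz s) (hnorm z hz t) hs'.2 ht'.2 h).symm
  have hg0 : ∀ᶠ s in 𝓝 0, ‖z s - z 0‖ < ε := by
    have : Tendsto (fun s => ‖z s - z 0‖) (𝓝 0) (𝓝 0) := by
      have := (((hcont z hz).sub continuous_const).norm (f := fun s => z s - z 0)).tendsto 0
      simpa using this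
    exact this.eventually_lt_const hε
  obtain ⟨η, hη, hη'⟩ := Metric.eventually_nhds_iff.mp hg0
  have hη2 : ∀ s ∈ Set.Icc 0 (η / 2), ‖z s - z 0‖ < ε := by
    intro s hs
    refine hη' ?_
    rw [dist_zero_right, Real.norm_eq_abs, abs_of_nonneg hs.1]
    linarith [hs.2]
  have hgz : Continuous fun s => g (z s) := g.continuous.comp (hcont z hz)
  have hmono := hgz.continuousOn.strictMonoOn_of_injOn_Icc' (show (0 : ℝ) ≤ η / 2 by positivity) (by
    intro s hs t ht hst
    rcases lt_trichotomy s t with h | h | h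
    · exact absurd hst (hinj s t hs.1 h (hη2 s hs) (hη2 t ht))
    · exact h
    · exact absurd hst.symm (hinj t s ht.1 h (hη2 t ht) (hη2 s hs)))
  have m0 : (0 : ℝ) ∈ Set.Icc 0 (η / 2) := ⟨le_rfl, by positivity⟩
  have m1 : η / 4 ∈ Set.Icc 0 (η / 2) := ⟨by positivity, by linarith⟩
  have m2 : η / 2 ∈ Set.Icc 0 (η / 2) := ⟨by positivity, le_rfl⟩
  set J : Set ℝ := Set.Ioo (min (g (z 0)) (g (z (η / 2)))) (max (g (z 0)) (g (z (η / 2)))) with hJ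
  have hmid : g (z (η / 4)) ∈ J := by
    rcases hmono with h | h
    · exact ⟨min_lt_of_left_lt (h m0 m1 (by positivity)),
        lt_max_of_lt_right (h m1 m2 (by linarith))⟩
    · exact ⟨min_lt_of_right_lt (h m1 m2 (by linarith)),
        lt_max_of_lt_left (h m0 m1 (by positivity))⟩
  have hopen : IsOpen {x | ‖x - z 0‖ < ε ∧ g x ∈ J} := by
    simp only [Set.ofPred_and]
    exact (isOpen_lt (by fun_prop) (by fun_prop)).inter (isOpen_Ioo.preimage g.continuous)
  obtain ⟨ε', hε', hsub⟩ := Metric.isOpen_iff.mp hopen (z (η / 4)) ⟨hη2 _ m1, hmid⟩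
  obtain ⟨T, hT, hTz⟩ := hrec z hz (η / 4) ε' hε' (η / 2)
  obtain ⟨h1, h2⟩ := hsub (mem_ball_iff_norm.mpr hTz)
  obtain ⟨s, hs, hsT⟩ := intermediate_value_uIcc (a := 0) (b := η / 2) hgz.continuousOn
    (show g (z T) ∈ Set.uIcc (g (z 0)) (g (z (η / 2))) from ⟨h2.1.le, h2.2.le⟩)
  rw [Set.uIcc_of_le (by positivity)] at hs
  exact hinj s T hs.1 (by linarith [hs.2]) (hη2 s hs) h1 hsT

end SmoothPoint

section Stereographic

variable {E : Type*} [NormedAddCommGroup E] [NormedSpace ℝ E]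

/-- The denominator of the stereographic projection. -/
noncomputable def stereoDenom (l f g : E →L[ℝ] ℝ) (x : E) : ℝ :=
  l x + √(l x ^ 2 + f x ^ 2 + g x ^ 2)

/-- Stereographic projection of directions, in the coordinates `(l, f, g)`. -/
noncomputable def stereo (l f g : E →L[ℝ] ℝ) (x : E) : ℂ :=
  ⟨f x / stereoDenom l f g x, g x / stereoDenom l f g x⟩

variable {l f g : E →L[ℝ] ℝ} {x x' y : E}

theorem continuous_stereoDenom : Continuous (stereoDenom l f g) := by
  unfold stereoDenom
  fun_prop

theorem continuousAt_stereo (hx : 0 < stereoDenom l f g x) : ContinuousAt (stereo l f g) x := by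
  have h : stereo l f g = fun x => ((f x / stereoDenom l f g x : ℝ) : ℂ) +
      ((g x / stereoDenom l f g x : ℝ) : ℂ) * Complex.I := by
    funext x
    apply Complex.ext <;> simp [stereo]
  have hd := (continuous_stereoDenom (l := l) (f := f) (g := g)).continuousAt (x := x)
  rw [h]
  exact (Complex.continuous_ofReal.continuousAt.comp (f.continuous.continuousAt.div hd hx.ne')).add
    ((Complex.continuous_ofReal.continuousAt.comp
      (g.continuous.continuousAt.div hd hx.ne')).mul continuousAt_const)

theorem stereo_spec (hx : 0 < stereoDenom l f g x) :
    f x = (stereo l f g x).re * stereoDenom l f g x ∧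
    g x = (stereo l f g x).im * stereoDenom l f g x ∧
    2 * l x = stereoDenom l f g x * (1 - ‖stereo l f g x‖ ^ 2) := by
  have h1 : f x = (stereo l f g x).re * stereoDenom l f g x := by
    simp only [stereo]; field_simp
  have h2 : g x = (stereo l f g x).im * stereoDenom l f g x := by
    simp only [stereo]; field_simp
  refine ⟨h1, h2, ?_⟩
  have h3 : (stereoDenom l f g x - l x) ^ 2 = l x ^ 2 + f x ^ 2 + g x ^ 2 := by
    rw [stereoDenom, add_sub_cancel_left, Real.sq_sqrt (by positivity)]
  rw [Complex.sq_norm, Complex.normSq_apply]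
  refine mul_left_cancel₀ hx.ne' ?_
  nth_rewrite 1 [h1] at h3
  nth_rewrite 1 [h2] at h3
  linear_combination -h3

theorem stereoDenom_pos {p : Seminorm ℝ E} (hinj : ∀ e, l e = 0 → f e = 0 → g e = 0 → e = 0)
    (hly : l y = 1) (hfy : f y = 0) (hgy : g y = 0) (hpy : p y = 1) (hpx : p x = 1)
    (hx : x ≠ -y) : 0 < stereoDenom l f g x := by
  have h0 : |l x| ≤ √(l x ^ 2 + f x ^ 2 + g x ^ 2) :=
    Real.abs_le_sqrt (by nlinarith [sq_nonneg (f x), sq_nonneg (g x)])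
  by_contra! h
  rw [stereoDenom] at h
  have h1 : √(l x ^ 2 + f x ^ 2 + g x ^ 2) = - l x := by
    have := neg_abs_le (l x)
    linarith
  have h2 : l x ^ 2 + f x ^ 2 + g x ^ 2 = l x ^ 2 := by
    rw [← Real.sq_sqrt (show 0 ≤ l x ^ 2 + f x ^ 2 + g x ^ 2 by positivity), h1, neg_sq]
  have hf : f x = 0 := by nlinarith [sq_nonneg (f x), sq_nonneg (g x)]
  have hg : g x = 0 := by nlinarith [sq_nonneg (f x), sq_nonneg (g x)]
  have h3 : x = l x • y := sub_eq_zero.mp <| hinj _ (by simp [hly]) (by simp [hf, hfy])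
    (by simp [hg, hgy])
  have h4 : |l x| = 1 := by
    rw [h3, map_smul_eq_mul, hpy, mul_one, Real.norm_eq_abs] at hpx
    simpa [hly] using hpx
  have h5 : l x = -1 := by
    have := abs_nonneg (l x)
    have h6 : l x ≤ 0 := by linarith [Real.sqrt_nonneg (l x ^ 2 + f x ^ 2 + g x ^ 2)]
    rw [abs_of_nonpos h6] at h4
    linarith
  rw [h5, neg_one_smul] at h3
  exact hx h3

theorem stereo_injective {p : Seminorm ℝ E} (hinj : ∀ e, l e = 0 → f e = 0 → g e = 0 → e = 0)
    (hx : 0 < stereoDenom l f g x) (hx' : 0 < stereoDenom l f g x') (hpx : p x = 1)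
    (hpx' : p x' = 1) (h : stereo l f g x = stereo l f g x') : x = x' := by
  obtain ⟨h1, h2, h3⟩ := stereo_spec hx
  obtain ⟨h1', h2', h3'⟩ := stereo_spec hx'
  rw [h] at h1 h2 h3
  set a := stereoDenom l f g x
  set a' := stereoDenom l f g x'
  have h4 : a' • x = a • x' := by
    refine sub_eq_zero.mp (hinj _ ?_ ?_ ?_)
    · simp only [map_sub, map_smul, smul_eq_mul]
      linear_combination (a' * h3 - a * h3') / 2
    · simp only [map_sub, map_smul, smul_eq_mul]
      linear_combination a' * h1 - a * h1'
    · simp only [map_sub, map_smul, smul_eq_mul]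
      linear_combination a' * h2 - a * h2'
  have h5 := congrArg p h4
  rw [map_smul_eq_mul, map_smul_eq_mul, hpx, hpx', Real.norm_of_nonneg hx.le,
    Real.norm_of_nonneg hx'.le, mul_one, mul_one] at h5
  rw [h5] at h4
  exact smul_right_injective E hx.ne' h4

/-- Directions with small stereographic projection are close to the pole. -/
theorem exists_norm_sub_le_of_stereo [FiniteDimensional ℝ E] {p : Seminorm ℝ E} {C : ℝ}
    (hp1 : ∀ x, ‖x‖ ≤ p x) (hp2 : ∀ x, p x ≤ C * ‖x‖)
    (hinj : ∀ e, l e = 0 → f e = 0 → g e = 0 → e = 0)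
    (hly : l y = 1) (hfy : f y = 0) (hgy : g y = 0) (hpy : p y = 1) :
    ∃ B > 0, ∀ x, p x = 1 → 0 < stereoDenom l f g x → ‖stereo l f g x‖ < 1 →
      ‖x - y‖ ≤ B * ‖stereo l f g x‖ := by
  obtain ⟨κ, hκ, hκ'⟩ := exists_norm_le_of_injective hinj
  have hC : 0 ≤ C := by
    have h1 := hp2 y
    rw [hpy] at h1
    by_contra! h
    nlinarith [norm_nonneg y]
  set B₀ := 2 * ‖l‖ + ‖f‖ + ‖g‖ with hB₀
  have hB₀0 : 0 ≤ B₀ := by positivity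
  refine ⟨(1 + C) * (2 * κ * B₀) + 1, by positivity, fun x hpx hx hlt => ?_⟩
  have hx1 : ‖x‖ ≤ 1 := hpx ▸ hp1 x
  have hle : ∀ m : E →L[ℝ] ℝ, |m x| ≤ ‖m‖ := fun m => by
    have := m.le_opNorm x
    rw [Real.norm_eq_abs] at this
    exact this.trans (mul_le_of_le_one_right (norm_nonneg m) hx1)
  have hden : stereoDenom l f g x ≤ B₀ := by
    have h1 : √(l x ^ 2 + f x ^ 2 + g x ^ 2) ≤ |l x| + |f x| + |g x| := by
      rw [Real.sqrt_le_left (by positivity)]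
      rw [← sq_abs (l x), ← sq_abs (f x), ← sq_abs (g x)]
      nlinarith [mul_nonneg (abs_nonneg (l x)) (abs_nonneg (f x)),
        mul_nonneg (abs_nonneg (l x)) (abs_nonneg (g x)),
        mul_nonneg (abs_nonneg (f x)) (abs_nonneg (g x))]
    rw [stereoDenom]
    linarith [hle l, hle f, hle g, le_abs_self (l x)]
  obtain ⟨h1, h2, h3⟩ := stereo_spec hx
  set G := stereo l f g x
  set a := stereoDenom l f g x
  have hl0 : 0 ≤ l x := by
    have : 0 ≤ a * (1 - ‖G‖ ^ 2) := mul_nonneg hx.le (by nlinarith [norm_nonneg G])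
    linarith
  have hf : |f x| ≤ B₀ * ‖G‖ := by
    rw [h1, abs_mul, abs_of_pos hx, mul_comm]
    exact mul_le_mul hden (Complex.abs_re_le_norm G) (abs_nonneg _) hB₀0
  have hg : |g x| ≤ B₀ * ‖G‖ := by
    rw [h2, abs_mul, abs_of_pos hx, mul_comm]
    exact mul_le_mul hden (Complex.abs_im_le_norm G) (abs_nonneg _) hB₀0
  have h4 : ‖x - l x • y‖ ≤ 2 * κ * B₀ * ‖G‖ := by
    refine (hκ' _).trans ?_
    simp only [map_sub, map_smul, smul_eq_mul, hly, hfy, hgy, mul_one, mul_zero, sub_zero, sub_self,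
      abs_zero, zero_add]
    have := mul_le_mul_of_nonneg_left (add_le_add hf hg) hκ.le
    linarith
  have h5 : |1 - l x| ≤ C * (2 * κ * B₀ * ‖G‖) := by
    have h6 : p (l x • y) = l x := by
      rw [map_smul_eq_mul, hpy, mul_one, Real.norm_of_nonneg hl0]
    have h7 := abs_sub_map_le_sub p x (l x • y)
    rw [hpx, h6] at h7
    exact h7.trans ((hp2 _).trans (by gcongr))
  have h8 : x - y = (x - l x • y) - (1 - l x) • y := by module
  calc ‖x - y‖ ≤ ‖x - l x • y‖ + |1 - l x| * ‖y‖ := by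
        rw [h8]
        refine (norm_sub_le _ _).trans ?_
        rw [norm_smul, Real.norm_eq_abs]
    _ ≤ 2 * κ * B₀ * ‖G‖ + C * (2 * κ * B₀ * ‖G‖) * 1 := by
        gcongr
        exact hpy ▸ hp1 y
    _ ≤ ((1 + C) * (2 * κ * B₀) + 1) * ‖G‖ := by nlinarith [norm_nonneg G]

end Stereographic

theorem tendsto_clm_apply {ι E F : Type*} [NormedAddCommGroup E] [NormedSpace ℝ E]
    [NormedAddCommGroup F] [NormedSpace ℝ F] {q : Filter ι} {f : ι → E →L[ℝ] F} {x : ι → E}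
    {f₀ : E →L[ℝ] F} {x₀ : E} (hf : Tendsto f q (𝓝 f₀)) (hx : Tendsto x q (𝓝 x₀)) :
    Tendsto (fun i => f i (x i)) q (𝓝 (f₀ x₀)) :=
  (isBoundedBilinearMap_apply.continuous.tendsto (f₀, x₀)).comp (hf.prodMk_nhds hx)

namespace IsExtremalFamily

variable {E : Type*} [NormedAddCommGroup E] [NormedSpace ℝ E]
  {p : Seminorm ℝ E} {K : Set (E →L[ℝ] E)} {Z : Set (ℝ → E)}

theorem exists_norm_sub_le (h : IsExtremalFamily p K Z) (hp : ∀ x, ‖x‖ ≤ p x) (hK : IsCompact K) :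
    ∃ Λ > 0, ∀ z ∈ Z, ∀ s t, |t - s| ≤ 1 → ‖z t - z s‖ ≤ Λ * |t - s| := by
  obtain ⟨c, hc, hincr⟩ := h.incr
  obtain ⟨B, hB⟩ := hK.exists_bound_of_continuousOn (f := id) continuousOn_id
  refine ⟨|B| + c + 1, by positivity, ?_⟩
  have key : ∀ z ∈ Z, ∀ s t, s ≤ t → t ≤ s + 1 → ‖z t - z s‖ ≤ (|B| + c + 1) * (t - s) := by
    intro z hz s t hst hst1
    obtain ⟨A, hA, hAz⟩ := hincr z hz s t hst hst1
    have h1 : ‖A (z s)‖ ≤ |B| :=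
      calc ‖A (z s)‖ ≤ ‖A‖ * ‖z s‖ := A.le_opNorm _
        _ ≤ |B| * 1 := by
          gcongr
          · exact (hB A hA).trans (le_abs_self B)
          · exact (hp _).trans (h.norm_eq z hz s).le
        _ = |B| := mul_one _
    have h2 : ‖(t - s) • A (z s)‖ ≤ (t - s) * |B| := by
      rw [norm_smul, Real.norm_of_nonneg (by linarith)]
      exact mul_le_mul_of_nonneg_left h1 (by linarith)
    have h3 : z t - z s = (z t - z s - (t - s) • A (z s)) + (t - s) • A (z s) := by abel
    have h4 := norm_add_le (z t - z s - (t - s) • A (z s)) ((t - s) • A (z s))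
    rw [← h3] at h4
    have h5 : c * (t - s) ^ 2 ≤ c * (t - s) := mul_le_mul_of_nonneg_left (by nlinarith) hc
    linarith
  intro z hz s t hst
  rcases le_total s t with h' | h'
  · rw [abs_of_nonneg (sub_nonneg.mpr h')] at hst ⊢
    exact key z hz s t h' (by linarith)
  · rw [abs_sub_comm, abs_of_nonneg (sub_nonneg.mpr h')] at hst ⊢
    rw [norm_sub_rev]
    exact key z hz t s h' (by linarith)

theorem continuous (h : IsExtremalFamily p K Z) (hp : ∀ x, ‖x‖ ≤ p x) (hK : IsCompact K)
    {z : ℝ → E} (hz : z ∈ Z) : Continuous z := by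
  obtain ⟨Λ, hΛ, hL⟩ := h.exists_norm_sub_le hp hK
  refine continuous_iff_continuousAt.mpr fun s => ?_
  rw [Metric.continuousAt_iff]
  intro ε hε
  refine ⟨min 1 (ε / Λ), by positivity, fun {t} ht => ?_⟩
  rw [Real.dist_eq, lt_min_iff, lt_div_iff₀ hΛ] at ht
  rw [dist_eq_norm]
  exact (hL z hz s t ht.1.le).trans_lt (by linarith [ht.2])

/-- Near a point where `p` is differentiable the velocities are almost tangent to its sphere. -/
theorem exists_tangent_incr [FiniteDimensional ℝ E] (h : IsExtremalFamily p K Z) {C : ℝ}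
    (hp1 : ∀ x, ‖x‖ ≤ p x) (hp2 : ∀ x, p x ≤ C * ‖x‖) (hK : IsCompact K) {y : E}
    {l : E →L[ℝ] ℝ} (hl : supportSet p y = {l}) {ε : ℝ} (hε : 0 < ε) :
    ∃ r > 0, ∀ z ∈ Z, ∀ s t, s < t → t ≤ s + r → ‖z s - y‖ < r →
      ∃ A ∈ K, l (A y) = 0 ∧ ‖z t - z s - (t - s) • A y‖ ≤ ε * (t - s) := by
  by_contra! H
  obtain ⟨c, hc, hincr⟩ := h.incr
  obtain ⟨Λ, hΛ, hL⟩ := h.exists_norm_sub_le hp1 hK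
  have hr : ∀ n : ℕ, (0 : ℝ) < 1 / (n + 1) := fun n => by positivity
  have hr1 : ∀ n : ℕ, (1 : ℝ) / (n + 1) ≤ 1 := fun n => by
    rw [div_le_one (by positivity)]
    linarith [n.cast_nonneg (α := ℝ)]
  choose z hz s t hst htr hsy hbad using fun n : ℕ => H (1 / (n + 1)) (hr n)
  choose A hA hAz using fun n => hincr (z n) (hz n) (s n) (t n) (hst n).le
    ((htr n).trans (by linarith [hr1 n]))
  choose m hm hm1 using fun n => exists_support p (h.norm_eq (z n) (hz n) (s n))
  choose m' hm' hm1' using fun n => exists_support p (h.norm_eq (z n) (hz n) (t n))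
  obtain ⟨⟨A₀, m₀, m₀'⟩, ⟨hA₀, hm₀, hm₀'⟩, φ, hφ, hlim⟩ :=
    (hK.prod ((isCompact_le_seminorm hp2).prod (isCompact_le_seminorm hp2))).tendsto_subseq
      (x := fun n => (A n, m n, m' n)) (fun n => ⟨hA n, hm n, hm' n⟩)
  have hrlim : Tendsto (fun n => 1 / ((φ n : ℝ) + 1)) atTop (𝓝 0) :=
    tendsto_one_div_add_atTop_nhds_zero_nat.comp hφ.tendsto_atTop
  have hAlim : Tendsto (fun n => A (φ n)) atTop (𝓝 A₀) := (continuous_fst.tendsto _).comp hlim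
  have hmlim : Tendsto (fun n => m (φ n)) atTop (𝓝 m₀) :=
    ((continuous_fst.comp continuous_snd).tendsto _).comp hlim
  have hmlim' : Tendsto (fun n => m' (φ n)) atTop (𝓝 m₀') :=
    ((continuous_snd.comp continuous_snd).tendsto _).comp hlim
  have hslim : Tendsto (fun n => z (φ n) (s (φ n))) atTop (𝓝 y) := by
    rw [tendsto_iff_norm_sub_tendsto_zero]
    exact squeeze_zero (fun n => norm_nonneg _) (fun n => (hsy (φ n)).le) hrlim
  have hdlim : Tendsto (fun n => z (φ n) (t (φ n)) - z (φ n) (s (φ n))) atTop (𝓝 0) := by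
    rw [tendsto_zero_iff_norm_tendsto_zero]
    refine squeeze_zero (fun n => norm_nonneg _) (fun n => ?_) (by simpa only [mul_zero] using hrlim.const_mul Λ)
    have h1 : |t (φ n) - s (φ n)| ≤ 1 / ((φ n : ℝ) + 1) := by
      rw [abs_of_pos (by linarith [hst (φ n)])]
      linarith [htr (φ n)]
    exact (hL _ (hz _) _ _ (h1.trans (hr1 _))).trans (mul_le_mul_of_nonneg_left h1 hΛ.le)
  have htlim : Tendsto (fun n => z (φ n) (t (φ n))) atTop (𝓝 y) := by
    simpa using hdlim.add hslim
  have hml : m₀ = l := by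
    have : m₀ ∈ supportSet p y := by
      refine ⟨hm₀, tendsto_nhds_unique (tendsto_clm_apply hmlim hslim) ?_⟩
      simp only [hm1]
      exact tendsto_const_nhds
    rwa [hl] at this
  have hml' : m₀' = l := by
    have : m₀' ∈ supportSet p y := by
      refine ⟨hm₀', tendsto_nhds_unique (tendsto_clm_apply hmlim' htlim) ?_⟩
      simp only [hm1']
      exact tendsto_const_nhds
    rwa [hl] at this
  subst hml
  set D : ℕ → E := fun n => (t n - s n)⁻¹ • (z n (t n) - z n (s n)) with hD
  have hpos : ∀ n, 0 < t n - s n := fun n => sub_pos.mpr (hst n)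
  have hDlim : Tendsto (fun n => D (φ n)) atTop (𝓝 (A₀ y)) := by
    have h1 : Tendsto (fun n => D (φ n) - A (φ n) (z (φ n) (s (φ n)))) atTop (𝓝 0) := by
      rw [tendsto_zero_iff_norm_tendsto_zero]
      refine squeeze_zero (fun n => norm_nonneg _) (fun n => ?_) (by simpa only [mul_zero] using hrlim.const_mul c)
      set k := φ n
      have h2 : D k - A k (z k (s k)) =
          (t k - s k)⁻¹ • (z k (t k) - z k (s k) - (t k - s k) • A k (z k (s k))) := by
        rw [smul_sub (t k - s k)⁻¹ (z k (t k) - z k (s k)), inv_smul_smul₀ (hpos k).ne']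
      rw [h2, norm_smul, norm_inv, Real.norm_of_nonneg (hpos k).le, inv_mul_le_iff₀ (hpos k)]
      refine (hAz k).trans ?_
      have h3 : t k - s k ≤ 1 / ((k : ℝ) + 1) := by linarith [htr k]
      have h4 := mul_le_mul_of_nonneg_left h3 (mul_nonneg hc (hpos k).le)
      linarith
    simpa using h1.add (tendsto_clm_apply hAlim hslim)
  have hl0 : m₀ (A₀ y) = 0 := by
    refine le_antisymm ?_ ?_
    · refine le_of_tendsto (tendsto_clm_apply hmlim hDlim) (Eventually.of_forall fun n => ?_)
      rw [hD]
      simp only [map_smul, map_sub, smul_eq_mul, hm1]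
      refine mul_nonpos_of_nonneg_of_nonpos (inv_nonneg.mpr (hpos _).le) ?_
      linarith [hm (φ n) (z (φ n) (t (φ n))), h.norm_eq _ (hz (φ n)) (t (φ n))]
    · rw [← hml']
      refine ge_of_tendsto (tendsto_clm_apply hmlim' hDlim) (Eventually.of_forall fun n => ?_)
      rw [hD]
      simp only [map_smul, map_sub, smul_eq_mul, hm1']
      refine mul_nonneg (inv_nonneg.mpr (hpos _).le) ?_
      linarith [hm' (φ n) (z (φ n) (s (φ n))), h.norm_eq _ (hz (φ n)) (s (φ n))]
  obtain ⟨n, hn⟩ := ((tendsto_iff_norm_sub_tendsto_zero.mp hDlim).eventually_lt_const hε).exists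
  refine (hbad (φ n) A₀ hA₀ hl0).not_ge ?_
  set k := φ n
  have h2 : z k (t k) - z k (s k) - (t k - s k) • A₀ y = (t k - s k) • (D k - A₀ y) := by
    rw [smul_sub, hD, smul_inv_smul₀ (hpos k).ne']
  rw [h2, norm_smul, Real.norm_of_nonneg (hpos k).le, mul_comm]
  exact mul_le_mul_of_nonneg_right hn.le (hpos k).le

end IsExtremalFamily

/-- If no generator is singular, some functional vanishing at `y` is bounded below on the
velocities at `y` that are tangent to the kernel of `l`. -/
theorem exists_separating_functional {E : Type*} [NormedAddCommGroup E] [NormedSpace ℝ E]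
    {K : Set (E →L[ℝ] E)} (hK : IsCompact K) (hKc : Convex ℝ K) {y : E}
    (hne : ∀ A ∈ K, A y ≠ 0) {l : E →L[ℝ] ℝ} (hly : l y ≠ 0) :
    ∃ f : E →L[ℝ] ℝ, f y = 0 ∧ ∃ c > 0, ∀ A ∈ K, l (A y) = 0 → c ≤ f (A y) := by
  set F : Set E := (fun A : E →L[ℝ] E => A y) '' (K ∩ {A | l (A y) = 0}) with hF
  have hFc : IsCompact F := (hK.inter_right
    (isClosed_eq (by fun_prop) continuous_const)).image (by fun_prop)
  have hFconv : Convex ℝ F := by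
    rintro _ ⟨A, ⟨hA, hA'⟩, rfl⟩ _ ⟨B, ⟨hB, hB'⟩, rfl⟩ a b ha hb hab
    refine ⟨a • A + b • B, ⟨hKc hA hB ha hb hab, ?_⟩, by simp⟩
    rw [Set.mem_ofPred_eq] at hA' hB' ⊢
    simp [hA', hB']
  have hdisj : Disjoint F (Submodule.span ℝ {y} : Set E) := by
    rw [Set.disjoint_left]
    rintro _ ⟨A, ⟨hA, hA'⟩, rfl⟩ h
    obtain ⟨a, ha⟩ := Submodule.mem_span_singleton.mp h
    have ha : a • y = A y := ha
    rw [Set.mem_ofPred_eq, ← ha, map_smul, smul_eq_mul, mul_eq_zero, or_iff_left hly] at hA'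
    rw [hA', zero_smul] at ha
    exact hne A hA ha.symm
  obtain ⟨f, u, v, hfu, huv, hv⟩ := geometric_hahn_banach_compact_closed hFconv hFc
    (Submodule.span ℝ {y}).convex (Submodule.closed_of_finiteDimensional _) hdisj
  have hv0 : v < 0 := by simpa using hv 0 (Submodule.zero_mem _)
  have hfy : f y = 0 := by
    by_contra h
    have := hv ((v / f y) • y) (Submodule.smul_mem _ _ (Submodule.mem_span_singleton_self y))
    rw [map_smul, smul_eq_mul, div_mul_cancel₀ _ h] at this
    exact this.false
  refine ⟨-f, by simp [hfy], -u, by linarith, fun A hA hlA => ?_⟩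
  have := hfu (A y) ⟨A, ⟨hA, hlA⟩, rfl⟩
  rw [neg_apply]
  linarith

namespace IsExtremalFamily

variable {E : Type*} [NormedAddCommGroup E] [NormedSpace ℝ E]
  {p : Seminorm ℝ E} {K : Set (E →L[ℝ] E)} {Z : Set (ℝ → E)}

/-- A recurrent curve which crosses a hyperplane only in one direction near a smooth point returns
to the hyperplane arbitrarily close to that point. -/
theorem exists_return {z : ℝ → E} {Λ : ℝ} (hΛ : 0 < Λ)
    (hL : ∀ s t, |t - s| ≤ 1 → ‖z t - z s‖ ≤ Λ * |t - s|) {f : E →L[ℝ] ℝ} (hf : f (z 0) = 0)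
    {c r : ℝ} (hc : 0 < c) (hr : 0 < r) (hz : Continuous z)
    (hmono : ∀ s t, s < t → t ≤ s + r → ‖z s - z 0‖ < r → c * (t - s) ≤ f (z t) - f (z s))
    (hrec : ∀ ε > 0, ∀ N, ∃ t > N, ‖z t - z 0‖ < ε) {δ : ℝ} (hδ : 0 < δ) :
    ∃ t > 0, f (z t) = 0 ∧ ‖z t - z 0‖ < δ := by
  set h := min (min (r / 2) (1 / 2)) (min r δ / (4 * Λ)) with hh
  have hh0 : 0 < h := by positivity
  have hhr : h ≤ r / 2 := (min_le_left _ _).trans (min_le_left _ _)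
  have hh1 : h ≤ 1 / 2 := (min_le_left _ _).trans (min_le_right _ _)
  have hhΛ : Λ * h ≤ min r δ / 4 := by
    have := min_le_right (min (r / 2) (1 / 2)) (min r δ / (4 * Λ))
    rw [← hh, le_div_iff₀ (by positivity)] at this
    linarith
  obtain ⟨T, hT, hTz⟩ := hrec (min (min r δ / 4) (c * h / (‖f‖ + 1))) (by positivity) 1
  rw [lt_min_iff, lt_div_iff₀ (show 0 < ‖f‖ + 1 by positivity)] at hTz
  have hrδ : 0 < min r δ := lt_min hr hδ
  have hclose : ∀ t, |t - T| ≤ h → ‖z t - z 0‖ < min r δ := by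
    intro t ht
    have h1 := hL T t (by linarith)
    have h2 := norm_add_le (z t - z T) (z T - z 0)
    rw [sub_add_sub_cancel] at h2
    have h3 := mul_le_mul_of_nonneg_left ht hΛ.le
    linarith [hTz.1]
  have hfT : |f (z T)| ≤ c * h := by
    have h1 := f.le_opNorm (z T - z 0)
    rw [map_sub, hf, sub_zero, Real.norm_eq_abs] at h1
    nlinarith [norm_nonneg (z T - z 0), hTz.2]
  have hcont : Continuous fun t => f (z t) := f.continuous.comp hz
  rw [abs_le] at hfT
  obtain ⟨t, ht, ht0⟩ : ∃ t, |t - T| ≤ h ∧ f (z t) = 0 := by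
    rcases le_total (f (z T)) 0 with h0 | h0
    · have h1 := hmono T (T + h) (by linarith) (by linarith)
        ((hclose T (by simpa using hh0.le)).trans_le (min_le_left _ _))
      rw [add_sub_cancel_left] at h1
      obtain ⟨t, ht, ht0⟩ := intermediate_value_Icc (show T ≤ T + h by linarith)
        hcont.continuousOn (show (0 : ℝ) ∈ Set.Icc _ _ from ⟨h0, by linarith⟩)
      exact ⟨t, abs_le.mpr ⟨by linarith [ht.1], by linarith [ht.2]⟩, ht0⟩
    · have h1 := hmono (T - h) T (by linarith) (by linarith)
        ((hclose (T - h) (by simp [abs_of_pos hh0])).trans_le (min_le_left _ _))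
      rw [sub_sub_cancel] at h1
      obtain ⟨t, ht, ht0⟩ := intermediate_value_Icc (show T - h ≤ T by linarith)
        hcont.continuousOn (show (0 : ℝ) ∈ Set.Icc _ _ from ⟨by linarith, h0⟩)
      exact ⟨t, abs_le.mpr ⟨by linarith [ht.1], by linarith [ht.2]⟩, ht0⟩
  exact ⟨t, by linarith [(abs_le.mp ht).1], ht0, (hclose t ht).trans_le (min_le_right _ _)⟩

variable [FiniteDimensional ℝ E]

/-- In dimension at most three there is no extremal family, by a Poincaré–Bendixson argument on
the unit sphere. -/
theorem false_of_finrank_le_three (h : IsExtremalFamily p K Z) (hd : Module.finrank ℝ E ≤ 3)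
    {C : ℝ} (hp1 : ∀ x, ‖x‖ ≤ p x) (hp2 : ∀ x, p x ≤ C * ‖x‖) (hK : IsCompact K)
    (hKc : Convex ℝ K) (hne : ∀ A ∈ K, ∀ y, y ≠ 0 → A y ≠ 0) : False := by
  obtain ⟨M, hMZ, hMne, hM, hMs, hMr⟩ := exists_recurrent_family h.isCompact h.nonempty h.shift
  obtain ⟨z, hzM, l, hl⟩ := exists_smooth_point hd hp2 hMne hM
    (fun z hz => h.continuous hp1 hK (hMZ hz)) (fun z hz => h.norm_eq z (hMZ hz))
    (fun z hz => h.ne z (hMZ hz)) hMs hMr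
  have hz := hMZ hzM
  have hrec := hMr z hzM
  have hcont := h.continuous hp1 hK hz
  have hp := h.norm_eq z hz
  set y := z 0 with hy
  have hly : l y = 1 := (hl.symm ▸ Set.mem_singleton l : l ∈ supportSet p y).2
  have hy0 : y ≠ 0 := by
    intro h0
    rw [h0, map_zero] at hly
    exact zero_ne_one hly
  obtain ⟨Λ, hΛ, hL⟩ := h.exists_norm_sub_le hp1 hK
  obtain ⟨f, hfy, c, hc, hfc⟩ := exists_separating_functional hK hKc (fun A hA => hne A hA y hy0)
    (hly.symm ▸ one_ne_zero : l y ≠ 0)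
  obtain ⟨r, hr, htan⟩ := h.exists_tangent_incr hp1 hp2 hK hl
    (ε := c / 2 / (‖f‖ + 1)) (by positivity)
  have hmono : ∀ s t, s < t → t ≤ s + r → ‖z s - y‖ < r → c / 2 * (t - s) ≤ f (z t) - f (z s) := by
    intro s t hst htr hs
    obtain ⟨A, hA, hlA, hAz⟩ := htan z hz s t hst htr hs
    have h1 := hfc A hA hlA
    have h2 := f.le_opNorm (z t - z s - (t - s) • A y)
    rw [map_sub, map_sub, map_smul, smul_eq_mul, Real.norm_eq_abs] at h2
    have h3 : ‖f‖ * ‖z t - z s - (t - s) • A y‖ ≤ c / 2 * (t - s) := by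
      have h4 : c / 2 / (‖f‖ + 1) * (‖f‖ + 1) = c / 2 := div_mul_cancel₀ _ (by positivity)
      nlinarith [norm_nonneg f, norm_nonneg (z t - z s - (t - s) • A y)]
    have h4 := mul_le_mul_of_nonneg_left h1 (sub_pos.mpr hst).le
    linarith [(abs_le.mp h2).1]
  obtain ⟨A, hA, hlA, -⟩ := htan z hz 0 r hr (by linarith) (by simpa [hy] using hr)
  have hfA := hfc A hA hlA
  obtain ⟨g₀, hg₀⟩ := exists_complementary hd (a := l) (b := f) (u := y) (v := A y)
    (hly.symm ▸ one_ne_zero) hlA (by linarith)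
  set g : E →L[ℝ] ℝ := g₀ - g₀ y • l with hg
  have hgy : g y = 0 := by simp [hg, hly]
  have hinj : ∀ e, l e = 0 → f e = 0 → g e = 0 → e = 0 := fun e h1 h2 h3 =>
    hg₀ e h1 h2 (by simpa [hg, h1] using h3)
  have hden : ∀ t, 0 < stereoDenom l f g (z t) := fun t => by
    refine stereoDenom_pos hinj hly hfy hgy (hp 0) (hp t) fun ht => ?_
    rcases lt_trichotomy t 0 with h0 | h0 | h0
    · exact h.ne_neg z hz t 0 h0 (by rw [ht, neg_neg])
    · have ht : y = -y := by rwa [h0, ← hy] at ht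
      have h2 : (2 : ℝ) • y = 0 := by
        rw [two_smul]
        nth_rewrite 1 [ht]
        exact neg_add_cancel y
      exact hy0 ((smul_eq_zero.mp h2).resolve_left two_ne_zero)
    · exact h.ne_neg z hz 0 t h0 ht
  obtain ⟨B, hB, hBz⟩ := exists_norm_sub_le_of_stereo hp1 hp2 hinj hly hfy hgy (hp 0)
  have hΓ := fun t => continuousAt_stereo (hden t)
  have hre : ∀ t, (stereo l f g (z t)).re = f (z t) / stereoDenom l f g (z t) := fun t => rfl
  have hrecΓ : ∀ s, ∀ ε > 0, ∃ δ > 0, ∀ t, ‖z t - z s‖ < δ →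
      ‖stereo l f g (z t) - stereo l f g (z s)‖ < ε := by
    intro s ε hε
    obtain ⟨δ, hδ, hδ'⟩ := Metric.continuousAt_iff.mp (hΓ s) ε hε
    refine ⟨δ, hδ, fun t ht => ?_⟩
    have := hδ' (x := z t) (by rwa [dist_eq_norm])
    rwa [dist_eq_norm] at this
  have hΓ0 : stereo l f g (z 0) = 0 := by
    apply Complex.ext <;> simp [stereo, ← hy, hfy, hgy]
  refine no_recurrent_crossing (γ := fun t => stereo l f g (z t)) (r := min 1 (r / B))
    (continuous_iff_continuousAt.mpr fun t => (hΓ t).comp hcont.continuousAt) ?_ hΓ0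
    (by positivity) ?_ ?_ ?_
  · intro s t hst
    have hzz := stereo_injective hinj (hden s) (hden t) (hp s) (hp t) hst
    rcases lt_trichotomy s t with h0 | h0 | h0
    · exact absurd hzz.symm (h.ne z hz s t h0)
    · exact h0
    · exact absurd hzz (h.ne z hz t s h0)
  · intro t ht ht0
    rw [lt_min_iff, lt_div_iff₀ hB] at ht
    have hclose : ‖z t - y‖ < r := (hBz _ (hp t) (hden t) ht.1).trans_lt (by linarith [ht.2])
    have hft : f (z t) = 0 := by
      rcases div_eq_zero_iff.mp ht0 with h0 | h0
      · exact h0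
      · exact absurd h0 (hden t).ne'
    constructor
    · have h1 : ∀ᶠ s in 𝓝[<] t, ‖z s - y‖ < r := nhdsWithin_le_nhds <|
        ((hcont.sub continuous_const).norm.continuousAt (x := t)).eventually_lt_const hclose
      have h2 : ∀ᶠ s in 𝓝[<] t, t - r < s := nhdsWithin_le_nhds (lt_mem_nhds (by linarith))
      filter_upwards [h1, h2, self_mem_nhdsWithin] with s hs1 hs2 hs3
      rw [Set.mem_Iio] at hs3
      have h3 := hmono s t hs3 (by linarith) hs1
      rw [hre]
      refine div_neg_of_neg_of_pos ?_ (hden s)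
      have := mul_pos (half_pos hc) (sub_pos.mpr hs3)
      linarith
    · have h2 : ∀ᶠ s in 𝓝[>] t, s < t + r := nhdsWithin_le_nhds (gt_mem_nhds (by linarith))
      filter_upwards [h2, self_mem_nhdsWithin] with s hs2 hs3
      rw [Set.mem_Ioi] at hs3
      have h3 := hmono t s hs3 hs2.le hclose
      rw [hre]
      refine div_pos ?_ (hden s)
      have := mul_pos (half_pos hc) (sub_pos.mpr hs3)
      linarith
  · intro ε hε
    obtain ⟨δ, hδ, hδ'⟩ := hrecΓ 0 ε hε
    obtain ⟨t, ht, hft, htz⟩ := exists_return hΛ (hL z hz) hfy (half_pos hc) hr hcont hmono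
      (hrec 0) hδ
    refine ⟨t, ht, by rw [hre, hft, zero_div], ?_⟩
    have := hδ' t htz
    rwa [hΓ0, sub_zero] at this
  · intro s ε hε N
    obtain ⟨δ, hδ, hδ'⟩ := hrecΓ s ε hε
    obtain ⟨t, ht, htz⟩ := hrec s δ hδ N
    exact ⟨t, ht, hδ' t htz⟩

end IsExtremalFamily

/-- In dimension at most three, a power stable evolution is uniformly exponentially stable. -/
theorem IsEvolution.exists_neg_expBound {E : Type*} [NormedAddCommGroup E] [NormedSpace ℝ E]
    [FiniteDimensional ℝ E] {S : ℝ → Set (E →L[ℝ] E)} {K : Set (E →L[ℝ] E)}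
    (hd : Module.finrank ℝ E ≤ 3) (h : IsEvolution S K) (hS : PowerStable S) :
    ∃ a < 0, ExpBound S a := by
  refine exists_neg_expBound_of_critical ?_ _ E S K rfl hd h hS
  intro E _ _ _ S K hd h hS hirr hpos hneg
  obtain ⟨C, hC⟩ := h.exists_bound hirr hpos
  obtain ⟨p, hp1, hp2, hp3⟩ := h.exists_extremal_seminorm hC
  obtain ⟨Z, hZ⟩ := h.exists_extremalFamily hS hneg hp1 hp2 hp3
  exact hZ.false_of_finrank_le_three hd hp1 hp2 h.isCompact_gen h.convex_gen
    fun A hA y hy => h.gen_apply_ne_zero hS hA hy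

section Laws

/-- A switching law normalized to take values in the simplex everywhere. -/
structure IsLaw {N : ℕ} (w : ℝ → Fin N → ℝ) : Prop where
  measurable : ∀ i, Measurable fun s => w s i
  mem : ∀ s, w s ∈ stdSimplex ℝ (Fin N)

variable {V : Type*} [NormedAddCommGroup V] [NormedSpace ℝ V] {N : ℕ}

/-- The linear combination of the generators with coefficients `c`. -/
def mix (L : Fin N → V →L[ℝ] V) (c : Fin N → ℝ) : V →L[ℝ] V := ∑ i, c i • L i

/-- A bound for the generators. -/
noncomputable def mixBound (L : Fin N → V →L[ℝ] V) : ℝ := ∑ i, ‖L i‖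

variable (L : Fin N → V →L[ℝ] V)

theorem mixBound_nonneg : 0 ≤ mixBound L := Finset.sum_nonneg fun _ _ => norm_nonneg _

theorem mix_apply (c : Fin N → ℝ) (v : V) : mix L c v = ∑ i, c i • L i v := by
  simp [mix, sum_apply]

theorem mix_add (c c' : Fin N → ℝ) : mix L (c + c') = mix L c + mix L c' := by
  simp [mix, add_smul, Finset.sum_add_distrib]

theorem mix_smul (a : ℝ) (c : Fin N → ℝ) : mix L (a • c) = a • mix L c := by
  simp [mix, mul_smul, Finset.smul_sum]

theorem continuous_mix : Continuous (mix L) := by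
  unfold mix
  fun_prop

variable {L}

theorem norm_mix_le {c : Fin N → ℝ} (hc : c ∈ stdSimplex ℝ (Fin N)) : ‖mix L c‖ ≤ mixBound L := by
  refine (norm_sum_le _ _).trans (Finset.sum_le_sum fun i _ => ?_)
  rw [norm_smul, Real.norm_of_nonneg (hc.1 i)]
  refine mul_le_of_le_one_left (norm_nonneg _) ?_
  rw [← hc.2]
  exact Finset.single_le_sum (fun j _ => hc.1 j) (Finset.mem_univ i)

theorem norm_mix_apply_le {c : Fin N → ℝ} (hc : c ∈ stdSimplex ℝ (Fin N)) (v : V) :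
    ‖mix L c v‖ ≤ mixBound L * ‖v‖ :=
  (mix L c).le_of_opNorm_le (norm_mix_le hc) v

namespace IsLaw

variable {w : ℝ → Fin N → ℝ}

theorem abs_le_one (hw : IsLaw w) (s : ℝ) (i : Fin N) : |w s i| ≤ 1 := by
  rw [abs_of_nonneg ((hw.mem s).1 i), ← (hw.mem s).2]
  exact Finset.single_le_sum (fun j _ => (hw.mem s).1 j) (Finset.mem_univ i)

theorem intervalIntegrable_coord (hw : IsLaw w) (i : Fin N) (a b : ℝ) :
    IntervalIntegrable (fun s => w s i) volume a b := by
  refine (intervalIntegrable_const (c := (1 : ℝ))).mono_fun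
    (hw.measurable i).aestronglyMeasurable (ae_of_all _ fun s => ?_)
  simpa using hw.abs_le_one s i

theorem intervalIntegrable (hw : IsLaw w) {x : ℝ → V} (hx : Continuous x) (a b : ℝ) :
    IntervalIntegrable (fun s => mix L (w s) (x s)) volume a b := by
  simp only [mix_apply]
  have := IntervalIntegrable.sum Finset.univ fun i _ =>
    (hw.intervalIntegrable_coord i a b).smul_continuousOn
      ((L i).continuous.comp hx).continuousOn
  simp only [Finset.sum_fn] at this
  exact this

theorem comp_add (hw : IsLaw w) (r : ℝ) : IsLaw fun s => w (r + s) :=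
  ⟨fun i => (hw.measurable i).comp (measurable_const_add r), fun _ => hw.mem _⟩

theorem integral_mix [CompleteSpace V] (hw : IsLaw w) (v : V) (a b : ℝ) :
    ∫ s in a..b, mix L (w s) v = mix L (fun i => ∫ s in a..b, w s i) v := by
  simp only [mix_apply]
  rw [intervalIntegral.integral_finsetSum fun i _ =>
    (hw.intervalIntegrable_coord i a b).smul_continuousOn continuousOn_const]
  exact Finset.sum_congr rfl fun i _ => intervalIntegral.integral_smul_const _ _

end IsLaw

/-- `x` solves the switched equation on `[0, T]`. -/
def IsSol (L : Fin N → V →L[ℝ] V) (w : ℝ → Fin N → ℝ) (T : ℝ) (x : ℝ → V) : Prop :=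
  Continuous x ∧ ∀ t ∈ Set.Icc 0 T, x t = x 0 + ∫ s in 0..t, mix L (w s) (x s)

namespace IsSol

variable {w : ℝ → Fin N → ℝ} {T : ℝ} {x y : ℝ → V}

theorem shift (hw : IsLaw w) (h : IsSol L w T x) {s : ℝ} (hs : s ∈ Set.Icc 0 T) :
    IsSol L (fun r => w (s + r)) (T - s) fun r => x (s + r) := by
  refine ⟨h.1.comp (continuous_const_add s), fun t ht => ?_⟩
  beta_reduce
  rw [intervalIntegral.integral_comp_add_left (fun r => mix L (w r) (x r)), add_zero,
    h.2 s hs, h.2 (s + t) ⟨add_nonneg hs.1 ht.1, by linarith [ht.2]⟩, add_assoc,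
    intervalIntegral.integral_add_adjacent_intervals (hw.intervalIntegrable h.1 _ _)
      (hw.intervalIntegrable h.1 _ _)]

theorem sub (hw : IsLaw w) (hx : IsSol L w T x) (hy : IsSol L w T y) :
    IsSol L w T fun t => x t - y t := by
  refine ⟨hx.1.sub hy.1, fun t ht => ?_⟩
  simp only [map_sub]
  rw [intervalIntegral.integral_sub (hw.intervalIntegrable hx.1 _ _)
    (hw.intervalIntegrable hy.1 _ _), hx.2 t ht, hy.2 t ht]
  abel

theorem norm_le (hw : IsLaw w) (h : IsSol L w T x) {t : ℝ} (ht : t ∈ Set.Icc 0 T) :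
    ‖x t‖ ≤ ‖x 0‖ * Real.exp (mixBound L * t) := by
  set M := mixBound L
  have hM : 0 ≤ M := mixBound_nonneg L
  have hxi : ∀ a b, IntervalIntegrable (fun s => ‖x s‖) volume a b :=
    fun a b => h.1.norm.intervalIntegrable a b
  set u : ℝ → ℝ := fun t => ‖x 0‖ + M * ∫ s in 0..t, ‖x s‖ with hu
  have hderiv : ∀ t, HasDerivAt u (M * ‖x t‖) t := fun t =>
    ((intervalIntegral.integral_hasDerivAt_right (hxi 0 t)
      h.1.norm.stronglyMeasurable.stronglyMeasurableAtFilter h.1.norm.continuousAt).const_mul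
        M).const_add _
  have hxu : ∀ t ∈ Set.Icc 0 T, ‖x t‖ ≤ u t := by
    intro t ht
    rw [h.2 t ht]
    refine (norm_add_le _ _).trans ?_
    rw [hu]
    simp only [add_le_add_iff_left, ← intervalIntegral.integral_const_mul]
    exact intervalIntegral.norm_integral_le_of_norm_le ht.1
      (ae_of_all _ fun s _ => norm_mix_apply_le (hw.mem s) _) ((hxi _ _).const_mul M)
  have hu0 : ∀ t, 0 ≤ t → 0 ≤ u t := fun t ht => by
    have := intervalIntegral.integral_nonneg (μ := volume) ht fun s _ => norm_nonneg (x s)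
    positivity
  have := norm_le_gronwallBound_of_norm_deriv_right_le (f := u) (f' := fun t => M * ‖x t‖)
    (δ := ‖x 0‖) (K := M) (ε := 0) (a := 0) (b := T)
    (fun t _ => (hderiv t).continuousAt.continuousWithinAt)
    (fun t _ => (hderiv t).hasDerivWithinAt) (by simp [hu]) (fun t ht => by
      rw [Real.norm_of_nonneg (by positivity), Real.norm_of_nonneg (hu0 t ht.1), add_zero]
      exact mul_le_mul_of_nonneg_left (hxu t ⟨ht.1, ht.2.le⟩) hM) t ht
  rw [gronwallBound_ε0, sub_zero, Real.norm_of_nonneg (hu0 t ht.1)] at this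
  exact (hxu t ht).trans this

theorem eq_of_eq_zero (hw : IsLaw w) (hx : IsSol L w T x) (hy : IsSol L w T y) (h0 : x 0 = y 0)
    {t : ℝ} (ht : t ∈ Set.Icc 0 T) : x t = y t := by
  have := (hx.sub hw hy).norm_le hw ht
  rw [h0, sub_self, norm_zero, zero_mul] at this
  exact sub_eq_zero.mp (norm_le_zero_iff.mp this)

theorem norm_sub_le (hw : IsLaw w) (h : IsSol L w T x) {t : ℝ} (ht : t ∈ Set.Icc 0 T) :
    ‖x t - x 0‖ ≤ (Real.exp (mixBound L * t) - 1) * ‖x 0‖ := by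
  set M := mixBound L
  have hM : 0 ≤ M := mixBound_nonneg L
  rw [h.2 t ht, add_sub_cancel_left]
  have hInt : IntervalIntegrable (fun s => M * (‖x 0‖ * Real.exp (M * s))) volume 0 t :=
    Continuous.intervalIntegrable (by fun_prop) _ _
  refine (intervalIntegral.norm_integral_le_of_norm_le ht.1 (ae_of_all _ fun s hs =>
    (norm_mix_apply_le (hw.mem s) _).trans (mul_le_mul_of_nonneg_left (h.norm_le hw
      ⟨hs.1.le, hs.2.trans ht.2⟩) hM)) hInt).trans_eq ?_
  rw [intervalIntegral.integral_eq_sub_of_hasDerivAt (f := fun s => ‖x 0‖ * Real.exp (M * s))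
    (fun s _ => ?_) hInt]
  · simp only [mul_zero, Real.exp_zero]; ring
  · have h2 : HasDerivAt (fun s => ‖x 0‖ * Real.exp (M * s))
        (‖x 0‖ * (Real.exp (M * s) * (M * 1))) s :=
      ((hasDerivAt_id s).const_mul M).exp.const_mul ‖x 0‖
    exact h2.congr_deriv (by ring)

theorem norm_sub_sub_le [CompleteSpace V] (hw : IsLaw w) (h : IsSol L w T x) {t : ℝ}
    (ht : t ∈ Set.Icc 0 T) : ‖x t - x 0 - mix L (fun i => ∫ s in 0..t, w s i) (x 0)‖ ≤
      (Real.exp (mixBound L * t) - 1 - mixBound L * t) * ‖x 0‖ := by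
  set M := mixBound L
  have hM : 0 ≤ M := mixBound_nonneg L
  rw [h.2 t ht, add_sub_cancel_left, ← hw.integral_mix,
    ← intervalIntegral.integral_sub (hw.intervalIntegrable h.1 _ _)
    (hw.intervalIntegrable continuous_const _ _)]
  have hInt : IntervalIntegrable (fun s => M * ((Real.exp (M * s) - 1) * ‖x 0‖)) volume 0 t :=
    Continuous.intervalIntegrable (by fun_prop) _ _
  refine (intervalIntegral.norm_integral_le_of_norm_le ht.1 (ae_of_all _ fun s hs => ?_)
    hInt).trans_eq ?_
  · rw [← map_sub]
    exact (norm_mix_apply_le (hw.mem s) _).trans (mul_le_mul_of_nonneg_left (h.norm_sub_le hw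
      ⟨hs.1.le, hs.2.trans ht.2⟩) hM)
  rw [intervalIntegral.integral_eq_sub_of_hasDerivAt
    (f := fun s => (Real.exp (M * s) - M * s) * ‖x 0‖) (fun s _ => ?_) hInt]
  · simp only [mul_zero, Real.exp_zero]; ring
  · have h2 : HasDerivAt (fun s => (Real.exp (M * s) - M * s) * ‖x 0‖)
        ((Real.exp (M * s) * (M * 1) - M * 1) * ‖x 0‖) s :=
      (((hasDerivAt_id s).const_mul M).exp.sub ((hasDerivAt_id s).const_mul M)).mul_const ‖x 0‖
    exact h2.congr_deriv (by ring)

end IsSol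

end Laws

section Existence

variable {V : Type*} [NormedAddCommGroup V] [NormedSpace ℝ V] {N : ℕ}

/-- The terms of the Picard series of the switched equation. -/
noncomputable def picardTerm (L : Fin N → V →L[ℝ] V) (w : ℝ → Fin N → ℝ) (v : V) : ℕ → ℝ → V
  | 0 => fun _ => v
  | n + 1 => fun t => ∫ s in 0..max t 0, mix L (w s) (picardTerm L w v n s)

variable {L : Fin N → V →L[ℝ] V} {w : ℝ → Fin N → ℝ}

namespace IsLaw

theorem continuous_picardTerm (hw : IsLaw w) (v : V) (n : ℕ) :
    Continuous (picardTerm L w v n) := by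
  induction n with
  | zero => exact continuous_const
  | succ n ih =>
    exact (intervalIntegral.continuous_primitive (hw.intervalIntegrable ih) 0).comp
      (continuous_id.max continuous_const)

theorem norm_picardTerm_le (hw : IsLaw w) (v : V) (n : ℕ) (t : ℝ) :
    ‖picardTerm L w v n t‖ ≤ (mixBound L * max t 0) ^ n / n.factorial * ‖v‖ := by
  have hM := mixBound_nonneg L
  induction n generalizing t with
  | zero => simp [picardTerm]
  | succ n ih =>
    have hInt : IntervalIntegrable (fun s => mixBound L * ((mixBound L * s) ^ n / n.factorial * ‖v‖))
      volume 0 (max t 0) := Continuous.intervalIntegrable (by fun_prop) _ _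
    refine (intervalIntegral.norm_integral_le_of_norm_le (le_max_right t 0)
      (ae_of_all _ fun s hs => (norm_mix_apply_le (hw.mem s) _).trans
        (mul_le_mul_of_nonneg_left ((ih s).trans_eq (by rw [max_eq_left hs.1.le])) hM))
      hInt).trans_eq ?_
    have : ∀ s : ℝ, mixBound L * ((mixBound L * s) ^ n / n.factorial * ‖v‖) =
        (mixBound L ^ (n + 1) / n.factorial * ‖v‖) * s ^ n := fun s => by
      rw [mul_pow, pow_succ]; ring
    simp only [this]
    rw [intervalIntegral.integral_const_mul, integral_pow, Nat.factorial_succ, mul_pow]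
    push_cast
    field_simp
    simp

theorem exists_isSol [CompleteSpace V] (hw : IsLaw w) (v : V) :
    ∃ x : ℝ → V, x 0 = v ∧ ∀ T, IsSol L w T x := by
  set a := picardTerm L w v
  set M := mixBound L
  have hM : 0 ≤ M := mixBound_nonneg L
  have hsum : ∀ R : ℝ, Summable fun n : ℕ => (M * R) ^ n / n.factorial * ‖v‖ := fun R =>
    (Real.summable_pow_div_factorial _).mul_right _
  have hle : ∀ (R : ℝ) n t, t ≤ R → ‖a n t‖ ≤ (M * max R 0) ^ n / n.factorial * ‖v‖ :=
    fun R n t ht => (hw.norm_picardTerm_le v n t).trans (by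
      have : max t 0 ≤ max R 0 := max_le_max_right 0 ht
      have h0 : 0 ≤ max t 0 := le_max_right _ _
      gcongr)
  have hsa : ∀ t, Summable fun n => a n t := fun t =>
    Summable.of_norm_bounded (hsum (max t 0)) fun n => hle t n t le_rfl
  have hcont : Continuous fun t => ∑' n, a n t := by
    refine continuous_iff_continuousAt.2 fun t => ?_
    exact (continuousOn_tsum (fun n => (hw.continuous_picardTerm v n).continuousOn)
      (hsum (max (t + 1) 0)) fun n s (hs : s ∈ Set.Iio (t + 1)) =>
        hle (t + 1) n s (le_of_lt hs)).continuousAt (Iio_mem_nhds (lt_add_one t))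
  have heq : ∀ t, 0 ≤ t → ∑' n, a n t = v + ∫ s in 0..t, mix L (w s) (∑' n, a n s) := by
    intro t ht
    have h1 : HasSum (fun n => ∫ s in 0..t, mix L (w s) (a n s))
        (∫ s in 0..t, mix L (w s) (∑' n, a n s)) := by
      refine intervalIntegral.hasSum_integral_of_dominated_convergence
        (fun n _ => M * ((M * max t 0) ^ n / n.factorial * ‖v‖))
        (fun n => ((hw.intervalIntegrable (hw.continuous_picardTerm v n)
          0 t).def').aestronglyMeasurable)
        (fun n => ae_of_all _ fun s hs => (norm_mix_apply_le (hw.mem s) _).trans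
          (mul_le_mul_of_nonneg_left (hle t n s ?_) hM))
        (ae_of_all _ fun s _ => (hsum _).mul_left M) intervalIntegrable_const
        (ae_of_all _ fun s _ => ((hsa s).hasSum).mapL (mix L (w s)))
      rw [Set.uIoc_of_le ht] at hs
      exact hs.2
    rw [(hsa t).tsum_eq_zero_add, ← h1.tsum_eq]
    refine congrArg₂ _ rfl (tsum_congr fun n => ?_)
    change ∫ s in 0..max t 0, _ = _
    rw [max_eq_left ht]
  have h0 : ∑' n, a n 0 = v := by rw [heq 0 le_rfl]; simp
  refine ⟨fun t => ∑' n, a n t, h0, fun T => ⟨hcont, fun t ht => ?_⟩⟩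
  beta_reduce
  rw [h0]
  exact heq t ht.1

theorem exists_fundamental [CompleteSpace V] (hw : IsLaw w) :
    ∃ Φ : ℝ → V →L[ℝ] V, Φ 0 = 1 ∧ ∀ v T, IsSol L w T fun t => Φ t v := by
  obtain ⟨Φ, h0, h⟩ := hw.exists_isSol
    (L := fun i => ContinuousLinearMap.mul ℝ (V →L[ℝ] V) (L i)) (1 : V →L[ℝ] V)
  have hmix : ∀ c X, mix (fun i => ContinuousLinearMap.mul ℝ (V →L[ℝ] V) (L i)) c X =
      mix L c * X := fun c X => by
    rw [mix_apply, mix, Finset.sum_mul]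
    simp
  refine ⟨Φ, h0, fun v T => ⟨(h 0).1.clm_apply continuous_const, fun t ht => ?_⟩⟩
  beta_reduce
  rw [(h T).2 t ht, add_apply, ContinuousLinearMap.intervalIntegral_apply
    (hw.intervalIntegrable (h T).1 _ _)]
  simp only [hmix]
  rfl

end IsLaw

end Existence

section Paths

variable {E : Type*} [NormedAddCommGroup E] [NormedSpace ℝ E] {N : ℕ}

/-- An integral-free description of a fundamental solution `Φ` of the switched equation: `F` is the
primitive of the switching law. -/
structure IsPath (A : Fin N → E →L[ℝ] E) (F : ℝ → Fin N → ℝ) (Φ : ℝ → E →L[ℝ] E) : Prop where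
  left_of_nonpos : ∀ t, t ≤ 0 → F t = 0
  right_of_nonpos : ∀ t, t ≤ 0 → Φ t = 1
  slope : ∀ s t, 0 ≤ s → s ≤ t → ∃ c ∈ stdSimplex ℝ (Fin N), F t - F s = (t - s) • c
  norm_sub_sub_le : ∀ s t, 0 ≤ s → s ≤ t → ∀ x, ‖Φ t x - Φ s x - mix A (F t - F s) (Φ s x)‖ ≤
    (Real.exp (mixBound A * (t - s)) - 1 - mixBound A * (t - s)) * ‖Φ s x‖

variable {A : Fin N → E →L[ℝ] E}

theorem norm_mix_smul_le {c : Fin N → ℝ} (hc : c ∈ stdSimplex ℝ (Fin N)) {h : ℝ} (hh : 0 ≤ h)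
    (x : E) : ‖mix A (h • c) x‖ ≤ mixBound A * h * ‖x‖ := by
  rw [mix_smul, smul_apply, norm_smul, Real.norm_of_nonneg hh, mul_comm (mixBound A), mul_assoc]
  exact mul_le_mul_of_nonneg_left (norm_mix_apply_le hc x) hh

namespace IsPath

variable {F : ℝ → Fin N → ℝ} {Φ : ℝ → E →L[ℝ] E}

theorem norm_sub_le (h : IsPath A F Φ) {s t : ℝ} (hs : 0 ≤ s) (hst : s ≤ t) (x : E) :
    ‖Φ t x - Φ s x‖ ≤ (Real.exp (mixBound A * (t - s)) - 1) * ‖Φ s x‖ := by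
  obtain ⟨c, hc, hF⟩ := h.slope s t hs hst
  have h1 := h.norm_sub_sub_le s t hs hst x
  have h2 := norm_mix_smul_le (A := A) hc (sub_nonneg.2 hst) (Φ s x)
  rw [← hF] at h2
  have := norm_add_le (Φ t x - Φ s x - mix A (F t - F s) (Φ s x)) (mix A (F t - F s) (Φ s x))
  rw [sub_add_cancel] at this
  linarith

theorem norm_le (h : IsPath A F Φ) {s t : ℝ} (hs : 0 ≤ s) (hst : s ≤ t) (x : E) :
    ‖Φ t x‖ ≤ Real.exp (mixBound A * (t - s)) * ‖Φ s x‖ := by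
  have h1 := h.norm_sub_le hs hst x
  have := norm_add_le (Φ t x - Φ s x) (Φ s x)
  rw [sub_add_cancel] at this
  linarith

/-- The defining estimate of a path composes. -/
theorem estimate_trans {c c' : Fin N → ℝ} (hc' : c' ∈ stdSimplex ℝ (Fin N)) {h h' : ℝ}
    (hh' : 0 ≤ h') {x y z : E}
    (hyx : ‖y - x‖ ≤ (Real.exp (mixBound A * h) - 1) * ‖x‖)
    (h1 : ‖y - x - mix A c x‖ ≤ (Real.exp (mixBound A * h) - 1 - mixBound A * h) * ‖x‖)
    (h2 : ‖z - y - mix A (h' • c') y‖ ≤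
      (Real.exp (mixBound A * h') - 1 - mixBound A * h') * ‖y‖) :
    ‖z - x - mix A (c + h' • c') x‖ ≤
      (Real.exp (mixBound A * (h + h')) - 1 - mixBound A * (h + h')) * ‖x‖ := by
  have hM := mixBound_nonneg A
  have h3 := norm_mix_smul_le (A := A) hc' hh' (y - x)
  have hy : ‖y‖ ≤ Real.exp (mixBound A * h) * ‖x‖ := by
    have := norm_add_le (y - x) x
    rw [sub_add_cancel] at this
    linarith
  have h4 : z - x - mix A (c + h' • c') x = (z - y - mix A (h' • c') y) + (y - x - mix A c x) +
      mix A (h' • c') (y - x) := by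
    rw [mix_add, add_apply, map_sub]; abel
  have hρ : 0 ≤ Real.exp (mixBound A * h') - 1 - mixBound A * h' := by
    linarith [Real.add_one_le_exp (mixBound A * h')]
  have h5 := mul_le_mul_of_nonneg_left hy hρ
  have h6 := mul_le_mul_of_nonneg_left hyx (mul_nonneg hM hh')
  rw [h4, mul_add, Real.exp_add]
  refine (norm_add₃_le).trans ?_
  linarith

theorem concat {F' : ℝ → Fin N → ℝ} {Φ' : ℝ → E →L[ℝ] E} (h : IsPath A F Φ)
    (h' : IsPath A F' Φ') {s : ℝ} (hs : 0 ≤ s) :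
    IsPath A (fun t => if t ≤ s then F t else F s + F' (t - s))
      fun t => if t ≤ s then Φ t else Φ' (t - s) * Φ s where
  left_of_nonpos t ht := by rw [if_pos (ht.trans hs), h.left_of_nonpos t ht]
  right_of_nonpos t ht := by rw [if_pos (ht.trans hs), h.right_of_nonpos t ht]
  slope a b ha hab := by
    rcases le_or_gt b s with hb | hb
    · rw [if_pos hb, if_pos (hab.trans hb)]
      exact h.slope a b ha hab
    rw [if_neg hb.not_ge]
    rcases le_or_gt a s with has | has
    · rw [if_pos has]
      obtain ⟨c, hc, hF⟩ := h.slope a s ha has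
      obtain ⟨c', hc', hF'⟩ := h'.slope 0 (b - s) le_rfl (by linarith)
      rw [h'.left_of_nonpos 0 le_rfl, sub_zero, sub_zero] at hF'
      have hba : 0 < b - a := by linarith
      refine ⟨((s - a) / (b - a)) • c + ((b - s) / (b - a)) • c',
        convex_stdSimplex ℝ (Fin N) hc hc' (div_nonneg (by linarith) hba.le)
          (div_nonneg (by linarith) hba.le) (by field_simp; ring), ?_⟩
      rw [smul_add, smul_smul, smul_smul, mul_div_cancel₀ _ hba.ne', mul_div_cancel₀ _ hba.ne',
        ← hF, ← hF']
      abel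
    · rw [if_neg has.not_ge]
      obtain ⟨c, hc, hF⟩ := h'.slope (a - s) (b - s) (by linarith) (by linarith)
      refine ⟨c, hc, ?_⟩
      rw [add_sub_add_left_eq_sub, hF]
      congr 1; ring
  norm_sub_sub_le a b ha hab x := by
    rcases le_or_gt b s with hb | hb
    · simp only [if_pos hb, if_pos (hab.trans hb)]
      exact h.norm_sub_sub_le a b ha hab x
    simp only [if_neg hb.not_ge]
    rcases le_or_gt a s with has | has
    · simp only [if_pos has]
      obtain ⟨c', hc', hF'⟩ := h'.slope 0 (b - s) le_rfl (by linarith)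
      have h2 := h'.norm_sub_sub_le 0 (b - s) le_rfl (by linarith) (Φ s x)
      rw [h'.left_of_nonpos 0 le_rfl, sub_zero, sub_zero] at hF'
      rw [h'.left_of_nonpos 0 le_rfl, sub_zero, sub_zero, h'.right_of_nonpos 0 le_rfl, hF'] at h2
      have := estimate_trans hc' (by linarith) (h.norm_sub_le ha has x)
        (h.norm_sub_sub_le a s ha has x) h2
      rw [show s - a + (b - s) = b - a by ring] at this
      rwa [hF', add_sub_right_comm]
    · simp only [if_neg has.not_ge]
      have := h'.norm_sub_sub_le (a - s) (b - s) (by linarith) (by linarith) (Φ s x)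
      rw [sub_sub_sub_cancel_right] at this
      rwa [add_sub_add_left_eq_sub]

theorem shift (h : IsPath A F Φ) {s : ℝ} (hs : 0 ≤ s) {R : E →L[ℝ] E} (hR : Φ s * R = 1) :
    IsPath A (fun t => F (s + max t 0) - F s) fun t => Φ (s + max t 0) * R where
  left_of_nonpos t ht := by simp [max_eq_right ht]
  right_of_nonpos t ht := by simpa [max_eq_right ht] using hR
  slope a b ha hab := by
    rw [max_eq_left ha, max_eq_left (ha.trans hab), sub_sub_sub_cancel_right]
    simpa using h.slope (s + a) (s + b) (by linarith) (by linarith)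
  norm_sub_sub_le a b ha hab x := by
    rw [max_eq_left ha, max_eq_left (ha.trans hab), sub_sub_sub_cancel_right]
    simpa using h.norm_sub_sub_le (s + a) (s + b) (by linarith) (by linarith) (R x)

theorem eq_zero_of_apply_eq_zero (h : IsPath A F Φ) {s : ℝ} {x : E} (hx : Φ s x = 0) : x = 0 := by
  have hM := mixBound_nonneg A
  obtain ⟨δ, hδ, hexp⟩ : ∃ δ : ℝ, 0 < δ ∧ Real.exp (mixBound A * δ) < 2 := by
    refine ⟨Real.log 2 / (mixBound A + 1), by positivity, ?_⟩
    rw [← Real.lt_log_iff_exp_lt two_pos, mul_div_assoc', div_lt_iff₀ (by positivity), mul_comm]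
    exact mul_lt_mul_of_pos_left (lt_add_one _) (Real.log_pos one_lt_two)
  have key : ∀ n : ℕ, ∀ s : ℝ, s ≤ n * δ → Φ s x = 0 → x = 0 := by
    intro n
    induction n with
    | zero =>
      intro s hs h0
      rw [h.right_of_nonpos s (by simpa using hs)] at h0
      exact h0
    | succ n ih =>
      intro s hs h0
      rcases le_or_gt s 0 with hs0 | hs0
      · rw [h.right_of_nonpos s hs0] at h0
        exact h0
      push_cast at hs
      have h1 : s - max (s - δ) 0 ≤ δ := by linarith [le_max_left (s - δ) 0]
      refine ih (max (s - δ) 0) (max_le (by linarith) (by positivity)) ?_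
      have h2 := h.norm_sub_le (le_max_right (s - δ) 0) (max_le (by linarith) hs0.le) x
      have h3 : Real.exp (mixBound A * (s - max (s - δ) 0)) < 2 :=
        (Real.exp_le_exp.2 (mul_le_mul_of_nonneg_left h1 hM)).trans_lt hexp
      rw [h0, zero_sub, norm_neg] at h2
      by_contra hne
      have := norm_pos_iff.2 hne
      nlinarith
  obtain ⟨n, hn⟩ := exists_nat_ge (s / δ)
  exact key n s ((div_le_iff₀ hδ).1 hn) hx

theorem exists_inverse [FiniteDimensional ℝ E] (h : IsPath A F Φ) (s : ℝ) :
    ∃ R : E →L[ℝ] E, Φ s * R = 1 ∧ R * Φ s = 1 := by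
  have hinj : Function.Injective (Φ s : E →ₗ[ℝ] E) :=
    (injective_iff_map_eq_zero _).2 fun x hx => h.eq_zero_of_apply_eq_zero hx
  set e := LinearEquiv.ofInjectiveEndo (Φ s : E →ₗ[ℝ] E) hinj
  have he : ∀ x, e x = Φ s x := fun x => rfl
  refine ⟨LinearMap.toContinuousLinearMap (e.symm : E →ₗ[ℝ] E), ?_, ?_⟩
  · ext x
    exact (he _).symm.trans (e.apply_symm_apply x)
  · ext x
    change e.symm (Φ s x) = x
    rw [← he, e.symm_apply_apply]

end IsPath

theorem IsLaw.isPath [CompleteSpace E] {w : ℝ → Fin N → ℝ} (hw : IsLaw w) {Φ : ℝ → E →L[ℝ] E}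
    (h0 : Φ 0 = 1) (h : ∀ v T, IsSol A w T fun t => Φ t v) :
    IsPath A (fun t i => ∫ s in 0..max t 0, w s i) fun t => Φ (max t 0) := by
  have hF : ∀ a b : ℝ, (fun i => ∫ s in 0..b, w s i) - (fun i => ∫ s in 0..a, w s i) =
      fun i => ∫ s in 0..(b - a), w (a + s) i := by
    intro a b
    ext i
    rw [Pi.sub_apply, intervalIntegral.integral_interval_sub_left
      (hw.intervalIntegrable_coord i _ _) (hw.intervalIntegrable_coord i _ _),
      intervalIntegral.integral_comp_add_left (fun s => w s i), add_zero, add_sub_cancel]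
  refine ⟨fun t ht => by ext i; simp [max_eq_right ht], fun t ht => by simp [max_eq_right ht, h0],
    fun a b ha hab => ?_, fun a b ha hab x => ?_⟩
  · rw [max_eq_left ha, max_eq_left (ha.trans hab), hF]
    rcases hab.eq_or_lt with rfl | hab
    · exact ⟨w 0, hw.mem 0, by ext i; simp⟩
    have hba : 0 < b - a := sub_pos.2 hab
    have hw' := hw.comp_add a
    refine ⟨(b - a)⁻¹ • fun i => ∫ s in 0..(b - a), w (a + s) i, ⟨fun i => ?_, ?_⟩, ?_⟩
    · exact mul_nonneg (inv_nonneg.2 hba.le) (intervalIntegral.integral_nonneg hba.le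
        fun s _ => (hw'.mem s).1 i)
    · simp only [Pi.smul_apply, smul_eq_mul]
      rw [← Finset.mul_sum, ← intervalIntegral.integral_finsetSum
        fun i _ => hw'.intervalIntegrable_coord i _ _]
      simp only [(hw'.mem _).2]
      simp [hba.ne']
    · rw [smul_inv_smul₀ hba.ne']
  · simp only [max_eq_left ha, max_eq_left (ha.trans hab), hF]
    have := ((h x b).shift hw ⟨ha, hab⟩).norm_sub_sub_le (hw.comp_add a)
      (Set.right_mem_Icc.2 (sub_nonneg.2 hab))
    simpa using this

end Paths

section Reach

variable {E : Type*} [NormedAddCommGroup E] [NormedSpace ℝ E] {N : ℕ}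

/-- The evolution operators of length `t` of the switched system. -/
def reach (A : Fin N → E →L[ℝ] E) (t : ℝ) : Set (E →L[ℝ] E) :=
  {X | ∃ F Φ, IsPath A F Φ ∧ Φ t = X}

variable {A : Fin N → E →L[ℝ] E}

theorem isClosed_isPath : IsClosed
    {p : (ℝ → Fin N → ℝ) × (ℝ → E →L[ℝ] E) | IsPath A p.1 p.2} := by
  have hset : {p : (ℝ → Fin N → ℝ) × (ℝ → E →L[ℝ] E) | IsPath A p.1 p.2} =
      ((⋂ t, ⋂ _ : t ≤ 0, {p | p.1 t = 0}) ∩ ⋂ t, ⋂ _ : t ≤ 0, {p | p.2 t = 1}) ∩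
      ((⋂ s, ⋂ t, ⋂ _ : 0 ≤ s, ⋂ _ : s ≤ t, (fun p => p.1 t - p.1 s) ⁻¹'
        ((fun c => (t - s) • c) '' stdSimplex ℝ (Fin N))) ∩
      ⋂ s, ⋂ t, ⋂ _ : 0 ≤ s, ⋂ _ : s ≤ t, ⋂ x,
        {p | ‖p.2 t x - p.2 s x - mix A (p.1 t - p.1 s) (p.2 s x)‖ ≤
          (Real.exp (mixBound A * (t - s)) - 1 - mixBound A * (t - s)) * ‖p.2 s x‖}) := by
    ext p
    simp only [Set.mem_inter_iff, Set.mem_iInter, Set.mem_preimage, Set.mem_image,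
      Set.mem_ofPred_eq]
    constructor
    · intro h
      refine ⟨⟨h.1, h.2⟩, fun s t hs ht => ?_, h.4⟩
      obtain ⟨c, hc, hF⟩ := h.3 s t hs ht
      exact ⟨c, hc, hF.symm⟩
    · rintro ⟨⟨h1, h2⟩, h3, h4⟩
      refine ⟨h1, h2, fun s t hs ht => ?_, h4⟩
      obtain ⟨c, hc, hF⟩ := h3 s t hs ht
      exact ⟨c, hc, hF.symm⟩
  have hc1 : ∀ t, Continuous fun p : (ℝ → Fin N → ℝ) × (ℝ → E →L[ℝ] E) => p.1 t :=
    fun t => (continuous_apply t).comp continuous_fst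
  have hc2 : ∀ t, Continuous fun p : (ℝ → Fin N → ℝ) × (ℝ → E →L[ℝ] E) => p.2 t :=
    fun t => (continuous_apply t).comp continuous_snd
  have hc3 : ∀ t x, Continuous fun p : (ℝ → Fin N → ℝ) × (ℝ → E →L[ℝ] E) => p.2 t x :=
    fun t x => (hc2 t).clm_apply continuous_const
  rw [hset]
  refine (IsClosed.inter ?_ ?_).inter (IsClosed.inter ?_ ?_)
  · exact isClosed_iInter fun t => isClosed_iInter fun _ => isClosed_eq (hc1 t) continuous_const
  · exact isClosed_iInter fun t => isClosed_iInter fun _ => isClosed_eq (hc2 t) continuous_const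
  · refine isClosed_iInter fun s => isClosed_iInter fun t => isClosed_iInter fun _ =>
      isClosed_iInter fun _ => IsClosed.preimage ((hc1 t).sub (hc1 s)) ?_
    exact ((isCompact_stdSimplex ℝ (Fin N)).image (continuous_const_smul _)).isClosed
  · refine isClosed_iInter fun s => isClosed_iInter fun t => isClosed_iInter fun _ =>
      isClosed_iInter fun _ => isClosed_iInter fun x => isClosed_le ?_ ?_
    · exact (((hc3 t x).sub (hc3 s x)).sub
        (((continuous_mix A).comp ((hc1 t).sub (hc1 s))).clm_apply (hc3 s x))).norm
    · exact continuous_const.mul (hc3 s x).norm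

theorem norm_le_one_of_mem_stdSimplex {c : Fin N → ℝ} (hc : c ∈ stdSimplex ℝ (Fin N)) :
    ‖c‖ ≤ 1 := by
  refine (pi_norm_le_iff_of_nonneg zero_le_one).2 fun i => ?_
  rw [Real.norm_of_nonneg (hc.1 i), ← hc.2]
  exact Finset.single_le_sum (fun j _ => hc.1 j) (Finset.mem_univ i)

theorem isCompact_reach [FiniteDimensional ℝ E] (t : ℝ) : IsCompact (reach A t) := by
  have : ProperSpace (E →L[ℝ] E) := FiniteDimensional.proper ℝ _
  have hc : IsCompact ((Set.univ.pi fun t : ℝ => Metric.closedBall (0 : Fin N → ℝ) |t|) ×ˢ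
      (Set.univ.pi fun t : ℝ => Metric.closedBall (0 : E →L[ℝ] E)
        (Real.exp (mixBound A * |t|)))) :=
    (isCompact_univ_pi fun _ => isCompact_closedBall _ _).prod
      (isCompact_univ_pi fun _ => isCompact_closedBall _ _)
  have hM := mixBound_nonneg A
  have hP := hc.of_isClosed_subset (isClosed_isPath (A := A)) (by
    rintro ⟨F, Φ⟩ (h : IsPath A F Φ)
    refine ⟨fun t _ => ?_, fun t _ => ?_⟩
    · simp only [mem_closedBall_zero_iff]
      rcases le_or_gt t 0 with ht | ht
      · simp [h.left_of_nonpos t ht]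
      obtain ⟨c, hc, hF⟩ := h.slope 0 t le_rfl ht.le
      rw [h.left_of_nonpos 0 le_rfl, sub_zero, sub_zero] at hF
      rw [hF, norm_smul]
      exact mul_le_of_le_one_right (norm_nonneg _) (norm_le_one_of_mem_stdSimplex hc)
    · simp only [mem_closedBall_zero_iff]
      refine ContinuousLinearMap.opNorm_le_bound _ (Real.exp_pos _).le fun x => ?_
      rcases le_or_gt t 0 with ht | ht
      · rw [h.right_of_nonpos t ht]
        exact le_mul_of_one_le_left (norm_nonneg x)
          (Real.one_le_exp (mul_nonneg hM (abs_nonneg t)))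
      · have := h.norm_le le_rfl ht.le x
        rw [h.right_of_nonpos 0 le_rfl, sub_zero] at this
        rwa [abs_of_pos ht])
  have : reach A t = (fun p : (ℝ → Fin N → ℝ) × (ℝ → E →L[ℝ] E) => p.2 t) ''
      {p | IsPath A p.1 p.2} := by
    ext X
    constructor
    · rintro ⟨F, Φ, h, hX⟩
      exact ⟨(F, Φ), h, hX⟩
    · rintro ⟨⟨F, Φ⟩, h, hX⟩
      exact ⟨F, Φ, h, hX⟩
  rw [this]
  exact hP.image ((continuous_apply t).comp continuous_snd)

theorem IsLaw.mem_reach [CompleteSpace E] {w : ℝ → Fin N → ℝ} (hw : IsLaw w)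
    {Φ : ℝ → E →L[ℝ] E} (h0 : Φ 0 = 1) (h : ∀ v T, IsSol A w T fun t => Φ t v) {t : ℝ}
    (ht : 0 ≤ t) : Φ t ∈ reach A t :=
  ⟨_, _, hw.isPath h0 h, by rw [max_eq_left ht]⟩

theorem isLaw_const {c : Fin N → ℝ} (hc : c ∈ stdSimplex ℝ (Fin N)) : IsLaw fun _ : ℝ => c :=
  ⟨fun _ => measurable_const, fun _ => hc⟩

theorem exp_mem_reach [CompleteSpace E] {c : Fin N → ℝ} (hc : c ∈ stdSimplex ℝ (Fin N)) {t : ℝ}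
    (ht : 0 ≤ t) : NormedSpace.exp (t • mix A c) ∈ reach A t := by
  have hd : ∀ (v : E) (t : ℝ), HasDerivAt (fun t : ℝ => NormedSpace.exp (t • mix A c) v)
      (mix A c (NormedSpace.exp (t • mix A c) v)) t := fun v t => by
    simpa using (hasDerivAt_exp_smul_const' (𝕂 := ℝ) (mix A c) t).clm_apply (hasDerivAt_const t v)
  have hcont : ∀ v : E, Continuous fun t : ℝ => NormedSpace.exp (t • mix A c) v := fun v =>
    continuous_iff_continuousAt.2 fun t => (hd v t).continuousAt
  refine (isLaw_const hc).mem_reach (Φ := fun t : ℝ => NormedSpace.exp (t • mix A c))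
    (by simp) (fun v T => ⟨hcont v, fun t _ => ?_⟩) ht
  rw [intervalIntegral.integral_eq_sub_of_hasDerivAt (fun s _ => hd v s)
    (((mix A c).continuous.comp (hcont v)).intervalIntegrable _ _)]
  abel

theorem isEvolution_reach [FiniteDimensional ℝ E] (A : Fin N → E →L[ℝ] E)
    (hN : (stdSimplex ℝ (Fin N)).Nonempty) :
    IsEvolution (reach A) (mix A '' stdSimplex ℝ (Fin N)) where
  one_mem := by
    obtain ⟨c, hc⟩ := hN
    simpa using exp_mem_reach (A := A) hc le_rfl
  mul_mem := by
    rintro s t _ _ hs ht ⟨F, Φ, h, rfl⟩ ⟨F', Φ', h', rfl⟩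
    refine ⟨_, _, h.concat h' hs, ?_⟩
    rcases ht.eq_or_lt with rfl | ht
    · simp [h'.right_of_nonpos 0 le_rfl]
    · simp [ht.not_ge]
  path := by
    rintro T _ - ⟨F, Φ, h, rfl⟩
    refine ⟨Φ, h.right_of_nonpos 0 le_rfl, rfl, fun s t hs hst _ => ?_⟩
    obtain ⟨R, hR, hR'⟩ := h.exists_inverse s
    refine ⟨Φ t * R, ⟨_, _, h.shift hs hR, ?_⟩, ?_⟩
    · rw [max_eq_left (sub_nonneg.2 hst), add_sub_cancel]
    · rw [mul_assoc, hR', mul_one]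
  isCompact t _ := isCompact_reach t
  isCompact_gen := (isCompact_stdSimplex ℝ (Fin N)).image (continuous_mix A)
  convex_gen := by
    rintro _ ⟨c, hc, rfl⟩ _ ⟨c', hc', rfl⟩ a b ha hb hab
    exact ⟨a • c + b • c', convex_stdSimplex ℝ (Fin N) hc hc' ha hb hab, by
      rw [mix_add, mix_smul, mix_smul]⟩
  approx := by
    have hM := mixBound_nonneg A
    refine ⟨mixBound A ^ 2 * (2 * Real.exp (mixBound A)), by positivity, ?_⟩
    rintro t ht ht1 _ ⟨F, Φ, h, rfl⟩
    obtain ⟨c, hc, hF⟩ := h.slope 0 t le_rfl ht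
    rw [h.left_of_nonpos 0 le_rfl, sub_zero, sub_zero] at hF
    refine ⟨mix A c, ⟨c, hc, rfl⟩, ContinuousLinearMap.opNorm_le_bound _ (by positivity)
      fun x => ?_⟩
    have h1 := h.norm_sub_sub_le 0 t le_rfl ht x
    rw [h.left_of_nonpos 0 le_rfl, sub_zero, sub_zero, h.right_of_nonpos 0 le_rfl, hF,
      mix_smul] at h1
    refine h1.trans (mul_le_mul_of_nonneg_right ?_ (norm_nonneg x))
    refine (le_abs_self _).trans ((abs_exp_sub_one_sub_le _).trans ?_)
    rw [abs_of_nonneg (mul_nonneg hM ht)]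
    have : mixBound A * t ≤ mixBound A := mul_le_of_le_one_right hM ht1
    calc (mixBound A * t) ^ 2 * (2 * Real.exp (mixBound A * t))
        ≤ (mixBound A * t) ^ 2 * (2 * Real.exp (mixBound A)) := by gcongr
      _ = mixBound A ^ 2 * (2 * Real.exp (mixBound A)) * t ^ 2 := by ring
  flow := by
    rintro _ ⟨c, hc, rfl⟩
    exact ⟨fun t => NormedSpace.exp (t • mix A c), by simp, fun t ht => exp_mem_reach hc ht,
      fun t _ => (hasDerivAt_exp_smul_const (𝕂 := ℝ) (mix A c) t).hasDerivWithinAt⟩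

end Reach

section Recover

variable {E : Type*} [NormedAddCommGroup E] [NormedSpace ℝ E] {N : ℕ} {A : Fin N → E →L[ℝ] E}

namespace IsPath

variable {F : ℝ → Fin N → ℝ} {Φ Ψ : ℝ → E →L[ℝ] E}

theorem lipschitzWith (h : IsPath A F Φ) : LipschitzWith 1 F := by
  have hle : ∀ s t, s ≤ t → dist (F s) (F t) ≤ dist s t := by
    intro s t hst
    have hmax : ∀ t, F t = F (max t 0) := fun t => by
      rcases le_or_gt t 0 with ht | ht
      · rw [max_eq_right ht, h.left_of_nonpos t ht, h.left_of_nonpos 0 le_rfl]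
      · rw [max_eq_left ht.le]
    obtain ⟨c, hc, hF⟩ := h.slope (max s 0) (max t 0) (le_max_right _ _) (max_le_max_right 0 hst)
    rw [dist_comm, dist_eq_norm, hmax s, hmax t, hF, norm_smul, Real.norm_eq_abs, dist_comm s t,
      Real.dist_eq]
    exact (mul_le_of_le_one_right (abs_nonneg _) (norm_le_one_of_mem_stdSimplex hc)).trans
      (abs_max_sub_max_le_abs _ _ _)
  refine LipschitzWith.of_dist_le_mul fun s t => ?_
  rw [NNReal.coe_one, one_mul]
  rcases le_total s t with hst | hst
  · exact hle s t hst
  · rw [dist_comm (F s), dist_comm s]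
    exact hle t s hst

theorem deriv_mem (h : IsPath A F Φ) {t : ℝ} (ht : 0 ≤ t) (hd : DifferentiableAt ℝ F t) :
    deriv F t ∈ stdSimplex ℝ (Fin N) := by
  refine (isCompact_stdSimplex ℝ (Fin N)).isClosed.mem_of_tendsto
    hd.hasDerivAt.tendsto_slope_zero_right ?_
  filter_upwards [self_mem_nhdsWithin] with r (hr : 0 < r)
  obtain ⟨c, hc, hF⟩ := h.slope t (t + r) ht (by linarith)
  rwa [hF, add_sub_cancel_left, inv_smul_smul₀ hr.ne']

theorem exists_isLaw (h : IsPath A F Φ) : ∃ w, IsLaw w ∧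
    ∀ t, 0 ≤ t → F t = fun i => ∫ s in 0..t, w s i := by
  classical
  obtain ⟨c, hc, -⟩ := h.slope 0 0 le_rfl le_rfl
  have hD := measurable_deriv F
  refine ⟨fun t => if deriv F t ∈ stdSimplex ℝ (Fin N) then deriv F t else c,
    ⟨fun i => ?_, fun s => ?_⟩, fun t ht => ?_⟩
  · exact (measurable_pi_apply i).comp (Measurable.ite
      (hD (isCompact_stdSimplex ℝ (Fin N)).isClosed.measurableSet) hD measurable_const)
  · split_ifs with hs
    · exact hs
    · exact hc
  · ext i
    have hlip : LipschitzWith 1 fun t => F t i := by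
      simpa using! (LipschitzWith.eval i).comp h.lipschitzWith
    have := (hlip.lipschitzOnWith (s := Set.uIcc 0 t)
      ).absolutelyContinuousOnInterval.integral_deriv_eq_sub
    rw [h.left_of_nonpos 0 le_rfl, Pi.zero_apply, sub_zero] at this
    rw [← this]
    refine intervalIntegral.integral_congr_ae ?_
    filter_upwards [h.lipschitzWith.ae_differentiableAt_real] with s hs hst
    rw [Set.uIoc_of_le ht] at hst
    rw [if_pos (h.deriv_mem hst.1.le hs)]
    exact (hasDerivAt_pi.1 hs.hasDerivAt i).deriv

theorem continuousOn_apply (h : IsPath A F Φ) (T : ℝ) (x : E) :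
    ContinuousOn (fun t => Φ t x) (Set.Icc 0 T) := by
  have hM := mixBound_nonneg A
  have hle : ∀ s t, 0 ≤ s → s ≤ t → t ≤ T → ‖Φ t x - Φ s x‖ ≤
      (Real.exp (mixBound A * |t - s|) - 1) * (Real.exp (mixBound A * T) * ‖x‖) := by
    intro s t hs hst ht
    have h1 := h.norm_le le_rfl hs x
    rw [h.right_of_nonpos 0 le_rfl, sub_zero] at h1
    rw [abs_of_nonneg (sub_nonneg.2 hst)]
    refine (h.norm_sub_le hs hst x).trans (mul_le_mul_of_nonneg_left (h1.trans ?_) ?_)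
    · change _ * ‖x‖ ≤ _
      have : s ≤ T := hst.trans ht
      gcongr
    · linarith [Real.one_le_exp (mul_nonneg hM (sub_nonneg.2 hst))]
  intro s hs
  rw [ContinuousWithinAt, tendsto_iff_norm_sub_tendsto_zero]
  have hlim : Tendsto (fun t => (Real.exp (mixBound A * |t - s|) - 1) *
      (Real.exp (mixBound A * T) * ‖x‖)) (𝓝[Set.Icc 0 T] s) (𝓝 0) := by
    have : Continuous fun t => (Real.exp (mixBound A * |t - s|) - 1) *
      (Real.exp (mixBound A * T) * ‖x‖) := by fun_prop
    have h2 := (this.tendsto s).mono_left (nhdsWithin_le_nhds (s := Set.Icc 0 T))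
    simpa using h2
  refine squeeze_zero' (Eventually.of_forall fun _ => norm_nonneg _) ?_ hlim
  filter_upwards [self_mem_nhdsWithin] with t ht
  rcases le_total s t with hst | hst
  · exact hle s t hs.1 hst ht.2
  · rw [norm_sub_rev, abs_sub_comm]
    exact hle t s ht.1 hst hs.2

/-- A path is determined by the primitive of its switching law. -/
theorem eq_of_eqOn {F' : ℝ → Fin N → ℝ} (h : IsPath A F Φ) (h' : IsPath A F' Ψ) {T : ℝ}
    (hT : 0 ≤ T) (hF : ∀ t ∈ Set.Icc 0 T, F t = F' t) : Φ T = Ψ T := by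
  have hM := mixBound_nonneg A
  ext x
  set f : ℝ → ℝ := fun t => ‖Φ t x - Ψ t x‖ with hf
  have hstep : ∀ s ∈ Set.Ico 0 T, ∀ t ∈ Set.Ioc s T, (t - s)⁻¹ * (f t - f s) ≤
      mixBound A * f s + mixBound A ^ 2 * (t - s) * (2 * Real.exp (mixBound A * (t - s))) *
        (‖Φ s x‖ + ‖Ψ s x‖) := by
    intro s hs t ht
    have hts : 0 < t - s := sub_pos.2 ht.1
    obtain ⟨c, hc, hFc⟩ := h.slope s t hs.1 ht.1.le
    have h1 := h.norm_sub_sub_le s t hs.1 ht.1.le x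
    have h2 := h'.norm_sub_sub_le s t hs.1 ht.1.le x
    rw [← hF s ⟨hs.1, hs.2.le⟩, ← hF t ⟨hs.1.trans ht.1.le, ht.2⟩] at h2
    have h3 := norm_mix_smul_le (A := A) hc hts.le (Φ s x - Ψ s x)
    rw [← hFc] at h3
    have h4 : Φ t x - Ψ t x = (Φ s x - Ψ s x) +
        ((Φ t x - Φ s x - mix A (F t - F s) (Φ s x)) -
          (Ψ t x - Ψ s x - mix A (F t - F s) (Ψ s x))) + mix A (F t - F s) (Φ s x - Ψ s x) := by
      rw [map_sub]; abel
    have h5 : f t ≤ f s + ((Real.exp (mixBound A * (t - s)) - 1 - mixBound A * (t - s)) *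
        (‖Φ s x‖ + ‖Ψ s x‖)) + mixBound A * (t - s) * f s := by
      simp only [hf]
      rw [h4]
      refine norm_add₃_le.trans ?_
      have := _root_.norm_sub_le (Φ t x - Φ s x - mix A (F t - F s) (Φ s x))
        (Ψ t x - Ψ s x - mix A (F t - F s) (Ψ s x))
      linarith
    have h6 := (le_abs_self _).trans (abs_exp_sub_one_sub_le (mixBound A * (t - s)))
    rw [abs_of_nonneg (mul_nonneg hM hts.le)] at h6
    have h7 := mul_le_mul_of_nonneg_right h6 (add_nonneg (norm_nonneg (Φ s x)) (norm_nonneg (Ψ s x)))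
    rw [inv_mul_le_iff₀ hts]
    linarith
  have hgron := le_gronwallBound_of_liminf_deriv_right_le (f := f)
    (f' := fun s => mixBound A * f s) (δ := 0) (K := mixBound A) (ε := 0) (a := 0) (b := T)
    ((h.continuousOn_apply T x).sub (h'.continuousOn_apply T x)).norm (by
      intro s hs r hr
      refine Eventually.frequently ?_
      have hlim : Tendsto (fun t => mixBound A * f s + mixBound A ^ 2 * (t - s) *
          (2 * Real.exp (mixBound A * (t - s))) * (‖Φ s x‖ + ‖Ψ s x‖)) (𝓝[>] s)
          (𝓝 (mixBound A * f s)) := by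
        have : Continuous fun t => mixBound A * f s + mixBound A ^ 2 * (t - s) *
          (2 * Real.exp (mixBound A * (t - s))) * (‖Φ s x‖ + ‖Ψ s x‖) := by fun_prop
        simpa using (this.tendsto s).mono_left (nhdsWithin_le_nhds (s := Set.Ioi s))
      filter_upwards [hlim.eventually_lt_const hr, Ioc_mem_nhdsGT hs.2] with t h1 h2
      exact (hstep s hs t h2).trans_lt h1)
    (by simp [hf, h.right_of_nonpos 0 le_rfl, h'.right_of_nonpos 0 le_rfl])
    (fun s _ => by simp) T (Set.right_mem_Icc.2 hT)
  exact sub_eq_zero.1 (norm_le_zero_iff.1 (hgron.trans_eq (by simp [gronwallBound])))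

end IsPath

theorem tendsto_zero_of_forall_apply [FiniteDimensional ℝ E] {X : ℕ → E →L[ℝ] E}
    (h : ∀ v, Tendsto (fun n => X n v) atTop (𝓝 0)) : Tendsto X atTop (𝓝 0) := by
  set b := Module.finBasis ℝ E
  obtain ⟨C, -, hC⟩ := b.exists_opNorm_le (F := E)
  have hlim : Tendsto (fun n => C * ∑ i, ‖X n (b i)‖) atTop (𝓝 0) := by
    simpa using (tendsto_finsetSum Finset.univ fun i _ => (h (b i)).norm).const_mul C
  refine squeeze_zero_norm (fun n => hC (Finset.sum_nonneg fun i _ => norm_nonneg _) fun i => ?_)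
    hlim
  exact Finset.single_le_sum (f := fun i => ‖X n (b i)‖) (fun i _ => norm_nonneg _)
    (Finset.mem_univ i)

/-- The `T`-periodic law which agrees with `w` on `(0, T]`. -/
noncomputable def periodize (w : ℝ → Fin N → ℝ) (T s : ℝ) : Fin N → ℝ :=
  w (T - T * Int.fract (-s / T))

theorem IsLaw.periodize {w : ℝ → Fin N → ℝ} (hw : IsLaw w) (T : ℝ) : IsLaw (periodize w T) :=
  ⟨fun i => (hw.measurable i).comp (by fun_prop), fun _ => hw.mem _⟩

theorem periodize_add (w : ℝ → Fin N → ℝ) {T : ℝ} (hT : T ≠ 0) (s : ℝ) :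
    periodize w T (s + T) = periodize w T s := by
  have : -(s + T) / T = -s / T - 1 := by field_simp; ring
  rw [periodize, this, Int.fract_sub_one, periodize]

theorem periodize_eq (w : ℝ → Fin N → ℝ) {T s : ℝ} (hs : 0 < s) (hsT : s ≤ T) :
    periodize w T s = w s := by
  have hT : 0 < T := hs.trans_le hsT
  have : Int.fract (-s / T) = 1 - s / T := by
    rw [Int.fract_eq_iff]
    refine ⟨sub_nonneg.2 ((div_le_one hT).2 hsT), sub_lt_self _ (div_pos hs hT), -1, ?_⟩
    push_cast
    ring
  rw [periodize, this]
  congr 1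
  field_simp
  ring

theorem powerStable_reach [FiniteDimensional ℝ E]
    (hper : ∀ u : ℝ → Fin N → ℝ, IsLaw u → ∀ T, 0 < T → (∀ s, u (s + T) = u s) →
      ∀ x : ℝ → E, (∀ R, IsSol A u R x) → Tendsto x atTop (𝓝 0)) : PowerStable (reach A) := by
  rintro T hT _ ⟨F, Φ, h, rfl⟩
  obtain ⟨w, hw, hF⟩ := h.exists_isLaw
  have hu := hw.periodize T
  have hut : ∀ s, periodize w T (s + T) = periodize w T s := periodize_add w hT.ne'
  obtain ⟨Ψ, h0, hΨ⟩ := hu.exists_fundamental (L := A)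
  have hΦΨ : Φ T = Ψ T := by
    have := h.eq_of_eqOn (hu.isPath h0 hΨ) hT.le fun t ht => by
      rw [hF t ht.1, max_eq_left ht.1]
      ext i
      refine intervalIntegral.integral_congr_ae (ae_of_all _ fun s hs => ?_)
      rw [Set.uIoc_of_le ht.1] at hs
      rw [periodize_eq w hs.1 (hs.2.trans ht.2)]
    rwa [max_eq_left hT.le] at this
  have hpow : ∀ (n : ℕ) v, Ψ (n * T) v = (Φ T ^ n) v := by
    intro n
    induction n with
    | zero => simp [h0]
    | succ n ih =>
      intro v
      have h1 := (hΨ v (T + n * T)).shift hu ⟨hT.le, by simp; positivity⟩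
      rw [funext fun r => (congrArg _ (add_comm T r)).trans (hut r), add_sub_cancel_left] at h1
      have h2 := h1.eq_of_eq_zero hu (hΨ (Φ T v) (n * T)) (by simp [h0, hΦΨ])
        (Set.right_mem_Icc.2 (by positivity))
      beta_reduce at h2
      rw [ih] at h2
      rw [pow_succ, Nat.cast_succ, add_one_mul, add_comm, h2]
      rfl
  refine tendsto_zero_of_forall_apply fun v => ?_
  have := (hper _ hu T hT hut _ (hΨ v)).comp
    (tendsto_natCast_atTop_atTop.atTop_mul_const hT)
  exact this.congr fun n => hpow n v

end Recover

section Trajectories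

variable {d N : ℕ} {A : Fin N → EuclideanSpace ℝ (Fin d) →L[ℝ] EuclideanSpace ℝ (Fin d)}

theorem IsSwitchingLaw.nonempty_stdSimplex {u : Fin N → ℝ → ℝ} (hu : IsSwitchingLaw u) :
    (stdSimplex ℝ (Fin N)).Nonempty := by
  have : (ae (volume.restrict (Set.Ici (0 : ℝ)))).NeBot := by
    rw [ae_neBot]
    simp
  obtain ⟨s, hs⟩ := hu.2.exists
  exact ⟨fun i => u i s, fun i => (hs.1 i).1, hs.2⟩

theorem IsSol.isLinTrajectoryWith {u : ℝ → Fin N → ℝ} (hu : IsLaw u)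
    {x : ℝ → EuclideanSpace ℝ (Fin d)} (hx : ∀ R, IsSol A u R x) :
    IsLinTrajectoryWith A (fun i s => u s i) fun t => x t := by
  refine ⟨(hx 0).1.comp NNReal.continuous_coe, ⟨hu.measurable, ae_of_all _ fun s =>
    ⟨fun i => ⟨(hu.mem s).1 i, (le_abs_self _).trans (hu.abs_le_one s i)⟩, (hu.mem s).2⟩⟩,
    fun t => ?_⟩
  beta_reduce
  rw [(hx t).2 t (Set.right_mem_Icc.2 t.2), intervalIntegral.integral_of_le (NNReal.coe_nonneg t),
    NNReal.coe_zero]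
  refine congrArg₂ _ rfl (setIntegral_congr_fun measurableSet_Ioc fun s hs => ?_)
  simp only [mix_apply, Real.coe_toNNReal s hs.1.le]

theorem IsLinTrajectoryWith.exists_isSol {u : Fin N → ℝ → ℝ}
    {x : ℝ≥0 → EuclideanSpace ℝ (Fin d)} (h : IsLinTrajectoryWith A u x) :
    ∃ w, IsLaw w ∧ ∀ T, IsSol A w T fun t => x t.toNNReal := by
  classical
  obtain ⟨c, hc⟩ := h.2.1.nonempty_stdSimplex
  have hm : Measurable fun s i => u i s := measurable_pi_lambda _ h.2.1.1
  refine ⟨fun s => if (fun i => u i s) ∈ stdSimplex ℝ (Fin N) then fun i => u i s else c,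
    ⟨fun i => ?_, fun s => ?_⟩, fun T => ⟨h.1.comp continuous_real_toNNReal, fun t ht => ?_⟩⟩
  · exact (measurable_pi_apply i).comp (Measurable.ite
      (hm (isCompact_stdSimplex ℝ (Fin N)).isClosed.measurableSet) hm measurable_const)
  · split_ifs with hs
    · exact hs
    · exact hc
  · beta_reduce
    rw [h.2.2, Real.coe_toNNReal t ht.1, Real.toNNReal_zero, intervalIntegral.integral_of_le ht.1]
    refine congrArg₂ _ rfl (setIntegral_congr_ae measurableSet_Ioc ?_)
    filter_upwards [(ae_restrict_iff' measurableSet_Ici).1 h.2.1.2] with s hs hst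
    have := hs hst.1.le
    rw [if_pos ⟨fun i => (this.1 i).1, this.2⟩, mix_apply]

end Trajectories

/-- In dimension `d ≤ 3`, a periodically asymptotically stable linear switched system is
globally uniformly exponentially stable. -/
theorem linear_periodic_stability_implies_GUES
    (d N : ℕ) (hd1 : 1 ≤ d) (hd3 : d ≤ 3)
    (A : Fin N → EuclideanSpace ℝ (Fin d) →L[ℝ] EuclideanSpace ℝ (Fin d))
    (hPAS : ∀ (u : Fin N → ℝ → ℝ) (x : ℝ≥0 → EuclideanSpace ℝ (Fin d)),
      IsLinTrajectoryWith A u x → (IsConstantLaw u ∨ IsPeriodicLaw u) →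
      Tendsto x atTop (𝓝 0)) :
    ∃ C κ : ℝ, 0 < C ∧ 0 < κ ∧
      ∀ (u : Fin N → ℝ → ℝ) (x : ℝ≥0 → EuclideanSpace ℝ (Fin d)),
        IsLinTrajectoryWith A u x →
        ∀ t : ℝ≥0, ‖x t‖ ≤ C * Real.exp (-κ * (t : ℝ)) * ‖x 0‖ := by
  by_cases hN : (stdSimplex ℝ (Fin N)).Nonempty
  swap
  · exact ⟨1, 1, one_pos, one_pos, fun u x h => absurd h.2.1.nonempty_stdSimplex hN⟩
  have hpow : PowerStable (reach A) := powerStable_reach fun u hu T hT hut x hx => by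
    have h1 := hPAS _ _ (IsSol.isLinTrajectoryWith hu hx)
      (Or.inr ⟨T, hT, fun i => ae_of_all _ fun s => congrFun (hut s) i⟩)
    refine (h1.comp tendsto_real_toNNReal_atTop).congr' ?_
    filter_upwards [eventually_ge_atTop 0] with s hs
    exact congrArg x (Real.coe_toNNReal s hs)
  obtain ⟨a, ha, C, hC, hbound⟩ :=
    (isEvolution_reach A hN).exists_neg_expBound (by simpa using hd3) hpow
  refine ⟨C, -a, hC, neg_pos.2 ha, fun u x h t => ?_⟩
  obtain ⟨w, hw, hx⟩ := h.exists_isSol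
  obtain ⟨Φ, h0, hΦ⟩ := hw.exists_fundamental (L := A)
  have h1 := (hx t).eq_of_eq_zero hw (hΦ (x 0) t) (by simp [h0]) (Set.right_mem_Icc.2 t.2)
  rw [Real.toNNReal_coe] at h1
  rw [h1, neg_neg]
  exact (Φ t).le_of_opNorm_le (hbound t t.2 _ (hw.mem_reach h0 hΦ t.2)) _
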